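/- Log^=_xd 𝒞_diff and Log^=_xd 𝒞_ftime are decidable, but Log^=_xd(𝒞_diff ⊗ 𝒞_diff ⊗ 𝒞_ftime) is undecidable. -/

import Mathlib

namespace OneVarEq

/-- A Kripke `M`-frame. -/
structure KFrame (M : Type) where
  W : Type
  ne : Nonempty W
  R : M → W → W → Prop

/-- the two domain semantics: expanding (`xd`) and constant (`cd`) domains -/
inductive DSem : Type
  | xd | cd
  deriving DecidableEq

/-- disjoint union of a family of frames -/
def KFrame.disjUnion {M ι : Type} (hι : Nonempty ι) (Fs : ι → KFrame M) : KFrame M where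
  W := Σ i, (Fs i).W
  ne := ⟨⟨Classical.choice hι, Classical.choice (Fs (Classical.choice hι)).ne⟩⟩
  R := fun m a b => ∃ (i : ι) (w v : (Fs i).W), (Fs i).R m w v ∧ a = ⟨i, w⟩ ∧ b = ⟨i, v⟩

/-- a class of frames closed under (arbitrary) disjoint unions -/
def ClosedDU {M : Type} (C : Set (KFrame M)) : Prop :=
  ∀ (ι : Type) (hι : Nonempty ι) (Fs : ι → KFrame M),
    (∀ i, Fs i ∈ C) → KFrame.disjUnion hι Fs ∈ C

/-- reduct of a frame along a map of modal signatures -/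
def KFrame.reduct {M M' : Type} (f : M' → M) (F : KFrame M) : KFrame M' :=
  ⟨F.W, F.ne, fun m => F.R (f m)⟩

/-- fusion `𝒞1 ⊗ 𝒞2` of classes of frames: frames over a common set of worlds
whose reducts belong to the respective classes -/
def frameFusion {M1 M2 : Type} (C1 : Set (KFrame M1)) (C2 : Set (KFrame M2)) :
    Set (KFrame (M1 ⊕ M2)) :=
  {F | F.reduct Sum.inl ∈ C1 ∧ F.reduct Sum.inr ∈ C2}

/-- a non-trivial frame: some `R_□` relates two distinct worlds -/
def KFrame.Nontrivial {M : Type} (F : KFrame M) : Prop :=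
  ∃ (m : M) (w v : F.W), w ≠ v ∧ F.R m w v

/-- terms of the one-variable language with constants: the variable `x`,
or a constant `c_k` -/
inductive ETm : Type
  | var : ETm
  | const : ℕ → ETm
  deriving DecidableEq

/-- One-variable modal formulas with equality and (non-rigid) constants. -/
inductive EF (M : Type) : Type
  | pred : ℕ → ETm → EF M
  | eq : ETm → ETm → EF M
  | neg : EF M → EF M
  | and : EF M → EF M → EF M
  | ex : EF M → EF M
  | box : M → EF M → EF M
  deriving DecidableEq

namespace EF

variable {M : Type}

def imp (φ ψ : EF M) : EF M := .neg (.and φ (.neg ψ))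

def or (φ ψ : EF M) : EF M := .neg (.and (.neg φ) (.neg ψ))

def iff (φ ψ : EF M) : EF M := .and (imp φ ψ) (imp ψ φ)

def all (φ : EF M) : EF M := .neg (.ex (.neg φ))

end EF

/-- A Kripke model with equality (expanding domains in general): a family of
normal classical structures over subsets of one big domain, with non-rigid
constants, expanding along all accessibility relations. -/
structure EModel {M : Type} (F : KFrame M) where
  D : Type
  dom : F.W → Set D
  domNe : ∀ w, (dom w).Nonempty
  expand : ∀ (m : M) (w v : F.W), F.R m w v → dom w ⊆ dom v
  I : F.W → ℕ → Set D
  cst : F.W → ℕ → D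
  cstMem : ∀ w k, cst w k ∈ dom w

namespace EModel

variable {M : Type} {F : KFrame M}

/-- a `d`-model: for `cd`, all the domains coincide (with the common domain) -/
def IsD (𝔪 : EModel F) (d : DSem) : Prop :=
  d = DSem.cd → ∀ w, 𝔪.dom w = Set.univ

/-- value of a term at a world under an assignment -/
def tmVal (𝔪 : EModel F) (w : F.W) (a : 𝔪.D) : ETm → 𝔪.D
  | .var => a
  | .const k => 𝔪.cst w k

/-- truth at a world under an assignment; `=` is interpreted as identity -/
def eval (𝔪 : EModel F) : EF M → F.W → 𝔪.D → Prop
  | .pred n t, w, a => 𝔪.tmVal w a t ∈ 𝔪.I w n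
  | .eq t₁ t₂, w, a => 𝔪.tmVal w a t₁ = 𝔪.tmVal w a t₂
  | .neg φ, w, a => ¬ 𝔪.eval φ w a
  | .and φ ψ, w, a => 𝔪.eval φ w a ∧ 𝔪.eval ψ w a
  | .ex φ, w, _ => ∃ b ∈ 𝔪.dom w, 𝔪.eval φ w b
  | .box m φ, w, a => ∀ v, F.R m w v → 𝔪.eval φ v a

def TrueAt (𝔪 : EModel F) (φ : EF M) (w : F.W) : Prop :=
  ∀ a ∈ 𝔪.dom w, 𝔪.eval φ w a

def TrueIn (𝔪 : EModel F) (φ : EF M) : Prop := ∀ w, 𝔪.TrueAt φ w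

end EModel

/-- `Log^=_d 𝒞`: formulas with equality true in every `d`-model with equality
based on a frame from `𝒞` -/
def LogED {M : Type} (d : DSem) (C : Set (KFrame M)) : Set (EF M) :=
  {φ | ∀ F ∈ C, ∀ 𝔪 : EModel F, 𝔪.IsD d → 𝔪.TrueIn φ}

/-- global consequence `φ ⊢*_L ψ` -/
inductive GlobalConseqE {M : Type} (L : Set (EF M)) (φ : EF M) : EF M → Prop
  | ax {ψ} : ψ ∈ L → GlobalConseqE L φ ψ
  | prem : GlobalConseqE L φ φ
  | mp {ψ χ} : GlobalConseqE L φ (EF.imp ψ χ) → GlobalConseqE L φ ψ → GlobalConseqE L φ χ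
  | gen {ψ} : GlobalConseqE L φ ψ → GlobalConseqE L φ (EF.all ψ)
  | nec (m : M) {ψ} : GlobalConseqE L φ ψ → GlobalConseqE L φ (EF.box m ψ)

/-- Gödel numbering of terms -/
def ETm.code : ETm → ℕ
  | .var => 0
  | .const k => k + 1

/-- the fixed Gödel numbering of formulas with equality (relative to a
numbering `eM` of the modal operators) -/
def EF.encode {M : Type} (eM : M → ℕ) : EF M → ℕ
  | .pred n t => Nat.pair 0 (Nat.pair n t.code)
  | .eq t₁ t₂ => Nat.pair 1 (Nat.pair t₁.code t₂.code)
  | .neg φ => Nat.pair 2 (EF.encode eM φ)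
  | .and φ ψ => Nat.pair 3 (Nat.pair (EF.encode eM φ) (EF.encode eM ψ))
  | .ex φ => Nat.pair 4 (EF.encode eM φ)
  | .box m φ => Nat.pair 5 (Nat.pair (eM m) (EF.encode eM φ))

/-- decidability of a set of formulas w.r.t. the fixed Gödel numbering -/
def DecidableELogic {M : Type} (eM : M → ℕ) (L : Set (EF M)) : Prop :=
  ComputablePred (fun n : ℕ => ∃ φ ∈ L, EF.encode eM φ = n)

/-- decidability of the global consequence relation of `L` -/
def GloballyDecidableE {M : Type} (eM : M → ℕ) (L : Set (EF M)) : Prop :=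
  ComputablePred (fun p : ℕ × ℕ =>
    ∃ φ ψ, GlobalConseqE L φ ψ ∧ EF.encode eM φ = p.1 ∧ EF.encode eM ψ = p.2)

/-- recursive enumerability (= recursive axiomatisability) of a set of
formulas w.r.t. the fixed Gödel numbering -/
def REELogic {M : Type} (eM : M → ℕ) (L : Set (EF M)) : Prop :=
  REPred (fun n : ℕ => ∃ φ ∈ L, EF.encode eM φ = n)

/-- the class `𝒟` of all disjoint unions of difference frames -/
def Dclass : Set (KFrame Unit) :=
  {F | ∃ (ι : Type) (f : F.W → ι), ∀ w v, F.R () w v ↔ (f w = f v ∧ w ≠ v)}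

/-- the class `𝒟_fin` of all disjoint unions of finite difference frames -/
def DfinClass : Set (KFrame Unit) :=
  {F | ∃ (ι : Type) (f : F.W → ι),
    (∀ w v, F.R () w v ↔ (f w = f v ∧ w ≠ v)) ∧ ∀ w, {v | f v = f w}.Finite}

/-- numbering of the trivial monomodal signature -/
def eU : Unit → ℕ := fun _ => 0

/-- numbering of the bimodal signature `Unit ⊕ Unit` -/
def eUU : Unit ⊕ Unit → ℕ := Sum.elim (fun _ => 0) (fun _ => 1)

end OneVarEq

namespace OneVarEq

/-! ### Propositional modal logic (to define the frame classes) -/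

/-- propositional modal formulas over modal signature `M` -/
inductive PF (M : Type) : Type
  | atom : ℕ → PF M
  | neg : PF M → PF M
  | and : PF M → PF M → PF M
  | box : M → PF M → PF M
  deriving DecidableEq

namespace PF

variable {M : Type}

def imp (φ ψ : PF M) : PF M := .neg (.and φ (.neg ψ))

def or (φ ψ : PF M) : PF M := .neg (.and (.neg φ) (.neg ψ))

def dia (m : M) (φ : PF M) : PF M := .neg (.box m (.neg φ))

/-- uniform substitution -/
def substP (σ : ℕ → PF M) : PF M → PF M
  | atom n => σ n
  | neg φ => neg (substP σ φ)
  | and φ ψ => and (substP σ φ) (substP σ ψ)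
  | box m φ => box m (substP σ φ)

end PF

/-- evaluation treating atoms and boxed formulas as atomic; used to define
classical tautologies in the modal language -/
def tautEval {M : Type} (v : PF M → Prop) : PF M → Prop
  | .atom n => v (.atom n)
  | .neg φ => ¬ tautEval v φ
  | .and φ ψ => tautEval v φ ∧ tautEval v ψ
  | .box m φ => v (.box m φ)

/-- classical tautologies of the propositional modal language -/
def IsTaut {M : Type} (φ : PF M) : Prop := ∀ v, tautEval v φ

/-- a (normal) propositional modal `M`-logic -/
structure IsPLogic {M : Type} (L : Set (PF M)) : Prop where
  taut : ∀ φ, IsTaut φ → φ ∈ L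
  kax : ∀ (m : M) (n k : ℕ),
    PF.imp (.box m (PF.imp (.atom n) (.atom k)))
      (PF.imp (.box m (.atom n)) (.box m (.atom k))) ∈ L
  mp : ∀ φ ψ, PF.imp φ ψ ∈ L → φ ∈ L → ψ ∈ L
  nec : ∀ m φ, φ ∈ L → PF.box m φ ∈ L
  subst : ∀ (σ : ℕ → PF M) φ, φ ∈ L → PF.substP σ φ ∈ L

/-- truth of a propositional formula in a Kripke model -/
def PVal {M : Type} {F : KFrame M} (V : ℕ → F.W → Prop) : PF M → F.W → Prop
  | .atom n, w => V n w
  | .neg φ, w => ¬ PVal V φ w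
  | .and φ ψ, w => PVal V φ w ∧ PVal V ψ w
  | .box m φ, w => ∀ v, F.R m w v → PVal V φ v

/-- validity of a propositional formula on a frame -/
def PValid {M : Type} (F : KFrame M) (φ : PF M) : Prop :=
  ∀ (V : ℕ → F.W → Prop) (w : F.W), PVal (F := F) V φ w

/-- the logic `Diff`: the smallest normal monomodal logic containing
`p → □◇p` and `◇p → □(p ∨ ◇p)` -/
def Diff : Set (PF Unit) :=
  ⋂₀ {L | IsPLogic L ∧
    PF.imp (.atom 0) (.box () (PF.dia () (.atom 0))) ∈ L ∧
    PF.imp (PF.dia () (.atom 0)) (.box () (PF.or (.atom 0) (PF.dia () (.atom 0)))) ∈ L}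

/-- `𝒞_diff`: all monomodal frames validating every formula of `Diff` -/
def Cdiff : Set (KFrame Unit) := {F | ∀ φ ∈ Diff, PValid F φ}

/-- a frame `(W, S, R)` with `R` a finite strict linear order and `S` its
immediate-successor relation (`false` is `S`, `true` is `R`) -/
def FTimeFrame (F : KFrame Bool) : Prop :=
  Finite F.W ∧
  (∀ w, ¬ F.R true w w) ∧
  (∀ w v u, F.R true w v → F.R true v u → F.R true w u) ∧
  (∀ w v, w ≠ v → F.R true w v ∨ F.R true v w) ∧
  (∀ w v, F.R false w v ↔ (F.R true w v ∧ ¬ ∃ u, F.R true w u ∧ F.R true u v))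

/-- the logic `LTL_f`: bimodal formulas valid on all finite strict linear
orders with their successor relation -/
def LTLf : Set (PF Bool) := {φ | ∀ F : KFrame Bool, FTimeFrame F → PValid F φ}

/-- `𝒞_ftime`: all bimodal frames validating every formula of `LTL_f` -/
def Cftime : Set (KFrame Bool) := {F | ∀ φ ∈ LTLf, PValid F φ}

/-- numbering of the `Bool` signature -/
def eB : Bool → ℕ := fun b => cond b 1 0

/-- numbering of the combined signature of `𝒞_diff ⊗ 𝒞_diff ⊗ 𝒞_ftime` -/
def eS3 : Unit ⊕ (Unit ⊕ Bool) → ℕ :=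
  Sum.elim (fun _ => 0) (Sum.elim (fun _ => 1) (fun b => cond b 3 2))


end OneVarEq

namespace OneVarEq

/-! ### frame facts -/
def IsDiff {W : Type} (R : W → W → Prop) : Prop :=
  (∀ w v, R w v → R v w) ∧ ∀ w v u, R w v → R w u → u = v ∨ R u v

theorem isPLogic_valid {M : Type} (F : KFrame M) : IsPLogic {φ | PValid F φ} where
  taut := by
    intro φ h V w
    have key : ∀ ψ : PF M, tautEval (fun χ => PVal (F := F) V χ w) ψ ↔ PVal (F := F) V ψ w := by
      intro ψ
      induction ψ with
      | atom n => rfl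
      | neg φ ih => simp [tautEval, PVal, ih]
      | and φ ψ ih1 ih2 => simp [tautEval, PVal, ih1, ih2]
      | box m φ => rfl
    exact (key φ).1 (h _)
  kax := by
    intro m n k V w
    simp only [PF.imp, PVal]
    grind
  mp := by
    intro φ ψ h1 h2 V w
    have a := h1 V w
    have b := h2 V w
    simp only [PF.imp, PVal] at a
    grind
  nec := by
    intro m φ h V w v _
    exact h V v
  subst := by
    intro σ φ h V w
    have key : ∀ (ψ : PF M) u, PVal (F := F) V (PF.substP σ ψ) u ↔
        PVal (F := F) (fun n x => PVal (F := F) V (σ n) x) ψ u := by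
      intro ψ
      induction ψ with
      | atom n => intro u; rfl
      | neg φ ih => intro u; simp [PF.substP, PVal, ih]
      | and φ ψ ih1 ih2 => intro u; simp [PF.substP, PVal, ih1, ih2]
      | box m φ ih => intro u; simp [PF.substP, PVal, ih]
    exact (key φ w).2 (h _ w)

theorem mem_Cdiff_iff (F : KFrame Unit) : F ∈ Cdiff ↔ IsDiff (F.R ()) := by
  constructor
  · intro h
    have h1 : PF.imp (.atom 0) (.box () (PF.dia () (.atom 0))) ∈ Diff := by
      rintro L ⟨_, h1, _⟩; exact h1
    have h2 : PF.imp (PF.dia () (.atom 0)) (.box () (PF.or (.atom 0) (PF.dia () (.atom 0)))) ∈ Diff := by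
      rintro L ⟨_, _, h1⟩; exact h1
    refine ⟨fun w v hwv => ?_, fun w v u hwv hwu => ?_⟩
    · have := h _ h1 (fun _ x => x = w) w
      simp only [PF.imp, PF.dia, PVal] at this
      grind
    · have := h _ h2 (fun _ x => x = v) w
      simp only [PF.imp, PF.dia, PF.or, PVal] at this
      grind
  · rintro ⟨hs, ht⟩ φ hφ
    refine hφ {φ | PValid F φ} ⟨isPLogic_valid F, ?_, ?_⟩
    · intro V w
      simp only [PF.imp, PF.dia, PVal]
      grind
    · intro V w
      simp only [PF.imp, PF.dia, PF.or, PVal]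
      grind

theorem ETm.code_inj {s t : ETm} (h : s.code = t.code) : s = t := by
  cases s <;> cases t <;> simp_all [ETm.code]

theorem encode_inj {M : Type} {eM : M → ℕ} (hM : Function.Injective eM) :
    ∀ φ ψ : EF M, φ.encode eM = ψ.encode eM → φ = ψ := by
  intro φ
  induction φ with
  | pred n t =>
    intro ψ h
    cases ψ <;> simp [EF.encode, Nat.pair_eq_pair] at h
    obtain ⟨rfl, h⟩ := h; rw [ETm.code_inj h]
  | eq s t =>
    intro ψ h
    cases ψ <;> simp [EF.encode, Nat.pair_eq_pair] at h
    rw [ETm.code_inj h.1, ETm.code_inj h.2]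
  | neg φ ih =>
    intro ψ h
    cases ψ <;> simp [EF.encode, Nat.pair_eq_pair] at h
    rw [ih _ h]
  | and φ ψ ih1 ih2 =>
    intro ψ h
    cases ψ <;> simp [EF.encode, Nat.pair_eq_pair] at h
    rw [ih1 _ h.1, ih2 _ h.2]
  | ex φ ih =>
    intro ψ h
    cases ψ <;> simp [EF.encode, Nat.pair_eq_pair] at h
    rw [ih _ h]
  | box m φ ih =>
    intro ψ h
    cases ψ <;> simp [EF.encode, Nat.pair_eq_pair] at h
    rw [ih _ h.2, hM h.1]

section evalsimp
variable {M : Type} {F : KFrame M} (𝔪 : EModel F)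
theorem eval_neg' (φ : EF M) (w a) : 𝔪.eval (.neg φ) w a ↔ ¬ 𝔪.eval φ w a := Iff.rfl
theorem eval_and' (φ ψ : EF M) (w a) : 𝔪.eval (.and φ ψ) w a ↔ 𝔪.eval φ w a ∧ 𝔪.eval ψ w a := Iff.rfl
theorem eval_ex' (φ : EF M) (w a) : 𝔪.eval (.ex φ) w a ↔ ∃ b ∈ 𝔪.dom w, 𝔪.eval φ w b := Iff.rfl
theorem eval_box' (m : M) (φ : EF M) (w a) :
    𝔪.eval (.box m φ) w a ↔ ∀ v, F.R m w v → 𝔪.eval φ v a := Iff.rfl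
theorem eval_imp' (φ ψ : EF M) (w a) :
    𝔪.eval (EF.imp φ ψ) w a ↔ (𝔪.eval φ w a → 𝔪.eval ψ w a) := by
  simp [EF.imp, EModel.eval]
theorem eval_or' (φ ψ : EF M) (w a) :
    𝔪.eval (EF.or φ ψ) w a ↔ (𝔪.eval φ w a ∨ 𝔪.eval ψ w a) := by
  simp [EF.or, EModel.eval]; tauto
theorem eval_iff' (φ ψ : EF M) (w a) :
    𝔪.eval (EF.iff φ ψ) w a ↔ (𝔪.eval φ w a ↔ 𝔪.eval ψ w a) := by
  simp only [EF.iff, eval_and', eval_imp']; tauto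
theorem eval_all' (φ : EF M) (w a) :
    𝔪.eval (EF.all φ) w a ↔ ∀ b ∈ 𝔪.dom w, 𝔪.eval φ w b := by
  simp [EF.all, EModel.eval]
end evalsimp
end OneVarEq

namespace OneVarEq
open Function

/-- definability syntax: existential/sum descriptions of relations on ℕ -/
inductive Dv : Type
  | zero : ℕ → Dv
  | one : ℕ → Dv
  | and : Dv → Dv → Dv
  | or : Dv → Dv → Dv
  | ex : ℕ → Dv → Dv
  | sum : (ℕ → ℕ) → List ℕ → Dv → Dv

def Dv.sem : Dv → (ℕ → ℕ) → Prop
  | .zero i, v => v i = 0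
  | .one i, v => v i = 1
  | .and d e, v => d.sem v ∧ e.sem v
  | .or d e, v => d.sem v ∨ e.sem v
  | .ex k d, v => ∃ n, d.sem (update v k n)
  | .sum κ ls d, v => ∃ L : List (ℕ → ℕ), (∀ u ∈ L, d.sem u ∧ ∀ i, i ∉ ls → u i = v i) ∧
      ∀ l ∈ ls, v (κ l) = (L.map (fun u => u l)).sum

def listBd (ls : List ℕ) : ℕ := ls.foldr (fun a b => max (a+1) b) 0

theorem lt_listBd {ls : List ℕ} {a : ℕ} (h : a ∈ ls) : a < listBd ls := by
  induction ls with
  | nil => simp at h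
  | cons b t ih =>
    simp only [listBd, List.foldr] at *
    rcases List.mem_cons.1 h with h | h
    · omega
    · have := ih h; omega

def Dv.bd : Dv → ℕ
  | .zero i => i + 1
  | .one i => i + 1
  | .and d e => max d.bd e.bd
  | .or d e => max d.bd e.bd
  | .ex k d => max (k+1) d.bd
  | .sum κ ls d => max d.bd (max (listBd ls) (listBd (ls.map κ)))

theorem Dv.sem_congr (d : Dv) : ∀ v v' : ℕ → ℕ, (∀ i < d.bd, v i = v' i) → d.sem v → d.sem v' := by
  induction d with
  | zero i => intro v v' h hs; simp only [Dv.sem, Dv.bd] at *; rw [← h i (by omega)]; exact hs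
  | one i => intro v v' h hs; simp only [Dv.sem, Dv.bd] at *; rw [← h i (by omega)]; exact hs
  | and d e ihd ihe =>
    intro v v' h hs; simp only [Dv.sem, Dv.bd] at *
    exact ⟨ihd _ _ (fun i hi => h i (by omega)) hs.1, ihe _ _ (fun i hi => h i (by omega)) hs.2⟩
  | or d e ihd ihe =>
    intro v v' h hs; simp only [Dv.sem, Dv.bd] at *
    rcases hs with hs | hs
    · exact Or.inl (ihd _ _ (fun i hi => h i (by omega)) hs)
    · exact Or.inr (ihe _ _ (fun i hi => h i (by omega)) hs)
  | ex k d ih =>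
    intro v v' h hs; simp only [Dv.sem, Dv.bd] at *
    obtain ⟨n, hn⟩ := hs
    refine ⟨n, ih _ _ (fun i hi => ?_) hn⟩
    by_cases hk : i = k
    · subst hk; simp
    · rw [update_of_ne hk, update_of_ne hk]; exact h i (by omega)
  | sum κ ls d ih =>
    intro v v' h hs; simp only [Dv.sem, Dv.bd] at *
    obtain ⟨L, hL, hsum⟩ := hs
    classical
    refine ⟨L.map (fun u i => if i ∈ ls then u i else v' i), ?_, ?_⟩
    · intro u hu
      obtain ⟨u0, hu0, rfl⟩ := List.mem_map.1 hu
      refine ⟨ih _ _ (fun i hi => ?_) (hL u0 hu0).1, fun i hi => by simp [hi]⟩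
      by_cases hi' : i ∈ ls
      · simp [hi']
      · simp only [hi', if_false]
        rw [(hL u0 hu0).2 i hi']; exact h i (by omega)
    · intro l hl
      rw [← h (κ l) (by have := lt_listBd (List.mem_map_of_mem (f := κ) hl); omega), hsum l hl]
      simp [List.map_map, Function.comp_def, hl]

def Rp (R : (ℕ → ℕ) → Prop) : Prop := ∃ d : Dv, ∀ v, d.sem v ↔ R v

theorem Rp.of_iff {R S : (ℕ → ℕ) → Prop} (h : Rp R) (e : ∀ v, R v ↔ S v) : Rp S := by
  obtain ⟨d, hd⟩ := h; exact ⟨d, fun v => (hd v).trans (e v)⟩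

theorem Rp.dep {R : (ℕ → ℕ) → Prop} (h : Rp R) :
    ∃ N, ∀ v v' : ℕ → ℕ, (∀ i < N, v i = v' i) → R v → R v' := by
  obtain ⟨d, hd⟩ := h
  exact ⟨d.bd, fun v v' hv hr => (hd v').1 (d.sem_congr v v' hv ((hd v).2 hr))⟩

theorem Rp.and {R S : (ℕ → ℕ) → Prop} (h : Rp R) (g : Rp S) : Rp fun v => R v ∧ S v := by
  obtain ⟨d, hd⟩ := h; obtain ⟨e, he⟩ := g
  exact ⟨.and d e, fun v => by simp [Dv.sem, hd, he]⟩

theorem Rp.or {R S : (ℕ → ℕ) → Prop} (h : Rp R) (g : Rp S) : Rp fun v => R v ∨ S v := by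
  obtain ⟨d, hd⟩ := h; obtain ⟨e, he⟩ := g
  exact ⟨.or d e, fun v => by simp [Dv.sem, hd, he]⟩

theorem Rp.ex {R : (ℕ → ℕ) → Prop} (k : ℕ) (h : Rp R) : Rp fun v => ∃ n, R (update v k n) := by
  obtain ⟨d, hd⟩ := h
  exact ⟨.ex k d, fun v => by simp [Dv.sem, hd]⟩

theorem Rp.sum {R : (ℕ → ℕ) → Prop} (κ : ℕ → ℕ) (ls : List ℕ) (h : Rp R) :
    Rp fun v => ∃ L : List (ℕ → ℕ), (∀ u ∈ L, R u ∧ ∀ i, i ∉ ls → u i = v i) ∧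
      ∀ l ∈ ls, v (κ l) = (L.map (fun u => u l)).sum := by
  obtain ⟨d, hd⟩ := h
  exact ⟨.sum κ ls d, fun v => by simp [Dv.sem, hd]⟩

theorem Rp.zero (i : ℕ) : Rp fun v => v i = 0 := ⟨.zero i, fun _ => Iff.rfl⟩
theorem Rp.one (i : ℕ) : Rp fun v => v i = 1 := ⟨.one i, fun _ => Iff.rfl⟩

theorem Rp.eq (i j : ℕ) : Rp fun v => v i = v j := by
  refine ((((Rp.one 0).and (Rp.one 1))).sum (fun l => if l = 0 then i else j) [0,1]).of_iff ?_
  intro v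
  constructor
  · rintro ⟨L, hL, hs⟩
    have h0 := hs 0 (by simp)
    have h1 := hs 1 (by simp)
    simp only [if_true, one_ne_zero, if_false] at h0 h1
    rw [h0, h1]
    congr 1
    apply List.map_congr_left
    intro u hu
    rw [(hL u hu).1.1, (hL u hu).1.2]
  · intro h
    refine ⟨List.replicate (v i) (fun k => if k < 2 then 1 else v k), ?_, ?_⟩
    · intro u hu
      rw [List.eq_of_mem_replicate hu]
      refine ⟨by simp, ?_⟩
      intro k hk
      have : ¬ k < 2 := by simp at hk; omega
      simp [this]
    · intro l hl
      simp at hl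
      rcases hl with rfl | rfl <;> simp [h]

theorem Rp.add (i j k : ℕ) : Rp fun v => v k = v i + v j := by
  refine ((((Rp.one 0).and ((Rp.zero 1).and (Rp.one 2))).or
    ((Rp.zero 0).and ((Rp.one 1).and (Rp.one 2)))).sum
      (fun l => if l = 0 then i else if l = 1 then j else k) [0,1,2]).of_iff ?_
  intro v
  constructor
  · rintro ⟨L, hL, hs⟩
    have h0 := hs 0 (by simp)
    have h1 := hs 1 (by simp)
    have h2 := hs 2 (by simp)
    simp at h0 h1 h2
    rw [h0, h1, h2, ← List.sum_map_add]
    congr 1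
    apply List.map_congr_left
    intro u hu
    rcases (hL u hu).1 with h | h <;> omega
  · intro h
    refine ⟨List.replicate (v i) (fun k => if k = 1 then 0 else if k < 3 then 1 else v k) ++
      List.replicate (v j) (fun k => if k = 0 then 0 else if k < 3 then 1 else v k), ?_, ?_⟩
    · intro u hu
      rcases List.mem_append.1 hu with hu | hu
      · rw [List.eq_of_mem_replicate hu]
        refine ⟨by simp, ?_⟩
        intro k hk
        have h3 : ¬ k < 3 := by simp at hk; omega
        have h1 : ¬ k = 1 := by omega
        simp [h3, h1]
      · rw [List.eq_of_mem_replicate hu]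
        refine ⟨by simp, ?_⟩
        intro k hk
        have h3 : ¬ k < 3 := by simp at hk; omega
        have h1 : ¬ k = 0 := by omega
        simp [h3, h1]
    · intro l hl
      simp at hl
      rcases hl with rfl | rfl | rfl <;> simp [h]

theorem Rp.mul (i j k : ℕ) : Rp fun v => v k = v i * v j := by
  refine (((Rp.eq (i+1) i).and (Rp.one (i+2))).sum
      (fun l => if l = i+1 then k else j) [i+1,i+2]).of_iff ?_
  intro v
  constructor
  · rintro ⟨L, hL, hs⟩
    have h0 := hs (i+1) (by simp)
    have h1 := hs (i+2) (by simp)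
    simp at h0 h1
    rw [h0, h1, ← List.sum_map_mul_left]
    congr 1
    apply List.map_congr_left
    intro u hu
    have := hL u hu
    rw [this.1.1, this.1.2, this.2 i (by simp), mul_one]
  · intro h
    refine ⟨List.replicate (v j) (fun k => if k = i+1 then v i else if k = i+2 then 1 else v k), ?_, ?_⟩
    · intro u hu
      rw [List.eq_of_mem_replicate hu]
      refine ⟨by simp, ?_⟩
      intro k hk
      simp at hk
      simp [hk]
    · intro l hl
      simp at hl
      rcases hl with rfl | rfl <;> simp [h, mul_comm]

/-! natural-number polynomial terms -/
inductive NT (γ : Type) : Type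
  | var : γ → NT γ
  | zero : NT γ
  | one : NT γ
  | add : NT γ → NT γ → NT γ
  | mul : NT γ → NT γ → NT γ

def NT.ev {γ : Type} (v : γ → ℕ) : NT γ → ℕ
  | .var i => v i
  | .zero => 0
  | .one => 1
  | .add a b => a.ev v + b.ev v
  | .mul a b => a.ev v * b.ev v

def NT.map {γ δ : Type} (f : γ → δ) : NT γ → NT δ
  | .var i => .var (f i)
  | .zero => .zero
  | .one => .one
  | .add a b => .add (a.map f) (b.map f)
  | .mul a b => .mul (a.map f) (b.map f)

def NT.vars {γ : Type} : NT γ → List γ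
  | .var i => [i]
  | .zero => []
  | .one => []
  | .add a b => a.vars ++ b.vars
  | .mul a b => a.vars ++ b.vars

theorem NT.ev_map {γ δ : Type} (f : γ → δ) (t : NT γ) (v : δ → ℕ) :
    (t.map f).ev v = t.ev (v ∘ f) := by
  induction t <;> simp_all [NT.map, NT.ev]

theorem NT.ev_congr {γ : Type} (t : NT γ) (v v' : γ → ℕ) (h : ∀ i ∈ t.vars, v i = v' i) :
    t.ev v = t.ev v' := by
  induction t with
  | var i => exact h i (by simp [NT.vars])
  | zero => rfl
  | one => rfl
  | add a b iha ihb =>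
    simp only [NT.ev, NT.vars, List.mem_append] at *
    rw [iha fun i hi => h i (Or.inl hi), ihb fun i hi => h i (Or.inr hi)]
  | mul a b iha ihb =>
    simp only [NT.ev, NT.vars, List.mem_append] at *
    rw [iha fun i hi => h i (Or.inl hi), ihb fun i hi => h i (Or.inr hi)]

theorem NT.ev_update (t : NT ℕ) (v : ℕ → ℕ) (k n : ℕ) (h : listBd t.vars ≤ k) :
    t.ev (update v k n) = t.ev v := by
  apply NT.ev_congr
  intro i hi
  have := lt_listBd hi
  rw [update_of_ne (by omega)]

theorem listBd_append (a b : List ℕ) : listBd (a ++ b) = max (listBd a) (listBd b) := by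
  induction a with
  | nil => simp [listBd]
  | cons x t ih => simp only [listBd, List.cons_append, List.foldr] at *; rw [ih]; omega

theorem Rp.nt (t : NT ℕ) : ∀ k, Rp fun v => v k = t.ev v := by
  induction t with
  | var i => exact fun k => Rp.eq k i
  | zero => exact fun k => Rp.zero k
  | one => exact fun k => Rp.one k
  | add a b iha ihb =>
    intro k
    set m := max (k+1) (max (listBd a.vars) (listBd b.vars)) with hm
    refine (((iha m).and ((ihb (m+1)).and (Rp.add m (m+1) k))).ex m |>.ex (m+1)).of_iff ?_
    intro v
    have e1 : ∀ n n', a.ev (update (update v (m+1) n) m n') = a.ev v := by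
      intro n n'; rw [NT.ev_update _ _ _ _ (by omega), NT.ev_update _ _ _ _ (by omega)]
    have e2 : ∀ n n', b.ev (update (update v (m+1) n) m n') = b.ev v := by
      intro n n'; rw [NT.ev_update _ _ _ _ (by omega), NT.ev_update _ _ _ _ (by omega)]
    have e3 : k ≠ m := by omega
    have e4 : k ≠ m+1 := by omega
    simp [e1, e2, e3, e4, NT.ev]
  | mul a b iha ihb =>
    intro k
    set m := max (k+1) (max (listBd a.vars) (listBd b.vars)) with hm
    refine (((iha m).and ((ihb (m+1)).and (Rp.mul m (m+1) k))).ex m |>.ex (m+1)).of_iff ?_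
    intro v
    have e1 : ∀ n n', a.ev (update (update v (m+1) n) m n') = a.ev v := by
      intro n n'; rw [NT.ev_update _ _ _ _ (by omega), NT.ev_update _ _ _ _ (by omega)]
    have e2 : ∀ n n', b.ev (update (update v (m+1) n) m n') = b.ev v := by
      intro n n'; rw [NT.ev_update _ _ _ _ (by omega), NT.ev_update _ _ _ _ (by omega)]
    have e3 : k ≠ m := by omega
    have e4 : k ≠ m+1 := by omega
    simp [e1, e2, e3, e4, NT.ev]

theorem Rp.nteq (a b : NT ℕ) : Rp fun v => a.ev v = b.ev v := by
  set m := max (listBd a.vars) (listBd b.vars) with hm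
  refine (((Rp.nt a m).and (Rp.nt b m)).ex m).of_iff ?_
  intro v
  have e1 : ∀ n, a.ev (update v m n) = a.ev v := fun n => NT.ev_update _ _ _ _ (by omega)
  have e2 : ∀ n, b.ev (update v m n) = b.ev v := fun n => NT.ev_update _ _ _ _ (by omega)
  simp [e1, e2]

def NT.ofNat {γ : Type} : ℕ → NT γ
  | 0 => .zero
  | n+1 => .add (NT.ofNat n) .one

theorem NT.ev_ofNat {γ : Type} (v : γ → ℕ) (n : ℕ) : (NT.ofNat n).ev v = n := by
  induction n <;> simp_all [NT.ofNat, NT.ev]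

theorem poly_nt {γ : Type} (p : Poly γ) : ∃ a b : NT γ, ∀ v, p v = (a.ev v : ℤ) - b.ev v := by
  induction p using Poly.induction with
  | H1 i => exact ⟨.var i, .zero, fun v => by simp [NT.ev]⟩
  | H2 n =>
    refine ⟨NT.ofNat n.toNat, NT.ofNat (-n).toNat, fun v => ?_⟩
    simp only [NT.ev_ofNat, Poly.const_apply]; omega
  | H3 f g hf hg =>
    obtain ⟨a, b, h⟩ := hf; obtain ⟨c, d, h'⟩ := hg
    refine ⟨.add a d, .add b c, fun v => ?_⟩
    simp only [Poly.sub_apply, h, h', NT.ev]; push_cast; ring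
  | H4 f g hf hg =>
    obtain ⟨a, b, h⟩ := hf; obtain ⟨c, d, h'⟩ := hg
    refine ⟨.add (.mul a c) (.mul b d), .add (.mul a d) (.mul b c), fun v => ?_⟩
    simp only [Poly.mul_apply, h, h', NT.ev]; push_cast; ring

theorem Rp.exAbove {R : (ℕ → ℕ) → Prop} (h : Rp R) (M : ℕ) :
    Rp fun v => ∃ u, (∀ i < M, u i = v i) ∧ R u := by
  obtain ⟨N, hN⟩ := h.dep
  have key : ∀ k, Rp fun v => ∃ u, (∀ i, (i < M ∨ M + k ≤ i) → u i = v i) ∧ R u := by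
    intro k
    induction k with
    | zero =>
      refine h.of_iff fun v => ⟨fun hr => ⟨v, fun _ _ => rfl, hr⟩, ?_⟩
      rintro ⟨u, hu, hr⟩
      have : u = v := funext fun i => hu i (by omega)
      rwa [← this]
    | succ k ih =>
      refine (ih.ex (M+k)).of_iff fun v => ?_
      constructor
      · rintro ⟨n, u, hu, hr⟩
        refine ⟨u, fun i hi => ?_, hr⟩
        rw [hu i (by omega), update_of_ne (by omega)]
      · rintro ⟨u, hu, hr⟩
        refine ⟨u (M+k), u, fun i hi => ?_, hr⟩
        by_cases e : i = M+k
        · subst e; simp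
        · rw [update_of_ne e]; exact hu i (by omega)
  refine (key N).of_iff fun v => ⟨?_, ?_⟩
  · rintro ⟨u, hu, hr⟩; exact ⟨u, fun i hi => hu i (Or.inl hi), hr⟩
  · rintro ⟨u, hu, hr⟩
    refine ⟨fun i => if M + N ≤ i then v i else u i, fun i hi => ?_, hN u _ (fun i hi => ?_) hr⟩
    · by_cases e : M + N ≤ i
      · simp [e]
      · simp only [e, if_false]; exact hu i (by omega)
    · rw [if_neg (by omega)]

def DR {n : ℕ} (R : (Fin n → ℕ) → Prop) : Prop := ∀ s : Fin n → ℕ, Rp fun v => R (v ∘ s)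

theorem DR.of_dioph {n : ℕ} {S : Set (Fin n → ℕ)} (h : Dioph S) : DR fun v => v ∈ S := by
  classical
  intro s
  obtain ⟨β, p, hp⟩ := h
  obtain ⟨a, b, hab⟩ := poly_nt p
  set vs := a.vars ++ b.vars with hvs
  set M := listBd (List.ofFn s) with hM
  have hsM : ∀ i, s i < M := fun i => lt_listBd (by simp)
  have hidx : ∀ x : β, ∃ j : ℕ, (Sum.inr x : Fin n ⊕ β) ∈ vs → vs[j]? = some (Sum.inr x) := by
    intro x
    by_cases hx : (Sum.inr x : Fin n ⊕ β) ∈ vs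
    · obtain ⟨j, hj⟩ := List.mem_iff_getElem?.1 hx
      exact ⟨j, fun _ => hj⟩
    · exact ⟨0, fun h => absurd h hx⟩
  choose idx hidx using hidx
  let s' : Fin n ⊕ β → ℕ := Sum.elim s (fun x => M + idx x)
  refine ((Rp.nteq (a.map s') (b.map s')).exAbove M).of_iff fun v => ?_
  simp only [NT.ev_map]
  rw [hp]
  constructor
  · rintro ⟨u, hu, he⟩
    refine ⟨fun x => u (s' (Sum.inr x)), ?_⟩
    have e : (Sum.elim (v ∘ s) (fun x => u (s' (Sum.inr x))) : Fin n ⊕ β → ℕ) = u ∘ s' := by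
      funext x
      rcases x with i | x
      · simp [s', hu (s i) (hsM i)]
      · simp
    rw [hab, e, he]; simp
  · rintro ⟨t, ht⟩
    let w : Fin n ⊕ β → ℕ := Sum.elim (v ∘ s) t
    refine ⟨fun i => if i < M then v i else ((vs[i - M]?).map w).getD 0, fun i hi => by simp [hi], ?_⟩
    have key : ∀ x ∈ vs, ((fun i => if i < M then v i else ((vs[i - M]?).map w).getD 0) ∘ s') x = w x := by
      intro x hx
      rcases x with i | x
      · simp [s', hsM i, w]
      · simp [s', hidx x hx]
    rw [NT.ev_congr a _ w (fun x hx => key x (by simp [hvs, hx])),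
      NT.ev_congr b _ w (fun x hx => key x (by simp [hvs, hx]))]
    have := hab w
    change p w = 0 at ht
    omega

theorem DR.and {n : ℕ} {R S : (Fin n → ℕ) → Prop} (h : DR R) (g : DR S) :
    DR fun v => R v ∧ S v := fun s => (h s).and (g s)

theorem DR.of_iff {n : ℕ} {R S : (Fin n → ℕ) → Prop} (h : DR R) (e : ∀ v, R v ↔ S v) : DR S :=
  fun s => (h s).of_iff fun _ => e _

theorem DR.reindex {n m : ℕ} {R : (Fin n → ℕ) → Prop} (h : DR R) (g : Fin n → Fin m) :
    DR fun v => R (v ∘ g) := fun s => h (s ∘ g)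

theorem DR.ex {n : ℕ} {S : ℕ → (Fin n → ℕ) → Prop}
    (h : DR fun v : Fin (n+1) → ℕ => S (v 0) (fun i => v i.succ)) : DR fun v => ∃ x, S x v := by
  intro s
  set M := listBd (List.ofFn s) with hM
  have hsM : ∀ i, s i < M := fun i => lt_listBd (by simp)
  refine ((h (Fin.cons M s)).ex M).of_iff fun v => ?_
  refine exists_congr fun x => ?_
  have : (fun i => update v M x (s i)) = v ∘ s := by
    funext i; rw [update_of_ne (hsM i).ne]; rfl
  simp [this]

/-- binary and ternary definable relations -/
def DR2 (R : ℕ → ℕ → Prop) : Prop := ∀ i j, Rp fun v => R (v i) (v j)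
def DR3 (R : ℕ → ℕ → ℕ → Prop) : Prop := ∀ i j k, Rp fun v => R (v i) (v j) (v k)

theorem DR2.dr {n : ℕ} {R : ℕ → ℕ → Prop} (h : DR2 R) (i j : Fin n) :
    DR fun v => R (v i) (v j) := fun s => h (s i) (s j)
theorem DR3.dr {n : ℕ} {R : ℕ → ℕ → ℕ → Prop} (h : DR3 R) (i j k : Fin n) :
    DR fun v => R (v i) (v j) (v k) := fun s => h (s i) (s j) (s k)

theorem DR.dr2 {R : ℕ → ℕ → Prop} (h : DR fun v : Fin 2 → ℕ => R (v 0) (v 1)) : DR2 R := by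
  intro i j
  simpa using h ![i, j]
theorem DR.dr3 {R : ℕ → ℕ → ℕ → Prop} (h : DR fun v : Fin 3 → ℕ => R (v 0) (v 1) (v 2)) :
    DR3 R := by
  intro i j k
  simpa using h ![i, j, k]

end OneVarEq

namespace OneVarEq
open Function

theorem dr_of_dioph {n : ℕ} {R : (Fin n → ℕ) → Prop} (h : Dioph {v | R v}) : DR R := DR.of_dioph h

theorem dr3_pow : DR3 fun a b c => a ^ b = c := by
  apply DR.dr3
  apply dr_of_dioph
  exact Dioph.eq_dioph (Dioph.pow_dioph (Dioph.proj_dioph 0) (Dioph.proj_dioph 1)) (Dioph.proj_dioph 2)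

theorem dr3_pair : DR3 fun a b c => Nat.pair a b = c := by
  apply DR.dr3
  apply dr_of_dioph
  have p0 : Dioph.DiophFn fun v : Fin 3 → ℕ => v 0 := Dioph.proj_dioph 0
  have p1 : Dioph.DiophFn fun v : Fin 3 → ℕ => v 1 := Dioph.proj_dioph 1
  have p2 : Dioph.DiophFn fun v : Fin 3 → ℕ => v 2 := Dioph.proj_dioph 2
  refine (Dioph.union (Dioph.inter (Dioph.lt_dioph p0 p1)
    (Dioph.eq_dioph (Dioph.add_dioph (Dioph.mul_dioph p1 p1) p0) p2))
    (Dioph.inter (Dioph.le_dioph p1 p0)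
    (Dioph.eq_dioph (Dioph.add_dioph (Dioph.add_dioph (Dioph.mul_dioph p0 p0) p0) p1) p2))).ext ?_
  intro v
  simp only [Set.mem_union, Set.mem_inter_iff, Set.mem_ofPred_eq, Nat.pair]
  split_ifs with h
  · have : ¬ v 1 ≤ v 0 := by omega
    simp [h, this]
  · have : v 1 ≤ v 0 := by omega
    simp [h, this]

theorem dr3_add : DR3 fun a b c => a + b = c := fun i j k => (Rp.add i j k).of_iff fun _ => eq_comm
theorem dr2_eq : DR2 fun a b => a = b := Rp.eq
theorem dr2_lt : DR2 fun a b => a < b := by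
  apply DR.dr2
  exact dr_of_dioph (Dioph.lt_dioph (Dioph.proj_dioph 0) (Dioph.proj_dioph 1))
theorem dr2_succ : DR2 fun a b => a + 1 = b := by
  apply DR.dr2
  exact dr_of_dioph (Dioph.eq_dioph (Dioph.add_dioph (Dioph.proj_dioph 0) (Dioph.const_dioph 1))
    (Dioph.proj_dioph 1))
theorem dr_zero {n : ℕ} (i : Fin n) : DR fun v => v i = 0 := fun s => Rp.zero (s i)
theorem dr_pos {n : ℕ} (i : Fin n) : DR fun v => v i ≠ 0 :=
  dr_of_dioph (Dioph.ne_dioph (Dioph.proj_dioph i) (Dioph.const_dioph 0))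

/-- rows relation used for transitive closure -/
def RowsR (R : ℕ → ℕ → Prop) (B S1 S2 c : ℕ) : Prop :=
  ∃ rows : List (ℕ × ℕ), (∀ r ∈ rows, R r.1 r.2) ∧ S1 = (rows.map fun r => B ^ r.1).sum ∧
    S2 = (rows.map fun r => B ^ r.2).sum ∧ c = rows.length

theorem dr_rows {R : ℕ → ℕ → Prop} (hR : DR2 R) (b i j k : ℕ) :
    Rp fun v => RowsR R (v b) (v i) (v j) (v k) := by
  have inner : DR fun v : Fin 4 → ℕ => ∃ x y, R x y ∧ (v 0) ^ x = v 1 ∧ v 0 ^ y = v 2 ∧ v 3 = 1 := by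
    apply DR.ex
    apply DR.ex
    have h1 := DR2.dr (n := 6) hR 1 0
    have h2 := DR3.dr (n := 6) dr3_pow 2 1 3
    have h3 := DR3.dr (n := 6) dr3_pow 2 0 4
    have h4 : DR fun v : Fin 6 → ℕ => v 5 = 1 := fun s => Rp.one (s 5)
    exact h1.and (h2.and (h3.and h4))
  have inner' := inner ![b, b+1, b+2, b+3]
  refine (inner'.sum (fun l => if l = b+1 then i else if l = b+2 then j else k)
    [b+1,b+2,b+3]).of_iff fun v => ?_
  constructor
  · rintro ⟨L, hL, hs⟩
    have h1 := hs (b+1) (by simp)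
    have h2 := hs (b+2) (by simp)
    have h3 := hs (b+3) (by simp)
    simp at h1 h2 h3
    clear hs
    suffices H : ∃ rows : List (ℕ × ℕ), (∀ r ∈ rows, R r.1 r.2) ∧
        (L.map fun u => u (b+1)).sum = (rows.map fun r => v b ^ r.1).sum ∧
        (L.map fun u => u (b+2)).sum = (rows.map fun r => v b ^ r.2).sum ∧
        (L.map fun u => u (b+3)).sum = rows.length by
      obtain ⟨rows, a1, a2, a3, a4⟩ := H
      exact ⟨rows, a1, h1.trans a2, h2.trans a3, h3.trans a4⟩
    clear h1 h2 h3
    induction L with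
    | nil => exact ⟨[], by simp⟩
    | cons u L ih =>
      obtain ⟨rows, a1, a2, a3, a4⟩ := ih fun u hu => hL u (by simp [hu])
      obtain ⟨⟨x, y, hxy, e1, e2, e3⟩, e4⟩ := hL u (by simp)
      have e5 := e4 b (by simp)
      simp at e1 e2 e3
      refine ⟨(x,y) :: rows, ?_, ?_, ?_, ?_⟩
      · intro r hr
        rcases List.mem_cons.1 hr with rfl | hr
        · exact hxy
        · exact a1 r hr
      · simp [a2, ← e1, e5]
      · simp [a3, ← e2, e5]
      · simp [a4, e3]; omega
  · rintro ⟨rows, h, e1, e2, e3⟩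
    refine ⟨rows.map fun r m => if m = b+1 then v b ^ r.1 else if m = b+2 then v b ^ r.2 else
      if m = b+3 then 1 else v m, ?_, ?_⟩
    · intro u hu
      obtain ⟨r, hr, rfl⟩ := List.mem_map.1 hu
      refine ⟨⟨r.1, r.2, h r hr, ?_⟩, ?_⟩
      · simp
      · intro m hm
        simp at hm
        simp [hm]
    · intro l hl
      simp at hl
      rcases hl with rfl | rfl | rfl
      · simp [e1, List.map_map, Function.comp_def]
      · simp [e2, List.map_map, Function.comp_def]
      · simp [e3, List.map_map, Function.comp_def]

theorem count_eq_of_powsum (B : ℕ) (hB : 1 < B) (l l' : List ℕ) (h1 : l.length < B)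
    (h2 : l'.length < B) (h : (l.map fun x => B ^ x).sum = (l'.map fun x => B ^ x).sum) :
    l.Perm l' := by
  classical
  have key : ∀ m : List ℕ, ∀ n, (∀ x ∈ m, x < n) →
      Nat.ofDigits B ((List.range n).map fun x => m.count x) = (m.map fun x => B ^ x).sum := by
    intro m n hm
    have e : ∀ k, Nat.ofDigits B ((List.range k).map fun x => m.count x) =
        ∑ x ∈ Finset.range k, m.count x * B ^ x := by
      intro k
      induction k with
      | zero => simp
      | succ k ih =>
        rw [List.range_succ, List.map_append, Nat.ofDigits_append, ih, Finset.sum_range_succ]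
        simp [mul_comm]
    rw [e]
    induction m with
    | nil => simp
    | cons a t ih =>
      have ht := ih (fun x hx => hm x (by simp [hx])) (by
        intro k
        induction k with
        | zero => simp
        | succ k ih =>
          rw [List.range_succ, List.map_append, Nat.ofDigits_append, ih, Finset.sum_range_succ]
          simp [mul_comm])
      simp only [List.count_cons, add_mul, Finset.sum_add_distrib, ht, List.map_cons, List.sum_cons]
      rw [Finset.sum_eq_single a]
      · simp [add_comm]
      · intro b _ hb; simp [hb.symm]
      · intro ha; exact absurd (hm a (by simp)) (by simpa using ha)
  set n := max (listBd l) (listBd l')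
  have k1 := key l n fun x hx => lt_of_lt_of_le (lt_listBd hx) (le_max_left _ _)
  have k2 := key l' n fun x hx => lt_of_lt_of_le (lt_listBd hx) (le_max_right _ _)
  have := Nat.ofDigits_inj_of_len_eq hB (L1 := (List.range n).map fun x => l.count x)
    (L2 := (List.range n).map fun x => l'.count x) (by simp)
    (by
      intro d hd
      obtain ⟨x, _, rfl⟩ := List.mem_map.1 hd
      exact lt_of_le_of_lt List.count_le_length h1)
    (by
      intro d hd
      obtain ⟨x, _, rfl⟩ := List.mem_map.1 hd
      exact lt_of_le_of_lt List.count_le_length h2) (by rw [k1, k2, h])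
  rw [List.perm_iff_count]
  intro x
  by_cases hx : x < n
  · exact (List.map_inj_left.1 this) x (by simpa using hx)
  · rw [List.count_eq_zero_of_not_mem fun hm => hx (lt_of_lt_of_le (lt_listBd hm) (le_max_left _ _)),
      List.count_eq_zero_of_not_mem fun hm => hx (lt_of_lt_of_le (lt_listBd hm) (le_max_right _ _))]

theorem tc_iff (R : ℕ → ℕ → Prop) (s t : ℕ) : Relation.ReflTransGen R s t ↔
    ∃ B S1 S2 c, RowsR R B S1 S2 c ∧ c + 1 < B ∧ S1 + B ^ t = S2 + B ^ s := by
  constructor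
  · intro h
    have : ∃ rows : List (ℕ × ℕ), (∀ r ∈ rows, R r.1 r.2) ∧
        ∀ B : ℕ, (rows.map fun r => B ^ r.1).sum + B ^ t = (rows.map fun r => B ^ r.2).sum + B ^ s := by
      induction h with
      | refl => exact ⟨[], by simp⟩
      | tail _ hbc ih =>
        rename_i b c _
        obtain ⟨rows, h1, h2⟩ := ih
        refine ⟨(b, c) :: rows, ?_, ?_⟩
        · intro r hr
          rcases List.mem_cons.1 hr with rfl | hr
          · exact hbc
          · exact h1 r hr
        · intro B
          have := h2 B
          simp only [List.map_cons, List.sum_cons]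
          omega
    obtain ⟨rows, h1, h2⟩ := this
    exact ⟨rows.length + 2, _, _, _, ⟨rows, h1, rfl, rfl, rfl⟩, by omega, h2 _⟩
  · rintro ⟨B, S1, S2, c, ⟨rows, h1, rfl, rfl, rfl⟩, hc, he⟩
    have hp := count_eq_of_powsum B (by omega) (t :: rows.map Prod.fst) (s :: rows.map Prod.snd)
      (by simpa using hc) (by simpa using hc) (by
        simp only [List.map_cons, List.sum_cons, List.map_map, Function.comp_def]; omega)
    classical
    by_contra hcon
    have := hp.countP_eq (fun x => decide (Relation.ReflTransGen R s x))
    rw [List.countP_cons, List.countP_cons, List.countP_map, List.countP_map] at this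
    simp only [hcon, decide_false, Relation.ReflTransGen.refl, decide_true, if_true] at this
    have hle : List.countP ((fun x => decide (Relation.ReflTransGen R s x)) ∘ Prod.fst) rows ≤
        List.countP ((fun x => decide (Relation.ReflTransGen R s x)) ∘ Prod.snd) rows := by
      apply List.countP_mono_left
      intro r hr hx
      simp at hx ⊢
      exact hx.tail (h1 r hr)
    simp only [Bool.false_eq_true, if_false] at this
    omega

theorem dr2_tc {R : ℕ → ℕ → Prop} (hR : DR2 R) : DR2 (Relation.ReflTransGen R) := by
  apply DR.dr2
  have : DR fun v : Fin 2 → ℕ => ∃ B S1 S2 c, RowsR R B S1 S2 c ∧ ∃ p q z, c + 1 = z ∧ z < B ∧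
      B ^ v 1 = p ∧ B ^ v 0 = q ∧ ∃ m, S1 + p = m ∧ S2 + q = m := by
    apply DR.ex; apply DR.ex; apply DR.ex; apply DR.ex
    apply DR.and
    · intro s
      exact dr_rows hR (s 3) (s 2) (s 1) (s 0)
    · apply DR.ex; apply DR.ex; apply DR.ex
      refine (DR2.dr dr2_succ _ _).and ((DR2.dr dr2_lt _ _).and ((DR3.dr dr3_pow _ _ _).and
        ((DR3.dr dr3_pow _ _ _).and ?_)))
      apply DR.ex
      exact (DR3.dr dr3_add _ _ _).and (DR3.dr dr3_add _ _ _)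
  refine this.of_iff fun v => ?_
  rw [tc_iff]
  refine exists_congr fun B => exists_congr fun S1 => exists_congr fun S2 => exists_congr fun c => ?_
  constructor
  · rintro ⟨h, p, q, z, rfl, hz, rfl, rfl, m, rfl, hm⟩
    exact ⟨h, hz, hm.symm⟩
  · rintro ⟨h, hz, hm⟩
    exact ⟨h, _, _, _, rfl, hz, rfl, rfl, _, rfl, hm.symm⟩

theorem dr2_partrec {f : ℕ →. ℕ} (hf : Nat.Partrec f) : DR2 fun a b => b ∈ f a := by
  induction hf with
  | zero =>
    intro i j
    exact (Rp.zero j).of_iff fun v => by simp [pure, PFun.pure]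
  | succ =>
    intro i j
    exact (dr2_succ i j).of_iff fun v => by simp [eq_comm]
  | left =>
    apply DR.dr2
    have : DR fun v : Fin 2 → ℕ => ∃ x, Nat.pair (v 1) x = v 0 := by
      apply DR.ex
      exact DR3.dr dr3_pair _ _ _
    refine this.of_iff fun v => ?_
    simp only [PFun.coe_val, Part.mem_some_iff]
    constructor
    · rintro ⟨x, hx⟩; rw [← hx]; simp
    · intro h; exact ⟨(v 0).unpair.2, by rw [h]; simp⟩
  | right =>
    apply DR.dr2
    have : DR fun v : Fin 2 → ℕ => ∃ x, Nat.pair x (v 1) = v 0 := by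
      apply DR.ex
      exact DR3.dr dr3_pair _ _ _
    refine this.of_iff fun v => ?_
    simp only [PFun.coe_val, Part.mem_some_iff]
    constructor
    · rintro ⟨x, hx⟩; rw [← hx]; simp
    · intro h; exact ⟨(v 0).unpair.1, by rw [h]; simp⟩
  | @pair f g _ _ ihf ihg =>
    apply DR.dr2
    have : DR fun v : Fin 2 → ℕ => ∃ x y, x ∈ f (v 0) ∧ y ∈ g (v 0) ∧ Nat.pair x y = v 1 := by
      apply DR.ex; apply DR.ex
      exact (DR2.dr ihf _ _).and ((DR2.dr ihg _ _).and (DR3.dr dr3_pair _ _ _))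
    refine this.of_iff fun v => ?_
    simp [Seq.seq]
  | @comp f g _ _ ihf ihg =>
    apply DR.dr2
    have : DR fun v : Fin 2 → ℕ => ∃ x, x ∈ g (v 0) ∧ v 1 ∈ f x := by
      apply DR.ex
      exact (DR2.dr ihg _ _).and (DR2.dr ihf _ _)
    refine this.of_iff fun v => ?_
    exact Part.mem_bind_iff.symm
  | @prec f g _ _ ihf ihg =>
    apply DR.dr2
    let R : ℕ → ℕ → Prop := fun s s' => ∃ a k y k' y' r r', Nat.pair a r = s ∧ Nat.pair k y = r ∧
      Nat.pair a r' = s' ∧ Nat.pair k' y' = r' ∧ k + 1 = k' ∧ y' ∈ g s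
    have hR : DR2 R := by
      apply DR.dr2
      apply DR.ex; apply DR.ex; apply DR.ex; apply DR.ex; apply DR.ex; apply DR.ex; apply DR.ex
      exact (DR3.dr dr3_pair _ _ _).and ((DR3.dr dr3_pair _ _ _).and ((DR3.dr dr3_pair _ _ _).and
        ((DR3.dr dr3_pair _ _ _).and ((DR2.dr dr2_succ _ _).and (DR2.dr ihg _ _)))))
    have hT := dr2_tc hR
    have : DR fun v : Fin 2 → ℕ => ∃ a n y0 z r r' s s', Nat.pair a n = v 0 ∧ y0 ∈ f a ∧ z = 0 ∧
        Nat.pair z y0 = r ∧ Nat.pair a r = s ∧ Nat.pair n (v 1) = r' ∧ Nat.pair a r' = s' ∧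
        Relation.ReflTransGen R s s' := by
      apply DR.ex; apply DR.ex; apply DR.ex; apply DR.ex; apply DR.ex; apply DR.ex; apply DR.ex
      apply DR.ex
      exact (DR3.dr dr3_pair _ _ _).and ((DR2.dr ihf _ _).and ((dr_zero _).and
        ((DR3.dr dr3_pair _ _ _).and
        ((DR3.dr dr3_pair _ _ _).and ((DR3.dr dr3_pair _ _ _).and ((DR3.dr dr3_pair _ _ _).and
        (DR2.dr hT _ _)))))))
    refine this.of_iff fun v => ?_
    have key : ∀ (a y0 n y : ℕ), y0 ∈ f a →
        Relation.ReflTransGen R (Nat.pair a (Nat.pair 0 y0)) (Nat.pair a (Nat.pair n y)) →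
        y ∈ (Nat.rec (f a) (fun y IH => IH.bind fun i => g (Nat.pair a (Nat.pair y i))) n : Part ℕ) := by
      intro a y0 n y h0 h
      have gen : ∀ s', Relation.ReflTransGen R (Nat.pair a (Nat.pair 0 y0)) s' →
          ∃ n y, s' = Nat.pair a (Nat.pair n y) ∧
          y ∈ (Nat.rec (f a) (fun y IH => IH.bind fun i => g (Nat.pair a (Nat.pair y i))) n : Part ℕ) := by
        intro s' hs'
        induction hs' with
        | refl => exact ⟨0, y0, rfl, h0⟩
        | tail _ hbc ih =>
          obtain ⟨n, y, rfl, hy⟩ := ih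
          obtain ⟨a', k, y2, k', y', r, r', e1, e2, e3, e4, e5, e6⟩ := hbc
          subst e2 e4 e5
          rw [Nat.pair_eq_pair, Nat.pair_eq_pair] at e1
          obtain ⟨rfl, rfl, rfl⟩ := e1
          exact ⟨k+1, y', e3.symm, Part.mem_bind hy e6⟩
      obtain ⟨n', y', e, h'⟩ := gen _ h
      rw [Nat.pair_eq_pair, Nat.pair_eq_pair] at e
      obtain ⟨-, rfl, rfl⟩ := e
      exact h'
    have key2 : ∀ (a n y : ℕ),
        y ∈ (Nat.rec (f a) (fun y IH => IH.bind fun i => g (Nat.pair a (Nat.pair y i))) n : Part ℕ) →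
        ∃ y0 ∈ f a, Relation.ReflTransGen R (Nat.pair a (Nat.pair 0 y0)) (Nat.pair a (Nat.pair n y)) := by
      intro a n
      induction n with
      | zero => intro y hy; exact ⟨y, hy, Relation.ReflTransGen.refl⟩
      | succ n ih =>
        intro y hy
        obtain ⟨i, hi, hg⟩ := Part.mem_bind_iff.1 hy
        obtain ⟨y0, h0, hp⟩ := ih i hi
        exact ⟨y0, h0, hp.tail ⟨a, n, i, n+1, y, _, _, rfl, rfl, rfl, rfl, rfl, hg⟩⟩
    constructor
    · rintro ⟨a, n, y0, z, r, r', s, s', e1, h0, rfl, rfl, rfl, rfl, rfl, h⟩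
      rw [← e1]
      simpa [Nat.unpaired] using key a y0 n (v 1) h0 h
    · intro h
      obtain ⟨y0, h0, hp⟩ := key2 (v 0).unpair.1 (v 0).unpair.2 (v 1) (by simpa [Nat.unpaired] using h)
      exact ⟨_, _, y0, 0, _, _, _, _, Nat.pair_unpair _, h0, rfl, rfl, rfl, rfl, rfl, hp⟩
  | @rfind f _ ih =>
    apply DR.dr2
    let R : ℕ → ℕ → Prop := fun s s' => ∃ a m m' y, Nat.pair a m = s ∧ Nat.pair a m' = s' ∧
      m + 1 = m' ∧ y ∈ f s ∧ y ≠ 0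
    have hR : DR2 R := by
      apply DR.dr2
      apply DR.ex; apply DR.ex; apply DR.ex; apply DR.ex
      exact (DR3.dr dr3_pair _ _ _).and ((DR3.dr dr3_pair _ _ _).and ((DR2.dr dr2_succ _ _).and
        ((DR2.dr ih _ _).and (dr_pos _))))
    have hT := dr2_tc hR
    have : DR fun v : Fin 2 → ℕ => ∃ z s s', z = 0 ∧ Nat.pair (v 0) z = s ∧
        Nat.pair (v 0) (v 1) = s' ∧ z ∈ f s' ∧ Relation.ReflTransGen R s s' := by
      apply DR.ex; apply DR.ex; apply DR.ex
      exact (dr_zero _).and ((DR3.dr dr3_pair _ _ _).and ((DR3.dr dr3_pair _ _ _).and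
        ((DR2.dr ih _ _).and (DR2.dr hT _ _))))
    refine this.of_iff fun v => ?_
    have key : ∀ a s', Relation.ReflTransGen R (Nat.pair a 0) s' →
        ∃ n, s' = Nat.pair a n ∧ ∀ m < n, ∃ y ∈ f (Nat.pair a m), y ≠ 0 := by
      intro a s' h
      induction h with
      | refl => exact ⟨0, rfl, by simp⟩
      | tail _ hbc ih =>
        obtain ⟨n, rfl, hn⟩ := ih
        obtain ⟨a', m, m', y, e1, e2, e3, e4, e5⟩ := hbc
        rw [Nat.pair_eq_pair] at e1
        obtain ⟨rfl, rfl⟩ := e1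
        subst e3
        refine ⟨_, e2.symm, fun k hk => ?_⟩
        rcases Nat.lt_succ_iff_lt_or_eq.1 hk with h | rfl
        · exact hn k h
        · exact ⟨y, e4, e5⟩
    have key2 : ∀ a n, (∀ m < n, ∃ y ∈ f (Nat.pair a m), y ≠ 0) →
        Relation.ReflTransGen R (Nat.pair a 0) (Nat.pair a n) := by
      intro a n
      induction n with
      | zero => intro _; exact Relation.ReflTransGen.refl
      | succ n ih =>
        intro h
        obtain ⟨y, hy, hy0⟩ := h n (by omega)
        exact (ih fun m hm => h m (by omega)).tail ⟨a, n, n+1, y, rfl, rfl, rfl, hy, hy0⟩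
    refine Iff.trans ?_ Nat.mem_rfind.symm
    constructor
    · rintro ⟨z, s, s', rfl, rfl, rfl, h0, h⟩
      obtain ⟨n, e, hn⟩ := key _ _ h
      rw [Nat.pair_eq_pair] at e
      obtain ⟨-, rfl⟩ := e
      refine ⟨(Part.mem_map_iff _).2 ⟨0, h0, by simp⟩, fun {m} hm => (Part.mem_map_iff _).2 ?_⟩
      obtain ⟨y, hy, hy0⟩ := hn m hm
      exact ⟨y, hy, by simp [hy0]⟩
    · rintro ⟨h1, h⟩
      obtain ⟨y, hy, hy0⟩ := (Part.mem_map_iff _).1 h1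
      have : y = 0 := by simpa using hy0
      subst this
      refine ⟨0, _, _, rfl, rfl, rfl, hy, key2 _ _ fun m hm => ?_⟩
      obtain ⟨y, hy, e⟩ := (Part.mem_map_iff _).1 (h hm)
      exact ⟨y, hy, by simpa using e⟩

/-- a definable halting-complete predicate -/
theorem exists_dv_undec : ∃ d : Dv, ¬ ComputablePred fun n : ℕ => ∃ v : ℕ → ℕ, v 0 = n ∧ d.sem v := by
  have h0 := ComputablePred.halting_problem 0
  have hre := ComputablePred.halting_problem_re 0
  let f : ℕ →. ℕ := fun n => (Nat.Partrec.Code.eval (Denumerable.ofNat Nat.Partrec.Code n) 0)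
  have hf : Nat.Partrec f := by
    rw [← Partrec.nat_iff]
    exact Nat.Partrec.Code.eval_part.comp (Computable.ofNat _) (Computable.const 0)
  have hd := (dr2_partrec hf 0 1).ex 1
  obtain ⟨d, hd⟩ := hd
  refine ⟨d, fun hc => h0 ?_⟩
  have : ComputablePred fun c : Nat.Partrec.Code =>
      ∃ v : ℕ → ℕ, v 0 = Encodable.encode c ∧ d.sem v := by
    obtain ⟨g, hg, e⟩ := ComputablePred.computable_iff.1 hc
    refine ComputablePred.computable_iff.2 ⟨fun c => g (Encodable.encode c),
      hg.comp Computable.encode, ?_⟩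
    funext c
    exact congrFun e (Encodable.encode c)
  refine this.of_eq fun c => ?_
  simp only [hd]
  constructor
  · rintro ⟨v, hv, n, hn⟩
    simp [hv, f] at hn
    exact Part.dom_iff_mem.2 ⟨n, hn⟩
  · intro h
    obtain ⟨n, hn⟩ := Part.dom_iff_mem.1 h
    exact ⟨fun _ => Encodable.encode c, rfl, n, by simpa [f] using hn⟩
end OneVarEq

namespace OneVarEq
open Function

/-! ### translation into formulas -/
abbrev S3 := Unit ⊕ (Unit ⊕ Bool)
def mD (b : Bool) : S3 := cond b (Sum.inl ()) (Sum.inr (Sum.inl ()))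
def mL : S3 := Sum.inr (Sum.inr true)

def fX (i : ℕ) : EF S3 := .pred (2*i) .var
def fAc (b : Bool) : EF S3 := .ex (.pred (cond b 1 3) .var)
def fdia (m : S3) (φ : EF S3) : EF S3 := .neg (.box m (.neg φ))
def fconj (l : List (EF S3)) : EF S3 := l.foldr .and (.eq .var .var)
def frig (b : Bool) (i : ℕ) : EF S3 :=
  EF.all (.and (EF.imp (fX i) (.box (mD b) (fX i)))
    (EF.imp (.neg (fX i)) (.box (mD b) (.neg (fX i)))))
def frigs (B : ℕ) (b : Bool) (ls : List ℕ) : EF S3 :=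
  fconj (((List.range B).filter (fun i => decide (i ∉ ls))).map (frig b))
def fsum1 (b : Bool) (k l : ℕ) : EF S3 :=
  .and (EF.all (EF.imp (fX k) (fdia (mD b) (.and (fAc b) (fX l)))))
   (.and (EF.all (EF.imp (.neg (fX k)) (.box (mD b) (EF.imp (fAc b) (.neg (fX l))))))
    (.box (mD b) (EF.imp (fAc b) (EF.all (EF.imp (fX l)
      (.box (mD b) (EF.imp (fAc b) (.neg (fX l)))))))))

def fm (B : ℕ) : Dv → Bool → EF S3
  | .zero i, _ => .neg (.ex (fX i))
  | .one i, _ => .and (.ex (fX i)) (EF.all (EF.imp (fX i) (.eq .var (.const 0))))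
  | .or d e, b => EF.or (fm B d b) (fm B e b)
  | .and d e, b => .and (frigs B b []) (.and (fdia (mD b) (fm B d !b)) (fdia (mD b) (fm B e !b)))
  | .ex k d, b => .and (frigs B b [k]) (fdia (mD b) (fm B d !b))
  | .sum κ ls d, b => .and (frigs B b ls) (.and (.neg (fAc b))
      (.and (.box (mD b) (EF.imp (fAc b) (fm B d !b))) (fconj (ls.map fun l => fsum1 b (κ l) l))))

section
variable {F : KFrame S3} (𝔪 : EModel F)

theorem eval_fX (i w a) : 𝔪.eval (fX i) w a ↔ a ∈ 𝔪.I w (2*i) := Iff.rfl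
theorem eval_fdia (m φ w a) : 𝔪.eval (fdia m φ) w a ↔ ∃ v, F.R m w v ∧ 𝔪.eval φ v a := by
  simp [fdia, EModel.eval]
theorem eval_fconj (l : List (EF S3)) (w a) : 𝔪.eval (fconj l) w a ↔ ∀ φ ∈ l, 𝔪.eval φ w a := by
  induction l with
  | nil => simp [fconj, EModel.eval]
  | cons φ l ih => simp only [fconj, List.foldr, eval_and', List.mem_cons, forall_eq_or_imp] at *; rw [ih]
def Acw (b : Bool) (w : F.W) : Prop := ∃ a ∈ 𝔪.dom w, a ∈ 𝔪.I w (cond b 1 3)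
theorem eval_fAc (b w a) : 𝔪.eval (fAc b) w a ↔ Acw 𝔪 b w := Iff.rfl
theorem eval_frig (b i w a) : 𝔪.eval (frig b i) w a ↔
    ∀ v, F.R (mD b) w v → ∀ x ∈ 𝔪.dom w, (x ∈ 𝔪.I w (2*i) ↔ x ∈ 𝔪.I v (2*i)) := by
  simp only [frig, eval_all', eval_and', eval_imp', eval_neg', eval_box', eval_fX]
  constructor
  · intro h v hv x hx
    have := h x hx
    exact ⟨fun h' => this.1 h' v hv, fun h' => by_contra fun h2 => this.2 h2 v hv h'⟩
  · intro h x hx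
    exact ⟨fun h' v hv => (h v hv x hx).1 h', fun h' v hv h2 => h' ((h v hv x hx).2 h2)⟩
theorem eval_frigs (B b ls w a) : 𝔪.eval (frigs B b ls) w a ↔
    ∀ v, F.R (mD b) w v → ∀ i < B, i ∉ ls → ∀ x ∈ 𝔪.dom w, (x ∈ 𝔪.I w (2*i) ↔ x ∈ 𝔪.I v (2*i)) := by
  simp only [frigs, eval_fconj, List.mem_map, List.mem_filter, List.mem_range]
  constructor
  · intro h v hv i hi hil
    exact (eval_frig 𝔪 b i w a).1 (h _ ⟨i, ⟨hi, by simpa using hil⟩, rfl⟩) v hv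
  · rintro h φ ⟨i, ⟨hi, hil⟩, rfl⟩
    exact (eval_frig 𝔪 b i w a).2 fun v hv => h v hv i hi (by simpa using hil)
theorem eval_fsum1 (b k l w a) : 𝔪.eval (fsum1 b k l) w a ↔
    (∀ x ∈ 𝔪.dom w, x ∈ 𝔪.I w (2*k) → ∃ v, F.R (mD b) w v ∧ Acw 𝔪 b v ∧ x ∈ 𝔪.I v (2*l)) ∧
    (∀ x ∈ 𝔪.dom w, x ∉ 𝔪.I w (2*k) → ∀ v, F.R (mD b) w v → Acw 𝔪 b v → x ∉ 𝔪.I v (2*l)) ∧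
    (∀ v, F.R (mD b) w v → Acw 𝔪 b v → ∀ x ∈ 𝔪.dom v, x ∈ 𝔪.I v (2*l) →
      ∀ u, F.R (mD b) v u → Acw 𝔪 b u → x ∉ 𝔪.I u (2*l)) := by
  simp only [fsum1, eval_all', eval_and', eval_imp', eval_neg', eval_box', eval_fX, eval_fdia, eval_fAc]

noncomputable def vl (B : ℕ) (w : F.W) (i : ℕ) : ℕ :=
  open Classical in if i < B then (𝔪.I w (2*i) ∩ 𝔪.dom w).ncard else 0

theorem fm_sound (hF : ∀ b, IsDiff (F.R (mD b))) (B : ℕ) (d : Dv) : ∀ (b : Bool) (w : F.W) (a : 𝔪.D),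
    d.bd ≤ B → (𝔪.dom w).Finite → 𝔪.eval (fm B d b) w a → d.sem (vl 𝔪 B w) := by
  classical
  have hdom : ∀ b w v, F.R (mD b) w v → 𝔪.dom v = 𝔪.dom w := fun b w v h =>
    Set.Subset.antisymm (𝔪.expand _ _ _ ((hF b).1 _ _ h)) (𝔪.expand _ _ _ h)
  have hrig : ∀ b w v i, F.R (mD b) w v →
      (i < B → ∀ x ∈ 𝔪.dom w, (x ∈ 𝔪.I w (2*i) ↔ x ∈ 𝔪.I v (2*i))) → vl 𝔪 B v i = vl 𝔪 B w i := by
    intro b w v i h hx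
    unfold vl
    split_ifs with hi
    · rw [hdom b w v h]
      congr 1
      ext x
      simp only [Set.mem_inter_iff]
      constructor
      · rintro ⟨h1, h2⟩; exact ⟨(hx hi x h2).2 h1, h2⟩
      · rintro ⟨h1, h2⟩; exact ⟨(hx hi x h2).1 h1, h2⟩
    · rfl
  induction d with
  | zero i =>
    intro b w a hb hfin h
    simp only [fm, eval_neg', eval_ex', eval_fX] at h
    simp only [Dv.bd] at hb
    simp only [Dv.sem, vl, if_pos (show i < B by omega)]
    have : 𝔪.I w (2*i) ∩ 𝔪.dom w = ∅ := by
      ext x; simp; intro h1 h2; exact h ⟨x, h2, h1⟩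
    rw [this]; simp
  | one i =>
    intro b w a hb hfin h
    simp only [fm, eval_and', eval_ex', eval_all', eval_imp', eval_fX, EModel.eval, EModel.tmVal] at h
    simp only [Dv.bd] at hb
    simp only [Dv.sem, vl, if_pos (show i < B by omega)]
    obtain ⟨⟨x, hx1, hx2⟩, h⟩ := h
    rw [Set.ncard_eq_one]
    refine ⟨𝔪.cst w 0, ?_⟩
    ext y
    simp only [Set.mem_inter_iff, Set.mem_singleton_iff]
    constructor
    · rintro ⟨h1, h2⟩; exact h y h2 h1
    · rintro rfl; rw [← h x hx1 hx2]; exact ⟨hx2, hx1⟩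
  | or d e ihd ihe =>
    intro b w a hb hfin h
    simp only [fm, eval_or'] at h
    simp only [Dv.bd] at hb
    rcases h with h | h
    · exact Or.inl (ihd b w a (by omega) hfin h)
    · exact Or.inr (ihe b w a (by omega) hfin h)
  | and d e ihd ihe =>
    intro b w a hb hfin h
    simp only [fm, eval_and', eval_fdia, eval_frigs] at h
    simp only [Dv.bd] at hb
    obtain ⟨hr, ⟨v, hv, h1⟩, u, hu, h2⟩ := h
    have ev : vl 𝔪 B v = vl 𝔪 B w := funext fun i => hrig b w v i hv fun hi => hr v hv i hi (by simp)
    have eu : vl 𝔪 B u = vl 𝔪 B w := funext fun i => hrig b w u i hu fun hi => hr u hu i hi (by simp)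
    refine ⟨?_, ?_⟩
    · rw [← ev]; exact ihd _ v a (by omega) (by rwa [hdom b w v hv]) h1
    · rw [← eu]; exact ihe _ u a (by omega) (by rwa [hdom b w u hu]) h2
  | ex k d ih =>
    intro b w a hb hfin h
    simp only [fm, eval_and', eval_fdia, eval_frigs] at h
    simp only [Dv.bd] at hb
    obtain ⟨hr, v, hv, h1⟩ := h
    refine ⟨vl 𝔪 B v k, ?_⟩
    have e : update (vl 𝔪 B w) k (vl 𝔪 B v k) = vl 𝔪 B v := by
      funext i
      by_cases hi : i = k
      · subst hi; simp
      · rw [update_of_ne hi]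
        exact (hrig b w v i hv fun hi' => hr v hv i hi' (by simpa using hi)).symm
    rw [e]
    exact ih _ v a (by omega) (by rwa [hdom b w v hv]) h1
  | sum κ ls d ih =>
    intro b w a hb hfin h
    simp only [fm, eval_and', eval_neg', eval_box', eval_imp', eval_fAc, eval_frigs, eval_fconj,
      List.mem_map] at h
    simp only [Dv.bd] at hb
    obtain ⟨hr, hna, hd, hs⟩ := h
    have hs' : ∀ l ∈ ls, _ := fun l hl => (eval_fsum1 𝔪 b (κ l) l w a).1 (hs _ ⟨l, hl, rfl⟩)
    clear hs
    -- the active successors carrying some element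
    let A : Set F.W := {v | F.R (mD b) w v ∧ Acw 𝔪 b v ∧ ∃ l ∈ ls, (𝔪.I v (2*l) ∩ 𝔪.dom w).Nonempty}
    have hAfin : A.Finite := by
      have hch : ∀ v : A, ∃ q : 𝔪.D × ℕ, q.1 ∈ 𝔪.dom w ∧ q.2 ∈ ls ∧ q.1 ∈ 𝔪.I v (2*q.2) := by
        rintro ⟨v, _, _, l, hl, x, hx1, hx2⟩
        exact ⟨(x, l), hx2, hl, hx1⟩
      choose g hg using hch
      have hfinT : (𝔪.dom w ×ˢ {l | l ∈ ls}).Finite := hfin.prod (List.finite_toSet ls)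
      have hinj : Function.Injective g := by
        intro v u e
        by_contra hne
        have h1 := hg v
        have h2 := hg u
        rw [← e] at h2
        have := (hF b).2 w u v u.2.1 v.2.1
        rcases this with h | h
        · exact hne (Subtype.ext h)
        · exact (hs' (g v).2 h1.2.1).2.2 v v.2.1 v.2.2.1 (g v).1
            (by rw [hdom b w v v.2.1]; exact h1.1) h1.2.2 u h u.2.2.1 h2.2.2
      have : Finite A := by
        have : Finite (𝔪.dom w ×ˢ {l | l ∈ ls} : Set (𝔪.D × ℕ)) := hfinT
        exact Finite.of_injective (fun v => (⟨g v, (hg v).1, (hg v).2.1⟩ :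
          (𝔪.dom w ×ˢ {l | l ∈ ls} : Set (𝔪.D × ℕ)))) (fun v u e => hinj (congrArg Subtype.val e))
      exact this
    refine ⟨hAfin.toFinset.toList.map (vl 𝔪 B), ?_, ?_⟩
    · intro u hu
      obtain ⟨v, hv, rfl⟩ := List.mem_map.1 hu
      have hvA : v ∈ A := by simpa using hv
      refine ⟨ih _ v a (by omega) (by rwa [hdom b w v hvA.1]) (hd v hvA.1 hvA.2.1), ?_⟩
      intro i hi
      exact hrig b w v i hvA.1 fun hi' => hr v hvA.1 i hi' hi
    · intro l hl
      have hlB : l < B := by have := lt_listBd hl; omega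
      have hkB : κ l < B := by have := lt_listBd (List.mem_map_of_mem (f := κ) hl); omega
      obtain ⟨h1, h2, h3⟩ := hs' l hl
      rw [List.map_map]
      have e1 : (List.map ((fun u => u l) ∘ vl 𝔪 B) hAfin.toFinset.toList).sum =
          ∑ v ∈ hAfin.toFinset, (𝔪.I v (2*l) ∩ 𝔪.dom w).ncard := by
        rw [Finset.sum_map_toList]
        apply Finset.sum_congr rfl
        intro v hv
        have hvA : v ∈ A := by simpa using hv
        simp [vl, hlB, hdom b w v hvA.1]
      rw [e1]
      have hf : ∀ v, (𝔪.I v (2*l) ∩ 𝔪.dom w).Finite := fun v => hfin.inter_of_right _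
      have e2 : ∀ v, (𝔪.I v (2*l) ∩ 𝔪.dom w).ncard = (hf v).toFinset.card := fun v =>
        Set.ncard_eq_toFinset_card _ (hf v)
      simp only [e2]
      rw [← Finset.card_biUnion]
      · have hfw : (𝔪.I w (2*κ l) ∩ 𝔪.dom w).Finite := hfin.inter_of_right _
        simp only [vl, hkB, if_true]
        rw [Set.ncard_eq_toFinset_card _ hfw]
        congr 1
        ext x
        simp only [Set.Finite.mem_toFinset, Set.mem_inter_iff, Finset.mem_biUnion]
        constructor
        · rintro ⟨hx1, hx2⟩
          obtain ⟨v, hv1, hv2, hv3⟩ := h1 x hx2 hx1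
          exact ⟨v, ⟨hv1, hv2, l, hl, x, hv3, hx2⟩, hv3, hx2⟩
        · rintro ⟨v, hv, hx1, hx2⟩
          refine ⟨?_, hx2⟩
          by_contra hc
          exact h2 x hx2 hc v hv.1 hv.2.1 hx1
      · intro v hv u hu hne
        have hvA : v ∈ A := by simpa using hv
        have huA : u ∈ A := by simpa using hu
        show Disjoint _ _
        rw [Finset.disjoint_left]
        intro x hx hx'
        simp only [Set.Finite.mem_toFinset, Set.mem_inter_iff] at hx hx'
        rcases (hF b).2 w u v huA.1 hvA.1 with h | h
        · exact hne h
        · exact h3 v hvA.1 hvA.2.1 x (by rw [hdom b w v hvA.1]; exact hx.2) hx.1 u h huA.2.1 hx'.1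
end
end OneVarEq

namespace OneVarEq
open Function

structure Lab (D : Type) where
  X : ℕ → Finset D
  act : Bool
  c : D

def Sat {D : Type} (B : ℕ) : Dv → (List ℕ → Lab D) → Prop
  | .zero i, t => (t []).X i = ∅
  | .one i, t => (t []).X i = {(t []).c}
  | .or d e, t => Sat B d t ∨ Sat B e t
  | .and d e, t => (∀ j, ∀ i < B, (t [j]).X i = (t []).X i) ∧ (∃ j, Sat B d fun q => t (j :: q)) ∧
      ∃ j, Sat B e fun q => t (j :: q)
  | .ex k d, t => (∀ j, ∀ i < B, i ≠ k → (t [j]).X i = (t []).X i) ∧ ∃ j, Sat B d fun q => t (j :: q)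
  | .sum κ ls d, t => (∀ j, ∀ i < B, i ∉ ls → (t [j]).X i = (t []).X i) ∧
      (∀ j, (t [j]).act = true → Sat B d fun q => t (j :: q)) ∧
      ∀ l ∈ ls, (∀ x, x ∈ (t []).X (κ l) ↔ ∃ j, (t [j]).act = true ∧ x ∈ (t [j]).X l) ∧
        ∀ j j' x, j ≠ j' → (t [j]).act = true → (t [j']).act = true → x ∈ (t [j]).X l → x ∉ (t [j']).X l

def mkT {D : Type} (r : Lab D) (f : ℕ → List ℕ → Lab D) : List ℕ → Lab D
  | [] => r
  | j :: q => f j q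

theorem partition_list {D α : Type} [DecidableEq D] (f : α → ℕ) (L : List α) : ∀ S : Finset D,
    S.card = (L.map f).sum → ∃ P : ℕ → Finset D, (∀ j, (P j).card = ((L[j]?).map f).getD 0) ∧
      (∀ j j', j ≠ j' → Disjoint (P j) (P j')) ∧ ∀ x, x ∈ S ↔ ∃ j, x ∈ P j := by
  induction L with
  | nil =>
    intro S hS
    have : S = ∅ := by simpa using hS
    exact ⟨fun _ => ∅, by simp, by simp, by simp [this]⟩
  | cons a L ih =>
    intro S hS
    simp only [List.map_cons, List.sum_cons] at hS
    obtain ⟨T, hT, hc⟩ := Finset.exists_subset_card_eq (show f a ≤ S.card by omega)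
    obtain ⟨P, h1, h2, h3⟩ := ih (S \ T) (by rw [Finset.card_sdiff_of_subset hT]; omega)
    have hd : ∀ j, Disjoint T (P j) := by
      intro j
      rw [Finset.disjoint_left]
      intro x hx hx'
      have := (h3 x).2 ⟨j, hx'⟩
      simp at this
      exact this.2 hx
    refine ⟨fun j => Nat.casesOn j T P, ?_, ?_, ?_⟩
    · intro j; cases j with
      | zero => simp [hc]
      | succ j => simp [h1]
    · intro j j' hne
      cases j with
      | zero => cases j' with
        | zero => exact absurd rfl hne
        | succ j' => exact hd j'
      | succ j => cases j' with
        | zero => exact (hd j).symm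
        | succ j' => exact h2 j j' (by omega)
    · intro x
      constructor
      · intro hx
        by_cases hxT : x ∈ T
        · exact ⟨0, hxT⟩
        · obtain ⟨j, hj⟩ := (h3 x).1 (by simp [hx, hxT])
          exact ⟨j+1, hj⟩
      · rintro ⟨j, hj⟩
        cases j with
        | zero => exact hT hj
        | succ j =>
          have := (h3 x).2 ⟨j, hj⟩
          simp at this
          exact this.1

theorem sat_complete (B : ℕ) (d : Dv) : ∀ v : ℕ → ℕ, d.bd ≤ B → d.sem v → ∃ N0, ∀ (D : Type)
    [Fintype D] [DecidableEq D], N0 < Fintype.card D → ∀ X0 : ℕ → Finset D,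
    (∀ i < B, (X0 i).card = v i) → ∀ act, ∃ t : List ℕ → Lab D, (t []).X = X0 ∧ (t []).act = act ∧
      Sat B d t := by
  induction d with
  | zero i =>
    intro v hb hs
    refine ⟨0, fun D _ _ hD X0 hX act => ?_⟩
    obtain ⟨x⟩ := Fintype.card_pos_iff.1 (show 0 < Fintype.card D by omega)
    simp only [Dv.bd, Dv.sem] at hb hs
    refine ⟨fun _ => ⟨X0, act, x⟩, rfl, rfl, ?_⟩
    have := hX i (by omega)
    simpa [Sat, hs] using this
  | one i =>
    intro v hb hs
    refine ⟨0, fun D _ _ hD X0 hX act => ?_⟩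
    simp only [Dv.bd, Dv.sem] at hb hs
    have := hX i (by omega)
    rw [hs, Finset.card_eq_one] at this
    obtain ⟨x, hx⟩ := this
    exact ⟨fun _ => ⟨X0, act, x⟩, rfl, rfl, hx⟩
  | or d e ihd ihe =>
    intro v hb hs
    simp only [Dv.bd, Dv.sem] at hb hs
    rcases hs with hs | hs
    · obtain ⟨N0, h⟩ := ihd v (by omega) hs
      refine ⟨N0, fun D _ _ hD X0 hX act => ?_⟩
      obtain ⟨t, h1, h2, h3⟩ := h D hD X0 hX act
      exact ⟨t, h1, h2, Or.inl h3⟩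
    · obtain ⟨N0, h⟩ := ihe v (by omega) hs
      refine ⟨N0, fun D _ _ hD X0 hX act => ?_⟩
      obtain ⟨t, h1, h2, h3⟩ := h D hD X0 hX act
      exact ⟨t, h1, h2, Or.inr h3⟩
  | and d e ihd ihe =>
    intro v hb hs
    simp only [Dv.bd, Dv.sem] at hb hs
    obtain ⟨N0, h⟩ := ihd v (by omega) hs.1
    obtain ⟨N1, h'⟩ := ihe v (by omega) hs.2
    refine ⟨max N0 N1, fun D _ _ hD X0 hX act => ?_⟩
    obtain ⟨t, h1, h2, h3⟩ := h D (by omega) X0 hX act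
    obtain ⟨t', h1', h2', h3'⟩ := h' D (by omega) X0 hX act
    obtain ⟨x⟩ := Fintype.card_pos_iff.1 (show 0 < Fintype.card D by omega)
    refine ⟨mkT ⟨X0, act, x⟩ (fun j => if j = 0 then t else t'), rfl, rfl, ?_, ⟨0, ?_⟩, ⟨1, ?_⟩⟩
    · intro j i _
      by_cases hj : j = 0
      · simp [mkT, hj, h1]
      · simp [mkT, hj, h1']
    · simpa [mkT] using h3
    · simpa [mkT] using h3'
  | ex k d ih =>
    intro v hb hs
    simp only [Dv.bd, Dv.sem] at hb hs
    obtain ⟨n, hs⟩ := hs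
    obtain ⟨N0, h⟩ := ih _ (by omega) hs
    refine ⟨max N0 n, fun D _ _ hD X0 hX act => ?_⟩
    obtain ⟨x⟩ := Fintype.card_pos_iff.1 (show 0 < Fintype.card D by omega)
    obtain ⟨T, -, hT⟩ := Finset.exists_subset_card_eq (s := (Finset.univ : Finset D)) (n := n)
      (by rw [Finset.card_univ]; omega)
    obtain ⟨t, h1, h2, h3⟩ := h D (by omega) (update X0 k T) (by
      intro i hi
      by_cases e : i = k
      · subst e; simp [hT]
      · simp [e, hX i hi]) act
    refine ⟨mkT ⟨X0, act, x⟩ (fun j => t), rfl, rfl, ?_, ⟨0, ?_⟩⟩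
    · intro j i _ hik
      simp [mkT, h1, hik]
    · simpa [mkT] using h3
  | sum κ ls d ih =>
    intro v hb hs
    simp only [Dv.bd, Dv.sem] at hb hs
    obtain ⟨L, hL, hsum⟩ := hs
    have hN : ∃ M, ∀ u ∈ L, ∀ (D : Type)
        [Fintype D] [DecidableEq D], M < Fintype.card D → ∀ X0 : ℕ → Finset D,
        (∀ i < B, (X0 i).card = u i) → ∀ act, ∃ t : List ℕ → Lab D, (t []).X = X0 ∧
          (t []).act = act ∧ Sat B d t := by
      clear hsum
      induction L with
      | nil => exact ⟨0, by simp⟩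
      | cons u L ihL =>
        obtain ⟨M, hM⟩ := ihL fun u hu => hL u (by simp [hu])
        obtain ⟨N0, h⟩ := ih u (by omega) (hL u (by simp)).1
        refine ⟨max M N0, fun u' hu' D _ _ hD => ?_⟩
        rcases List.mem_cons.1 hu' with rfl | hu'
        · exact h D (by omega)
        · exact hM u' hu' D (by omega)
    obtain ⟨M, hM⟩ := hN
    refine ⟨M, fun D _ _ hD X0 hX act => ?_⟩
    obtain ⟨x⟩ := Fintype.card_pos_iff.1 (show 0 < Fintype.card D by omega)
    have hP : ∀ l, ∃ P : ℕ → Finset D, l ∈ ls → (∀ j, (P j).card = ((L[j]?).map (fun u => u l)).getD 0) ∧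
      (∀ j j', j ≠ j' → Disjoint (P j) (P j')) ∧ ∀ x, x ∈ X0 (κ l) ↔ ∃ j, x ∈ P j := by
      intro l
      by_cases hl : l ∈ ls
      · have hkB : κ l < B := by have := lt_listBd (List.mem_map_of_mem (f := κ) hl); omega
        obtain ⟨P, hP⟩ := partition_list (fun u : ℕ → ℕ => u l) L (X0 (κ l)) (by rw [hX _ hkB, hsum l hl])
        exact ⟨P, fun _ => hP⟩
      · exact ⟨fun _ => ∅, fun h => absurd h hl⟩
    choose P hP using hP
    have hch : ∀ j, ∃ t : List ℕ → Lab D, (t []).X = (fun i => if i ∈ ls then P i j else X0 i) ∧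
        ((t []).act = true ↔ j < L.length) ∧ (j < L.length → Sat B d t) := by
      intro j
      by_cases hj : j < L.length
      · have hm : L[j] ∈ L := List.getElem_mem hj
        obtain ⟨t, h1, h2, h3⟩ := hM L[j] hm D hD (fun i => if i ∈ ls then P i j else X0 i) (by
          intro i hi
          by_cases hl : i ∈ ls
          · simp [hl, (hP i hl).1 j, hj]
          · simp only [hl, if_false]; rw [hX i hi, (hL _ hm).2 i hl]) true
        exact ⟨t, h1, by simp [h2, hj], fun _ => h3⟩
      · exact ⟨fun _ => ⟨fun i => if i ∈ ls then P i j else X0 i, false, x⟩, rfl, by simp [hj],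
          fun h => absurd h hj⟩
    choose t ht1 ht2 ht3 using hch
    refine ⟨mkT ⟨X0, act, x⟩ t, rfl, rfl, ?_, ?_, ?_⟩
    · intro j i _ hil
      simp [mkT, ht1, hil]
    · intro j hj
      exact ht3 j ((ht2 j).1 hj)
    · intro l hl
      obtain ⟨p1, p2, p3⟩ := hP l hl
      refine ⟨fun y => ?_, ?_⟩
      · simp only [mkT, ht1, hl, if_true, ht2]
        rw [p3]
        constructor
        · rintro ⟨j, hj⟩
          refine ⟨j, ?_, hj⟩
          by_contra hc
          have := p1 j
          rw [List.getElem?_eq_none (by omega)] at this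
          simp at this
          simp [this] at hj
        · rintro ⟨j, _, hj⟩; exact ⟨j, hj⟩
      · intro j j' y hne _ _
        simp only [mkT, ht1, hl, if_true]
        exact fun h1 h2 => Finset.disjoint_left.1 (p2 j j' hne) h1 h2

end OneVarEq

namespace OneVarEq
open Function
/-! ### the tree model -/
def tyP (p : List ℕ) : Bool := decide (p.length % 2 = 0)
def clP (b : Bool) (p : List ℕ) : List ℕ := if tyP p = b then p else p.dropLast

def treeR (K : ℕ) : S3 → (List ℕ × Fin (K+1)) → (List ℕ × Fin (K+1)) → Prop
  | .inl _, a, b => a.2 = b.2 ∧ clP true a.1 = clP true b.1 ∧ a.1 ≠ b.1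
  | .inr (.inl _), a, b => a.2 = b.2 ∧ clP false a.1 = clP false b.1 ∧ a.1 ≠ b.1
  | .inr (.inr false), a, b => a.1 = b.1 ∧ a.2.val + 1 = b.2.val
  | .inr (.inr true), a, b => a.1 = b.1 ∧ a.2 < b.2

@[reducible] def treeF (K : ℕ) : KFrame S3 := ⟨List ℕ × Fin (K+1), ⟨([], 0)⟩, treeR K⟩

theorem treeR_mD (K : ℕ) (b : Bool) (p q : List ℕ × Fin (K+1)) :
    treeR K (mD b) p q ↔ p.2 = q.2 ∧ clP b p.1 = clP b q.1 ∧ p.1 ≠ q.1 := by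
  cases b <;> rfl

@[reducible] def chainF (K : ℕ) : KFrame Bool := ⟨Fin (K+1), ⟨0⟩, fun b x y => cond b (x < y) (x.val + 1 = y.val)⟩

theorem chainF_ftime (K : ℕ) : FTimeFrame (chainF K) := by
  refine ⟨inferInstanceAs (Finite (Fin (K+1))), ?_, ?_, ?_, ?_⟩
  · intro w; exact lt_irrefl (α := Fin (K+1)) w
  · intro w v u; exact lt_trans (α := Fin (K+1))
  · intro w v h; exact lt_or_gt_of_ne (α := Fin (K+1)) h
  · intro (w : Fin (K+1)) (v : Fin (K+1))
    change w.val + 1 = v.val ↔ (w < v ∧ ¬ ∃ u : Fin (K+1), w < u ∧ u < v)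
    constructor
    · intro h
      refine ⟨?_, ?_⟩
      · rw [Fin.lt_def]; omega
      · rintro ⟨u, h1, h2⟩; rw [Fin.lt_def] at h1 h2; omega
    · rintro ⟨h1, h2⟩
      by_contra hc
      rw [Fin.lt_def] at h1
      have := v.2
      exact h2 ⟨⟨w.val+1, by omega⟩, by rw [Fin.lt_def]; simp, by rw [Fin.lt_def]; simp; omega⟩

theorem chainF_mem (K : ℕ) : chainF K ∈ Cftime := fun _ hφ => hφ _ (chainF_ftime K)

theorem isDiff_cl {W ι : Type} (f : W → ι) : IsDiff fun a b : W => f a = f b ∧ a ≠ b := by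
  refine ⟨fun w v h => ⟨h.1.symm, h.2.symm⟩, fun w v u h1 h2 => ?_⟩
  by_cases e : u = v
  · exact Or.inl e
  · exact Or.inr ⟨h2.1.symm.trans h1.1, e⟩

theorem treeF_isDiff (K : ℕ) (b : Bool) : IsDiff ((treeF K).R (mD b)) := by
  have := isDiff_cl fun p : List ℕ × Fin (K+1) => (p.2, clP b p.1)
  have e : (treeF K).R (mD b) = fun p q => (p.2, clP b p.1) = (q.2, clP b q.1) ∧ p ≠ q := by
    funext p q
    apply propext
    refine (treeR_mD K b p q).trans ?_
    have h : p = q ↔ p.1 = q.1 ∧ p.2 = q.2 := Prod.ext_iff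
    rw [Prod.mk.injEq, Ne, Ne, h]
    tauto
  rw [e]; exact this

theorem treeF_mem (K : ℕ) : treeF K ∈ frameFusion Cdiff (frameFusion Cdiff Cftime) := by
  refine ⟨(mem_Cdiff_iff _).2 (treeF_isDiff K true), (mem_Cdiff_iff _).2 (treeF_isDiff K false), ?_⟩
  intro φ hφ V w
  obtain ⟨p, k⟩ := w
  have key : ∀ (ψ : PF Bool) (k : Fin (K+1)),
      PVal (F := ((treeF K).reduct Sum.inr).reduct Sum.inr) V ψ (p, k) ↔
      PVal (F := chainF K) (fun n x => V n (p, x)) ψ k := by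
    intro ψ
    induction ψ with
    | atom n => intro k; rfl
    | neg φ ih => intro k; simp [PVal, ih]
    | and φ ψ ih1 ih2 => intro k; simp [PVal, ih1, ih2]
    | box m φ ih =>
      intro k
      simp only [PVal]
      constructor
      · intro h x hx
        refine (ih x).1 (h (p, x) ?_)
        cases m
        · exact ⟨rfl, hx⟩
        · exact ⟨rfl, hx⟩
      · rintro h ⟨q, x⟩ hx
        cases m
        · obtain ⟨rfl, hx⟩ := (hx : p = q ∧ k.val + 1 = x.val)
          exact (ih x).2 (h x hx)
        · obtain ⟨rfl, hx⟩ := (hx : p = q ∧ k < x)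
          exact (ih x).2 (h x hx)
  exact (key φ k).2 (chainF_mem K φ hφ _ k)

theorem tyP_append (p : List ℕ) (j : ℕ) : tyP (p ++ [j]) = !tyP p := by
  simp only [tyP, List.length_append, List.length_singleton]
  by_cases h : p.length % 2 = 0
  · have : ¬ (p.length + 1) % 2 = 0 := by omega
    simp [h, this]
  · have : (p.length + 1) % 2 = 0 := by omega
    simp [h, this]

theorem cl_succ {p q : List ℕ} : (clP (tyP p) p = clP (tyP p) q ∧ p ≠ q) ↔ ∃ j, q = p ++ [j] := by
  constructor
  · rintro ⟨h1, h2⟩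
    simp only [clP, if_true] at h1
    split_ifs at h1 with h
    · exact absurd h1 h2
    · rcases List.eq_nil_or_concat q with rfl | ⟨r, j, rfl⟩
      · simp at h1; exact absurd h1 (by simpa using h2)
      · rw [List.concat_eq_append] at *
        rw [List.dropLast_concat] at h1
        exact ⟨j, by rw [h1]⟩
  · rintro ⟨j, rfl⟩
    simp [clP, tyP_append]

theorem cl_succ2 {p q : List ℕ} {j : ℕ} : (clP (tyP p) (p ++ [j]) = clP (tyP p) q ∧ p ++ [j] ≠ q) →
    q = p ∨ ∃ j', j ≠ j' ∧ q = p ++ [j'] := by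
  rintro ⟨h1, h2⟩
  by_cases e : q = p
  · exact Or.inl e
  · right
    have h3 : clP (tyP p) p = clP (tyP p) (p ++ [j]) := (cl_succ.2 ⟨j, rfl⟩).1
    obtain ⟨j', rfl⟩ := cl_succ.1 ⟨h3.trans h1, fun h => e h.symm⟩
    refine ⟨j', ?_, rfl⟩
    rintro rfl; exact h2 rfl

section
variable {D : Type} (K : ℕ) (t : List ℕ → Lab D) (en : ℕ → D) (cs : ℕ → D) (As : ℕ → Set D)

def treeI (q : List ℕ) (n : ℕ) : Set D :=
  if n % 2 = 0 then (t q).X (n / 2)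
  else if n = 1 then {_x | tyP q = false ∧ (t q).act = true}
  else if n = 3 then {_x | tyP q = true ∧ (t q).act = true}
  else As ((n - 5) / 2)

@[reducible] def treeM (x0 : D) : EModel (treeF K) where
  D := D
  dom _ := Set.univ
  domNe _ := ⟨x0, trivial⟩
  expand _ _ _ _ := Set.subset_univ _
  I w n := treeI t As w.1 n
  cst w k := match k with
    | 0 => if w.2 = 0 then (t w.1).c else en w.2.val
    | k+1 => cs k
  cstMem _ _ := trivial

variable (x0 : D)

theorem treeM_Acw (b : Bool) (q : List ℕ) (k : Fin (K+1)) :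
    Acw (treeM K t en cs As x0) b (q, k) ↔ tyP q = !b ∧ (t q).act = true := by
  unfold Acw
  cases b
  · simp only [cond, Bool.not_false]
    constructor
    · rintro ⟨a, _, h⟩; exact h
    · intro h; exact ⟨x0, trivial, h⟩
  · simp only [cond, Bool.not_true]
    constructor
    · rintro ⟨a, _, h⟩; exact h
    · intro h; exact ⟨x0, trivial, h⟩

theorem treeM_I (q : List ℕ) (i : ℕ) (x : D) :
    x ∈ treeI t As q (2*i) ↔ x ∈ (t q).X i := by
  simp [treeI]

theorem treeM_R (p : List ℕ) (k : Fin (K+1)) (v : List ℕ × Fin (K+1)) :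
    (treeF K).R (mD (tyP p)) (p, k) v ↔ ∃ j, v = (p ++ [j], k) := by
  refine (treeR_mD K _ _ _).trans ?_
  obtain ⟨q, k'⟩ := v
  simp only [cl_succ, Prod.mk.injEq]
  constructor
  · rintro ⟨rfl, j, rfl⟩; exact ⟨j, rfl, rfl⟩
  · rintro ⟨j, rfl, rfl⟩; exact ⟨rfl, j, rfl⟩

theorem treeM_eval (B : ℕ) (d : Dv) : ∀ (p : List ℕ) (a : D), Sat B d (fun q => t (p ++ q)) →
    (treeM K t en cs As x0).eval (fm B d (tyP p)) (p, (0 : Fin (K+1))) a := by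
  induction d with
  | zero i =>
    intro p a h
    simp only [Sat, List.append_nil] at h
    simp only [fm, eval_neg', eval_ex', eval_fX, treeM_I, h]
    simp
  | one i =>
    intro p a h
    simp only [Sat, List.append_nil] at h
    simp only [fm, eval_and', eval_ex', eval_fX, eval_all', eval_imp', treeM_I, h]
    refine ⟨⟨(t p).c, trivial, by simp⟩, fun b _ hb => ?_⟩
    simp only [Finset.mem_singleton] at hb
    subst hb
    rfl
  | or d e ihd ihe =>
    intro p a h
    simp only [fm, eval_or']
    rcases h with h | h
    · exact Or.inl (ihd p a h)
    · exact Or.inr (ihe p a h)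
  | and d e ihd ihe =>
    intro p a h
    simp only [fm, eval_and', eval_fdia, eval_frigs, treeM_I]
    obtain ⟨h1, ⟨j, h2⟩, ⟨j', h3⟩⟩ := h
    refine ⟨?_, ⟨(p ++ [j], 0), (treeM_R K p 0 _).2 ⟨j, rfl⟩, ?_⟩,
      ⟨(p ++ [j'], 0), (treeM_R K p 0 _).2 ⟨j', rfl⟩, ?_⟩⟩
    · intro v hv i hi _ x _
      obtain ⟨j, rfl⟩ := (treeM_R K p 0 _).1 hv
      have := h1 j i hi
      simp only [List.append_nil] at this
      rw [this]
    · rw [← tyP_append p j]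
      exact ihd _ a (by simpa using h2)
    · rw [← tyP_append p j']
      exact ihe _ a (by simpa using h3)
  | ex k d ih =>
    intro p a h
    simp only [fm, eval_and', eval_fdia, eval_frigs, treeM_I]
    obtain ⟨h1, ⟨j, h2⟩⟩ := h
    refine ⟨?_, ⟨(p ++ [j], 0), (treeM_R K p 0 _).2 ⟨j, rfl⟩, ?_⟩⟩
    · intro v hv i hi hik x _
      obtain ⟨j, rfl⟩ := (treeM_R K p 0 _).1 hv
      have := h1 j i hi (by simpa using hik)
      simp only [List.append_nil] at this
      rw [this]
    · rw [← tyP_append p j]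
      exact ih _ a (by simpa using h2)
  | sum κ ls d ih =>
    intro p a h
    simp only [fm, eval_and', eval_neg', eval_box', eval_imp', eval_fAc, eval_frigs, eval_fconj,
      List.mem_map, treeM_I]
    obtain ⟨h1, h2, h3⟩ := h
    simp only [List.append_nil] at h1 h2 h3
    refine ⟨?_, ?_, ?_, ?_⟩
    · intro v hv i hi hik x _
      obtain ⟨j, rfl⟩ := (treeM_R K p 0 _).1 hv
      rw [h1 j i hi hik]
    · rw [treeM_Acw]; simp
    · intro v hv hac
      obtain ⟨j, rfl⟩ := (treeM_R K p 0 _).1 hv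
      rw [treeM_Acw] at hac
      rw [← tyP_append p j]
      exact ih _ a (by simpa using h2 j hac.2)
    · rintro _ ⟨l, hl, rfl⟩
      obtain ⟨h4, h5⟩ := h3 l hl
      simp only [eval_fsum1, treeM_I]
      refine ⟨?_, ?_, ?_⟩
      · intro x _ hx
        obtain ⟨j, hj1, hj2⟩ := (h4 x).1 hx
        exact ⟨(p ++ [j], 0), (treeM_R K p 0 _).2 ⟨j, rfl⟩,
          (treeM_Acw ..).2 ⟨tyP_append p j, hj1⟩, hj2⟩
      · intro x _ hx v hv hac hxv
        obtain ⟨j, rfl⟩ := (treeM_R K p 0 _).1 hv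
        rw [treeM_Acw] at hac
        exact hx ((h4 x).2 ⟨j, hac.2, hxv⟩)
      · intro v hv hac x _ hxv u hu hau hxu
        obtain ⟨j, rfl⟩ := (treeM_R K p 0 _).1 hv
        obtain ⟨q, k'⟩ := u
        have hu' := (treeR_mD K _ _ _).1 hu
        rw [treeM_Acw] at hac hau
        rcases cl_succ2 hu'.2 with e | ⟨j', hne, e⟩
        · simp only at e; subst e
          have := hau.1
          simp at this
        · simp only at e; subst e
          exact h5 j j' x hne hac.2 hau.2 hxv hxu
end
end OneVarEq

namespace OneVarEq

theorem ftime_wf_conv {F : KFrame Bool} (h : FTimeFrame F) : WellFounded fun a b => F.R true b a := by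
  haveI := h.1
  haveI : IsTrans F.W (fun a b => F.R true b a) := ⟨fun a b c h1 h2 => h.2.2.1 _ _ _ h2 h1⟩
  haveI : Std.Irrefl (fun a b : F.W => F.R true b a) := ⟨fun a => h.2.1 a⟩
  exact Finite.wellFounded_of_trans_of_irrefl _
theorem ftime_wf {F : KFrame Bool} (h : FTimeFrame F) : WellFounded (F.R true) := by
  haveI := h.1
  haveI : IsTrans F.W (F.R true) := ⟨fun a b c h1 h2 => h.2.2.1 _ _ _ h1 h2⟩
  haveI : Std.Irrefl (F.R true) := ⟨fun a => h.2.1 a⟩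
  exact Finite.wellFounded_of_trans_of_irrefl _

theorem ftime_succ {F : KFrame Bool} (h : FTimeFrame F) (w v : F.W) :
    F.R true w v ↔ F.R false w v ∨ ∃ u, F.R false w u ∧ F.R true u v := by
  constructor
  · intro hv
    obtain ⟨u, hu, hm⟩ := (ftime_wf h).has_min {x | F.R true w x} ⟨v, hv⟩
    have hs : F.R false w u := (h.2.2.2.2 w u).2 ⟨hu, fun ⟨x, hx, hx'⟩ => hm x hx hx'⟩
    by_cases e : v = u
    · subst e; exact Or.inl hs
    · exact Or.inr ⟨u, hs, (h.2.2.2.1 v u e).resolve_left (hm v hv)⟩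
  · rintro (hs | ⟨u, hs, hu⟩)
    · exact ((h.2.2.2.2 _ _).1 hs).1
    · exact h.2.2.1 _ _ _ ((h.2.2.2.2 _ _).1 hs).1 hu

theorem ftime_fun {F : KFrame Bool} (h : FTimeFrame F) (w u v : F.W) (h1 : F.R false w u)
    (h2 : F.R false w v) : u = v := by
  by_contra e
  have h1' := (h.2.2.2.2 _ _).1 h1
  have h2' := (h.2.2.2.2 _ _).1 h2
  rcases h.2.2.2.1 u v e with h' | h'
  · exact h2'.2 ⟨u, h1'.1, h'⟩
  · exact h1'.2 ⟨v, h2'.1, h'⟩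

section
variable {M : Type} {F : KFrame M} (V : ℕ → F.W → Prop)
theorem pval_imp (φ ψ : PF M) (w) : PVal (F := F) V (PF.imp φ ψ) w ↔ (PVal (F := F) V φ w → PVal (F := F) V ψ w) := by
  simp [PF.imp, PVal]
theorem pval_dia (m) (φ : PF M) (w) : PVal (F := F) V (PF.dia m φ) w ↔ ∃ v, F.R m w v ∧ PVal (F := F) V φ v := by
  simp [PF.dia, PVal]
end

theorem Cftime_fun {F : KFrame Bool} (h : F ∈ Cftime) (w u v : F.W) (h1 : F.R false w u)
    (h2 : F.R false w v) : u = v := by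
  have := h (PF.imp (PF.dia false (.atom 0)) (.box false (.atom 0))) (by
    intro G hG V x
    rw [pval_imp, pval_dia]
    rintro ⟨y, hy, hp⟩ z hz
    rw [ftime_fun hG _ _ _ hz hy]; exact hp) (fun _ x => x = v) w
  rw [pval_imp, pval_dia] at this
  exact this ⟨v, h2, rfl⟩ u h1

theorem Cftime_succ {F : KFrame Bool} (h : F ∈ Cftime) (w v : F.W) :
    F.R true w v ↔ F.R false w v ∨ ∃ u, F.R false w u ∧ F.R true u v := by
  constructor
  · intro hv
    have := h (PF.imp (PF.dia true (.atom 0)) (PF.imp (PF.neg (PF.dia false (.atom 0))) (PF.dia false (PF.dia true (.atom 0))))) (by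
      intro G hG V x
      simp only [pval_imp, pval_dia, PVal]
      rintro ⟨y, hy, hp⟩ hn
      rcases (ftime_succ hG _ _).1 hy with h' | ⟨u, hu, h'⟩
      · exact absurd ⟨y, h', hp⟩ hn
      · exact ⟨u, hu, y, h', hp⟩) (fun _ x => x = v) w
    simp only [pval_imp, pval_dia, PVal] at this
    by_cases hs : F.R false w v
    · exact Or.inl hs
    · obtain ⟨u, hu, x, hx, rfl⟩ := this ⟨v, hv, rfl⟩ (by rintro ⟨x, hx, rfl⟩; exact hs hx)
      exact Or.inr ⟨u, hu, hx⟩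
  · rintro (hs | ⟨u, hs, hu⟩)
    · have := h (PF.imp (PF.dia false (.atom 0)) (PF.dia true (.atom 0))) (by
        intro G hG V x
        simp only [pval_imp, pval_dia, PVal]
        rintro ⟨y, hy, hp⟩
        exact ⟨y, (ftime_succ hG _ _).2 (Or.inl hy), hp⟩) (fun _ x => x = v) w
      simp only [pval_imp, pval_dia, PVal] at this
      obtain ⟨x, hx, rfl⟩ := this ⟨v, hs, rfl⟩
      exact hx
    · have := h (PF.imp (PF.dia false (PF.dia true (.atom 0))) (PF.dia true (.atom 0))) (by
        intro G hG V x
        simp only [pval_imp, pval_dia, PVal]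
        rintro ⟨y, hy, z, hz, hp⟩
        exact ⟨z, (ftime_succ hG _ _).2 (Or.inr ⟨y, hy, hz⟩), hp⟩) (fun _ x => x = v) w
      simp only [pval_imp, pval_dia, PVal] at this
      obtain ⟨x, hx, rfl⟩ := this ⟨u, hs, v, hu, rfl⟩
      exact hx

theorem Cftime_wf {F : KFrame Bool} (h : F ∈ Cftime) : WellFounded fun a b => F.R true b a := by
  rw [WellFounded.wellFounded_iff_has_min]
  intro s ⟨w, hw⟩
  by_contra hc
  push Not at hc
  have := h (PF.imp (.box true (PF.imp (.box true (.atom 0)) (.atom 0))) (.box true (.atom 0))) (by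
    intro G hG V x
    simp only [pval_imp, PVal]
    intro hx y
    induction y using (ftime_wf_conv hG).induction with
    | _ y ih => exact fun hy => hx y hy fun z hz => ih z hz (hG.2.2.1 _ _ _ hy hz)) (fun _ x => x ∉ s) w
  simp only [pval_imp, PVal] at this
  obtain ⟨v, hv, hr⟩ := hc w hw
  refine this ?_ v hr hv
  intro y hy hy' hys
  obtain ⟨z, hz, hr⟩ := hc y hys
  exact hy' z hr hz

theorem Cftime_finite {F : KFrame Bool} (h : F ∈ Cftime) (w : F.W) : {v | F.R true w v}.Finite := by
  induction w using (Cftime_wf h).induction with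
  | _ w ih =>
    by_cases hs : ∃ u, F.R false w u
    · obtain ⟨u, hu⟩ := hs
      refine ((ih u ((Cftime_succ h _ _).2 (Or.inl hu))).insert u).subset ?_
      intro v hv
      rcases (Cftime_succ h _ _).1 hv with h' | ⟨u', hu', h'⟩
      · exact Or.inl (Cftime_fun h _ _ _ h' hu)
      · rw [Cftime_fun h _ _ _ hu' hu] at h'; exact Or.inr h'
    · refine Set.finite_empty.subset ?_
      intro v hv
      rcases (Cftime_succ h _ _).1 hv with h' | ⟨u', hu', h'⟩
      · exact hs ⟨_, h'⟩
      · exact hs ⟨_, hu'⟩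
end OneVarEq

namespace OneVarEq
open Function

def fA (i : ℕ) (t : ETm) : EF S3 := .pred (2*i+5) t
def fst' (i : ℕ) : EF S3 :=
  .and (EF.all (EF.iff (fA (i+1) .var) (EF.or (fA i .var) (.eq .var (.const (i+1))))))
    (.neg (fA i (.const (i+1))))
def fnum : ℕ → EF S3
  | 0 => .neg (.ex (fA 0 .var))
  | n+1 => .and (fnum n) (fst' n)
def fphi (B : ℕ) (d : Dv) (n : ℕ) : EF S3 :=
  .and (EF.all (fdia mL (.eq .var (.const 0))))
    (.and (fm B d true) (.and (fnum n) (EF.all (EF.iff (fA n .var) (fX 0)))))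

/-! #### primitive recursiveness of the code -/
def PE (f : ℕ → EF S3) : Prop := Primrec fun n => EF.encode eS3 (f n)
theorem PE.const (φ) : PE fun _ => φ := Primrec.const _
theorem PE.neg {f} (h : PE f) : PE fun n => .neg (f n) :=
  Primrec₂.natPair.comp (Primrec.const 2) h
theorem PE.ex {f} (h : PE f) : PE fun n => .ex (f n) :=
  Primrec₂.natPair.comp (Primrec.const 4) h
theorem PE.and {f g} (h : PE f) (h' : PE g) : PE fun n => .and (f n) (g n) :=
  Primrec₂.natPair.comp (Primrec.const 3) (Primrec₂.natPair.comp h h')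
theorem PE.all {f} (h : PE f) : PE fun n => EF.all (f n) := h.neg.ex.neg
theorem PE.imp {f g} (h : PE f) (h' : PE g) : PE fun n => EF.imp (f n) (g n) := (h.and h'.neg).neg
theorem PE.or {f g} (h : PE f) (h' : PE g) : PE fun n => EF.or (f n) (g n) := (h.neg.and h'.neg).neg
theorem PE.iff {f g} (h : PE f) (h' : PE g) : PE fun n => EF.iff (f n) (g n) := (h.imp h').and (h'.imp h)
theorem PE.pred {f : ℕ → ℕ} (h : Primrec f) (t : ℕ → ETm) (h' : Primrec fun n => (t n).code) :
    PE fun n => .pred (f n) (t n) :=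
  Primrec₂.natPair.comp (Primrec.const 0) (Primrec₂.natPair.comp h h')
theorem PE.fA {f : ℕ → ℕ} (h : Primrec f) (t : ℕ → ETm) (h' : Primrec fun n => (t n).code) :
    PE fun n => fA (f n) (t n) :=
  PE.pred (Primrec.nat_add.comp (Primrec.nat_mul.comp (Primrec.const 2) h) (Primrec.const 5)) t h'
theorem PE_fst : PE fst' := by
  refine PE.and (PE.all (PE.iff (PE.fA Primrec.succ _ (Primrec.const 0)) (PE.or
    (PE.fA Primrec.id _ (Primrec.const 0)) ?_))) (PE.neg (PE.fA Primrec.id (fun i => .const (i+1)) ?_))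
  · exact Primrec₂.natPair.comp (Primrec.const 1) (Primrec₂.natPair.comp (Primrec.const 0)
      (Primrec.succ.comp Primrec.succ))
  · exact Primrec.succ.comp Primrec.succ
theorem PE_fnum : PE fnum := by
  have : Primrec fun n : ℕ => (Nat.rec (EF.encode eS3 (fnum 0))
      (fun k c => Nat.pair 3 (Nat.pair c (EF.encode eS3 (fst' k)))) n : ℕ) := by
    refine Primrec.nat_rec₁ _ ?_
    exact Primrec₂.natPair.comp (Primrec.const 3) (Primrec₂.natPair.comp Primrec.snd
      ((show Primrec _ from PE_fst).comp Primrec.fst))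
  refine this.of_eq fun n => ?_
  induction n with
  | zero => rfl
  | succ n ih => simp only [ih]; rfl
theorem PE_fphi (B d) : PE fun n => .neg (fphi B d n) :=
  (PE.and (PE.const _) (PE.and (PE.const _) (PE.and PE_fnum (PE.all (PE.iff
    (PE.fA Primrec.id _ (Primrec.const 0)) (PE.const _)))))).neg

theorem eval_fA {F : KFrame S3} (𝔪 : EModel F) (i t w a) :
  𝔪.eval (fA i t) w a ↔ 𝔪.tmVal w a t ∈ 𝔪.I w (2*i+5) := Iff.rfl
theorem eval_fst {F : KFrame S3} (𝔪 : EModel F) (i w a) :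
  𝔪.eval (fst' i) w a ↔ (∀ x ∈ 𝔪.dom w, (x ∈ 𝔪.I w (2*(i+1)+5) ↔ x ∈ 𝔪.I w (2*i+5) ∨ x = 𝔪.cst w (i+1))) ∧
    𝔪.cst w (i+1) ∉ 𝔪.I w (2*i+5) := by
  simp only [fst', eval_and', eval_all', eval_iff', eval_or', eval_neg', eval_fA, EModel.tmVal, EModel.eval]

theorem fnum_sound {F : KFrame S3} (𝔪 : EModel F) (w a) (hf : (𝔪.dom w).Finite) : ∀ n,
    𝔪.eval (fnum n) w a → (𝔪.I w (2*n+5) ∩ 𝔪.dom w).ncard = n := by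
  intro n
  induction n with
  | zero =>
    intro h
    have : 𝔪.I w (2*0+5) ∩ 𝔪.dom w = ∅ := by
      ext x
      simp only [Set.mem_inter_iff, Set.mem_empty_iff_false, iff_false]
      rintro ⟨h1, h2⟩
      exact h ⟨x, h2, h1⟩
    rw [this]; simp
  | succ n ih =>
    intro h
    rw [fnum, eval_and', eval_fst] at h
    obtain ⟨h1, h2, h3⟩ := h
    have e : 𝔪.I w (2*(n+1)+5) ∩ 𝔪.dom w = insert (𝔪.cst w (n+1)) (𝔪.I w (2*n+5) ∩ 𝔪.dom w) := by
      ext x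
      simp only [Set.mem_inter_iff, Set.mem_insert_iff]
      constructor
      · rintro ⟨hx, hd⟩
        rcases (h2 x hd).1 hx with h | h
        · exact Or.inr ⟨h, hd⟩
        · exact Or.inl h
      · rintro (rfl | ⟨hx, hd⟩)
        · exact ⟨(h2 _ (𝔪.cstMem _ _)).2 (Or.inr rfl), 𝔪.cstMem _ _⟩
        · exact ⟨(h2 x hd).2 (Or.inl hx), hd⟩
    rw [e, Set.ncard_insert_of_notMem (fun hh => h3 hh.1) (hf.subset Set.inter_subset_right), ih h1]

theorem fphi_sound {F : KFrame S3} (hF : F ∈ frameFusion Cdiff (frameFusion Cdiff Cftime)) (𝔪 : EModel F)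
    (B : ℕ) (d : Dv) (hB : d.bd ≤ B) (hB1 : 1 ≤ B) (n w a) (h : 𝔪.eval (fphi B d n) w a) :
    ∃ v : ℕ → ℕ, v 0 = n ∧ d.sem v := by
  simp only [fphi, eval_and', eval_all', eval_fdia, eval_iff', eval_fA, eval_fX, EModel.tmVal] at h
  obtain ⟨h1, h2, h3, h4⟩ := h
  have hfin : (𝔪.dom w).Finite := by
    have : {v | F.R mL w v}.Finite := Cftime_finite (F := (F.reduct Sum.inr).reduct Sum.inr) hF.2.2 w
    refine (this.image fun v => 𝔪.cst v 0).subset ?_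
    intro x hx
    obtain ⟨v, hv, e⟩ := h1 x hx
    exact ⟨v, hv, e.symm⟩
  have hd : ∀ b, IsDiff (F.R (mD b)) := by
    intro b
    cases b
    · exact (mem_Cdiff_iff _).1 hF.2.1
    · exact (mem_Cdiff_iff _).1 hF.1
  refine ⟨_, ?_, fm_sound 𝔪 hd B d true w a hB hfin h2⟩
  rw [vl, if_pos (by omega), ← fnum_sound 𝔪 w a hfin n h3]
  congr 1
  ext x
  simp only [Set.mem_inter_iff]
  exact ⟨fun hh => ⟨(h4 x hh.2).2 hh.1, hh.2⟩, fun hh => ⟨(h4 x hh.2).1 hh.1, hh.2⟩⟩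

theorem fphi_complete (B : ℕ) (d : Dv) (hB : d.bd ≤ B) (v : ℕ → ℕ)
    (hv : d.sem v) : ∃ F ∈ frameFusion Cdiff (frameFusion Cdiff Cftime), ∃ (𝔪 : EModel F) (w : F.W) (a : 𝔪.D),
    a ∈ 𝔪.dom w ∧ 𝔪.eval (fphi B d (v 0)) w a := by
  obtain ⟨N0, hN⟩ := sat_complete B d v hB hv
  obtain ⟨N, hN1, hN2⟩ : ∃ N, N0 ≤ N ∧ ∀ i ≤ B, v i ≤ N := by
    refine ⟨N0 + ∑ i ∈ Finset.range (B+1), v i, by omega, fun i hi => ?_⟩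
    have := Finset.single_le_sum (f := v) (s := Finset.range (B+1)) (by simp) (Finset.mem_range.2 (show i < B+1 by omega))
    omega
  have hcard : ∀ k ≤ N, (Finset.univ.filter fun x : Fin (N+1) => x.val < k).card = k := by
    intro k hk
    rw [Fin.card_filter_val_lt]; omega
  obtain ⟨t, ht1, ht2, ht3⟩ := hN (Fin (N+1)) (by simp; omega)
    (fun i => Finset.univ.filter fun x : Fin (N+1) => x.val < v i)
    (fun i hi => hcard _ (hN2 i hi.le)) true
  let el : ℕ → Fin (N+1) := fun i => ⟨i % (N+1), Nat.mod_lt _ (by omega)⟩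
  refine ⟨treeF (N+1), treeF_mem _, treeM (N+1) t (fun k => el (k-1)) el
    (fun i => {x | x.val < i}) 0, ([], 0), (0 : Fin (N+1)), trivial, ?_⟩
  have hI : ∀ i (x : Fin (N+1)), x ∈ treeI t (fun i => {x : Fin (N+1) | x.val < i}) [] (2*i+5) ↔ x.val < i := by
    intro i x
    have e1 : (2*i+5)%2 ≠ 0 := by omega
    have e2 : (2*i+5-5)/2 = i := by omega
    simp [treeI, e1, e2]
  have hnum : ∀ n ≤ v 0, (treeM (N+1) t (fun k => el (k-1)) el
    (fun i => {x | x.val < i}) 0).eval (fnum n) ([], 0) (0 : Fin (N+1)) := by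
    intro n
    induction n with
    | zero =>
      rintro - ⟨x, -, hx⟩
      have := (hI 0 x).1 hx
      omega
    | succ n ih =>
      intro hn
      have hv0 := hN2 0 (by omega)
      have hel : (el n).val = n := Nat.mod_eq_of_lt (by omega)
      rw [fnum, eval_and', eval_fst]
      refine ⟨ih (by omega), fun x _ => ?_, ?_⟩
      · refine (hI (n+1) x).trans (Iff.trans ?_ (or_congr (hI n x).symm (Iff.rfl (a := x = el n))))
        rw [Fin.ext_iff, hel]; omega
      · intro hx
        have := (hI n (el n)).1 hx
        omega
  simp only [fphi, eval_and', eval_all', eval_fdia, eval_iff', eval_fA, eval_fX, EModel.tmVal]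
  refine ⟨?_, ?_, hnum _ le_rfl, ?_⟩
  · intro (x : Fin (N+1)) _
    have hx := x.2
    refine ⟨([], ⟨x.val+1, by omega⟩), ⟨rfl, ?_⟩, ?_⟩
    · rw [Fin.lt_def]; simp
    · change x = if (⟨x.val+1, by omega⟩ : Fin (N+1+1)) = 0 then (t []).c else el (x.val + 1 - 1)
      rw [if_neg (by rw [Fin.ext_iff]; simp)]
      ext
      simp only [Nat.add_sub_cancel]
      exact (Nat.mod_eq_of_lt hx).symm
  · exact treeM_eval (N+1) t _ _ _ 0 B d [] _ ht3
  · intro x _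
    refine (hI (v 0) x).trans (Iff.symm ((treeM_I t _ [] 0 x).trans ?_))
    rw [ht1]; simp

theorem eS3_inj : Injective eS3 := by
  rintro (⟨⟩ | ⟨⟩ | a) (⟨⟩ | ⟨⟩ | b) h <;> first | rfl | (cases a <;> cases b <;> first | rfl | cases h) | (cases a <;> cases h) | (cases b <;> cases h) | cases h

theorem part3 : ¬ DecidableELogic eS3 (LogED DSem.xd (frameFusion Cdiff (frameFusion Cdiff Cftime))) := by
  intro hdec
  obtain ⟨d, hd⟩ := exists_dv_undec
  apply hd
  have h1 : ComputablePred fun n : ℕ => ∃ φ ∈ LogED DSem.xd (frameFusion Cdiff (frameFusion Cdiff Cftime)),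
      EF.encode eS3 φ = EF.encode eS3 (.neg (fphi (max d.bd 1) d n)) := by
    obtain ⟨f, hf, e⟩ := ComputablePred.computable_iff.1 hdec
    refine ComputablePred.computable_iff.2 ⟨fun n => f (EF.encode eS3 (.neg (fphi (max d.bd 1) d n))),
      hf.comp (PE_fphi _ d).to_comp, ?_⟩
    funext n
    exact congrFun e _
  refine (ComputablePred.not h1).of_eq fun n => ?_
  constructor
  · intro hn
    by_contra hc
    apply hn
    refine ⟨_, ?_, rfl⟩
    intro F hF 𝔪 _ w a ha h
    exact hc (fphi_sound hF 𝔪 _ d (le_max_left _ _) (le_max_right _ _) n w a h)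
  · rintro ⟨v, rfl, hv⟩ ⟨φ, hφ, e⟩
    rw [encode_inj eS3_inj _ _ e] at hφ
    obtain ⟨F, hF, 𝔪, w, a, ha, h⟩ := fphi_complete (max d.bd 1) d (le_max_left _ _) v hv
    exact hφ F hF 𝔪 (by intro h; cases h) w a ha h
end OneVarEq

namespace OneVarEq
open Function

/-! ### primitive recursive predicates -/
attribute [fun_prop] Primrec
attribute [fun_prop] Primrec.id Primrec.comp Primrec.const Primrec.pair

section PR
variable {α β : Type} [Primcodable α] [Primcodable β]
@[fun_prop] theorem pr_add {f g : α → ℕ} (hf : Primrec f) (hg : Primrec g) :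
    Primrec fun a => f a + g a := Primrec.nat_add.comp hf hg
@[fun_prop] theorem pr_sub {f g : α → ℕ} (hf : Primrec f) (hg : Primrec g) :
    Primrec fun a => f a - g a := Primrec.nat_sub.comp hf hg
@[fun_prop] theorem pr_mul {f g : α → ℕ} (hf : Primrec f) (hg : Primrec g) :
    Primrec fun a => f a * g a := Primrec.nat_mul.comp hf hg
@[fun_prop] theorem pr_div {f g : α → ℕ} (hf : Primrec f) (hg : Primrec g) :
    Primrec fun a => f a / g a := Primrec.nat_div.comp hf hg
@[fun_prop] theorem pr_mod {f g : α → ℕ} (hf : Primrec f) (hg : Primrec g) :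
    Primrec fun a => f a % g a := Primrec.nat_mod.comp hf hg
@[fun_prop] theorem pr_npair {f g : α → ℕ} (hf : Primrec f) (hg : Primrec g) :
    Primrec fun a => Nat.pair (f a) (g a) := Primrec₂.natPair.comp hf hg
@[fun_prop] theorem pr_pow {f g : α → ℕ} (hf : Primrec f) (hg : Primrec g) :
    Primrec fun a => f a ^ g a := by
  have : Primrec fun a => (Nat.rec 1 (fun _ c => c * f a) (g a) : ℕ) :=
    Primrec.nat_rec' hg (Primrec.const 1) (h := fun a (x : ℕ × ℕ) => x.2 * f a)
      (Primrec.nat_mul.comp (Primrec.snd.comp Primrec.snd) (hf.comp Primrec.fst)).to₂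
  refine this.of_eq fun a => ?_
  generalize g a = n
  induction n with
  | zero => rfl
  | succ n ih => rw [pow_succ, ← ih]
@[fun_prop] theorem pr_len {f : α → List β} (hf : Primrec f) : Primrec fun a => (f a).length :=
  Primrec.list_length.comp hf
@[fun_prop] theorem pr_range {f : α → ℕ} (hf : Primrec f) : Primrec fun a => List.range (f a) :=
  Primrec.list_range.comp hf
@[fun_prop] theorem pr_getD {f : α → List β} {g : α → ℕ} (d : β) (hf : Primrec f) (hg : Primrec g) :
    Primrec fun a => (f a).getD (g a) d := (Primrec.list_getD d).comp hf hg

@[fun_prop] theorem pr_fst {γ : Type} [Primcodable γ] {f : α → β × γ} (hf : Primrec f) :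
    Primrec fun a => (f a).1 := Primrec.fst.comp hf
@[fun_prop] theorem pr_snd {γ : Type} [Primcodable γ] {f : α → β × γ} (hf : Primrec f) :
    Primrec fun a => (f a).2 := Primrec.snd.comp hf

def PP (p : α → Prop) : Prop := PrimrecPred p

theorem PP.of_iff {p q : α → Prop} (h : PP q) (e : ∀ a, p a ↔ q a) : PP p := PrimrecPred.of_eq h fun a => (e a).symm
theorem PP.true : PP fun _ : α => True := (PrimrecPred.of_eq (Primrec.eq.comp (Primrec.const 0) (Primrec.const 0)) (by simp))
theorem PP.and {p q : α → Prop} (hp : PP p) (hq : PP q) : PP fun a => p a ∧ q a := PrimrecPred.and hp hq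
theorem PP.or {p q : α → Prop} (hp : PP p) (hq : PP q) : PP fun a => p a ∨ q a := PrimrecPred.or hp hq
theorem PP.not {p : α → Prop} (hp : PP p) : PP fun a => ¬ p a := PrimrecPred.not hp
theorem PP.imp {p q : α → Prop} (hp : PP p) (hq : PP q) : PP fun a => p a → q a :=
  (hp.not.or hq).of_iff fun a => by tauto
theorem PP.iff {p q : α → Prop} (hp : PP p) (hq : PP q) : PP fun a => (p a ↔ q a) :=
  ((hp.imp hq).and (hq.imp hp)).of_iff fun a => by tauto
theorem PP.eq {f g : α → ℕ} (hf : Primrec f) (hg : Primrec g) : PP fun a => f a = g a := Primrec.eq.comp hf hg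
theorem PP.ne {f g : α → ℕ} (hf : Primrec f) (hg : Primrec g) : PP fun a => f a ≠ g a := (PP.eq hf hg).not
theorem PP.lt {f g : α → ℕ} (hf : Primrec f) (hg : Primrec g) : PP fun a => f a < g a := Primrec.nat_lt.comp hf hg
theorem PP.le {f g : α → ℕ} (hf : Primrec f) (hg : Primrec g) : PP fun a => f a ≤ g a := Primrec.nat_le.comp hf hg
theorem PP.comp {p : β → Prop} (hp : PP p) {f : α → β} (hf : Primrec f) : PP fun a => p (f a) := PrimrecPred.comp hp hf
theorem PP.all_mem {p : α → β → Prop} {f : α → List β} (hf : Primrec f) (hp : PP fun x : α × β => p x.1 x.2) :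
    PP fun a => ∀ x ∈ f a, p a x := by
  have h : PrimrecRel fun (b : β) (a : α) => p a b := hp.comp (f := fun x : β × α => (x.2, x.1)) (by fun_prop)
  exact h.forall_mem_list.comp hf Primrec.id
theorem PP.ex_mem {p : α → β → Prop} {f : α → List β} (hf : Primrec f) (hp : PP fun x : α × β => p x.1 x.2) :
    PP fun a => ∃ x ∈ f a, p a x := by
  have h : PrimrecRel fun (b : β) (a : α) => p a b := hp.comp (f := fun x : β × α => (x.2, x.1)) (by fun_prop)
  exact h.exists_mem_list.comp hf Primrec.id
theorem PP.all_lt {p : α → ℕ → Prop} {f : α → ℕ} (hf : Primrec f) (hp : PP fun x : α × ℕ => p x.1 x.2) :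
    PP fun a => ∀ x < f a, p a x :=
  (PP.all_mem (pr_range hf) hp).of_iff fun a => by simp
theorem PP.ex_lt {p : α → ℕ → Prop} {f : α → ℕ} (hf : Primrec f) (hp : PP fun x : α × ℕ => p x.1 x.2) :
    PP fun a => ∃ x < f a, p a x :=
  (PP.ex_mem (pr_range hf) hp).of_iff fun a => by simp
theorem PP.all_le {p : α → ℕ → Prop} {f : α → ℕ} (hf : Primrec f) (hp : PP fun x : α × ℕ => p x.1 x.2) :
    PP fun a => ∀ x ≤ f a, p a x :=
  (PP.all_lt (f := fun a => f a + 1) (by fun_prop) hp).of_iff fun a => by simp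
theorem PP.ex_le {p : α → ℕ → Prop} {f : α → ℕ} (hf : Primrec f) (hp : PP fun x : α × ℕ => p x.1 x.2) :
    PP fun a => ∃ x ≤ f a, p a x :=
  (PP.ex_lt (f := fun a => f a + 1) (by fun_prop) hp).of_iff fun a => by simp
theorem PP.computable {p : α → Prop} (hp : PP p) : ComputablePred p := by
  obtain ⟨i, h⟩ := hp
  exact ⟨i, h.to_comp⟩
theorem PP.re_ex {p : α → ℕ → Prop} (hp : PP fun x : α × ℕ => p x.1 x.2) : REPred fun a => ∃ n, p a n := by
  classical
  have hd : Primrec fun x : α × ℕ => decide (p x.1 x.2) := by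
    obtain ⟨i, h⟩ := hp
    convert h
  have : Partrec fun a => Nat.rfind (fun n => Part.some (decide (p a n)) : ℕ →. Bool) :=
    Partrec.rfind (p := fun a => (fun n => Part.some (decide (p a n)) : ℕ →. Bool)) (Computable.partrec hd.to_comp)
  refine this.dom_re.of_eq fun a => ?_
  refine (Nat.rfind_dom (p := (fun n => Part.some (decide (p a n)) : ℕ →. Bool))).trans ?_
  constructor
  · rintro ⟨n, h, _⟩
    exact ⟨n, by simpa using h⟩
  · rintro ⟨n, h⟩
    exact ⟨n, by simpa using h, fun _ => trivial⟩
theorem PP.re_ex' {p : α → β → Prop} (hp : PP fun x : α × β => p x.1 x.2) : REPred fun a => ∃ b, p a b := by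
  have : PP fun x : α × ℕ => ∃ y ∈ (Encodable.decode (α := β) x.2).toList, p x.1 y := by
    refine PP.ex_mem ?_ (hp.comp (f := fun y : (α × ℕ) × β => (y.1.1, y.2)) (by fun_prop))
    refine (Primrec.option_casesOn (o := fun x : α × ℕ => Encodable.decode (α := β) x.2) (f := fun _ => ([] : List β))
      (g := fun _ b => [b]) (Primrec.decode.comp Primrec.snd) (Primrec.const _) ?_).of_eq ?_
    · exact Primrec.list_cons.comp Primrec.snd (Primrec.const [])
    · intro x; cases Encodable.decode (α := β) x.2 <;> rfl
  refine (PP.re_ex (p := fun a n => ∃ y ∈ (Encodable.decode (α := β) n).toList, p a y) this).of_eq fun a => ?_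
  constructor
  · rintro ⟨n, b, _, h⟩; exact ⟨b, h⟩
  · rintro ⟨b, h⟩; exact ⟨Encodable.encode b, b, by simp, h⟩
end PR

/-! ### digits -/
def dg (b c i : ℕ) : ℕ := c / b ^ i % b
@[fun_prop] theorem pr_dg {α : Type} [Primcodable α] {f g h : α → ℕ} (hf : Primrec f) (hg : Primrec g) (hh : Primrec h) :
    Primrec fun a => dg (f a) (g a) (h a) := by unfold dg; fun_prop
theorem dg_exists (b : ℕ) : ∀ (len : ℕ) (g : ℕ → ℕ), (∀ i < len, g i < b) →
    ∃ c < b ^ len, ∀ i < len, dg b c i = g i := by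
  intro len
  induction len with
  | zero => intro g _; exact ⟨0, by simp, by simp⟩
  | succ n ih =>
    intro g hg
    obtain ⟨c, hc, h⟩ := ih (fun i => g (i+1)) fun i hi => hg (i+1) (by omega)
    have h0 := hg 0 (by omega)
    refine ⟨c * b + g 0, ?_, ?_⟩
    · rw [pow_succ]; nlinarith
    · intro i hi
      cases i with
      | zero => simp [dg, Nat.mod_eq_of_lt h0]
      | succ i =>
        rw [← h i (by omega)]
        unfold dg
        rw [pow_succ', ← Nat.div_div_eq_div_mul]
        congr 2
        rw [Nat.mul_comm, Nat.mul_add_div (by omega), Nat.div_eq_of_lt h0]; rfl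
theorem dg_lt {b c i : ℕ} (hb : 0 < b) : dg b c i < b := Nat.mod_lt _ hb

def bt (c i : ℕ) : Prop := dg 2 c i = 1
theorem bt_exists (len : ℕ) (P : ℕ → Prop) : ∃ c < 2 ^ len, ∀ i < len, (bt c i ↔ P i) := by
  classical
  obtain ⟨c, hc, h⟩ := dg_exists 2 len (fun i => if P i then 1 else 0) (by intro i _; split_ifs <;> omega)
  refine ⟨c, hc, fun i hi => ?_⟩
  unfold bt; rw [h i hi]; split_ifs with h' <;> simp [h']
theorem PP.bt {α : Type} [Primcodable α] {g h : α → ℕ} (hg : Primrec g) (hh : Primrec h) :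
    PP fun a => bt (g a) (h a) := PP.eq (by fun_prop) (by fun_prop)
/-- two numbers below `2^len` with the same bits coincide -/
theorem bt_ext : ∀ (len a b : ℕ), a < 2 ^ len → b < 2 ^ len → (∀ i < len, (bt a i ↔ bt b i)) → a = b := by
  intro len
  induction len with
  | zero => intro a b ha hb _; simp at ha hb; omega
  | succ n ih =>
    intro a b ha hb h
    have h0 := h 0 (by omega)
    have h1 := ih (a/2) (b/2) (by rw [pow_succ] at ha; omega) (by rw [pow_succ] at hb; omega) (by
      intro i hi
      have := h (i+1) (by omega)
      simpa only [bt, dg, pow_succ', ← Nat.div_div_eq_div_mul] using this)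
    simp only [bt, dg, pow_zero, Nat.div_one] at h0
    omega
end OneVarEq

namespace OneVarEq
open Function

theorem lt_pair_of_pos {a : ℕ} (h : 0 < a) (b : ℕ) : b < Nat.pair a b :=
  lt_of_lt_of_le (by omega) (Nat.add_le_pair a b)

def decT : ℕ → ETm
  | 0 => .var
  | k+1 => .const k
theorem decT_code (t : ETm) : decT t.code = t := by cases t <;> rfl

def decF {M : Type} (dM : ℕ → M) : ℕ → ℕ → EF M
  | 0, _ => .eq .var .var
  | f+1, x => match x.unpair.1 with
    | 0 => .pred x.unpair.2.unpair.1 (decT x.unpair.2.unpair.2)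
    | 1 => .eq (decT x.unpair.2.unpair.1) (decT x.unpair.2.unpair.2)
    | 2 => .neg (decF dM f x.unpair.2)
    | 3 => .and (decF dM f x.unpair.2.unpair.1) (decF dM f x.unpair.2.unpair.2)
    | 4 => .ex (decF dM f x.unpair.2)
    | 5 => .box (dM x.unpair.2.unpair.1) (decF dM f x.unpair.2.unpair.2)
    | _ => .eq .var .var

theorem decF_fuel {M : Type} (dM : ℕ → M) : ∀ f g x, x < f → x < g → decF dM f x = decF dM g x := by
  intro f
  induction f with
  | zero => intro g x h; omega
  | succ f ih =>
    intro g x h1 h2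
    obtain ⟨g, rfl⟩ : ∃ g', g = g' + 1 := ⟨g-1, by omega⟩
    have hx := Nat.pair_unpair x
    unfold decF
    rcases Nat.lt_or_ge x.unpair.1 2 with h | h
    · interval_cases h' : x.unpair.1 <;> rfl
    · have a1 : x.unpair.2 < x := by
        conv_rhs => rw [← hx]
        exact lt_pair_of_pos (by omega) _
      have a2 := Nat.unpair_left_le x.unpair.2
      have a3 := Nat.unpair_right_le x.unpair.2
      rw [ih g x.unpair.2 (by omega) (by omega), ih g x.unpair.2.unpair.1 (by omega) (by omega),
        ih g x.unpair.2.unpair.2 (by omega) (by omega)]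

def decE {M : Type} (dM : ℕ → M) (x : ℕ) : EF M := decF dM (x+1) x

section
variable {M : Type} (dM : ℕ → M)
theorem decE_pred (n t) : decE dM (Nat.pair 0 (Nat.pair n t)) = .pred n (decT t) := by
  simp [decE, decF]
theorem decE_eq (s t) : decE dM (Nat.pair 1 (Nat.pair s t)) = .eq (decT s) (decT t) := by
  simp [decE, decF]
theorem decE_neg (y) : decE dM (Nat.pair 2 y) = .neg (decE dM y) := by
  have := lt_pair_of_pos (show 0 < 2 by omega) y
  simp only [decE]; rw [decF]; simp only [Nat.unpair_pair]
  rw [decF_fuel dM _ (y+1) y (by omega) (by omega)]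
theorem decE_ex (y) : decE dM (Nat.pair 4 y) = .ex (decE dM y) := by
  have := lt_pair_of_pos (show 0 < 4 by omega) y
  simp only [decE]; rw [decF]; simp only [Nat.unpair_pair]
  rw [decF_fuel dM _ (y+1) y (by omega) (by omega)]
theorem decE_and (x y) : decE dM (Nat.pair 3 (Nat.pair x y)) = .and (decE dM x) (decE dM y) := by
  have := lt_pair_of_pos (show 0 < 3 by omega) (Nat.pair x y)
  have := Nat.left_le_pair x y
  have := Nat.right_le_pair x y
  simp only [decE]; rw [decF]; simp only [Nat.unpair_pair]
  rw [decF_fuel dM _ (y+1) y (by omega) (by omega), decF_fuel dM _ (x+1) x (by omega) (by omega)]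
theorem decE_box (i y) : decE dM (Nat.pair 5 (Nat.pair i y)) = .box (dM i) (decE dM y) := by
  have := lt_pair_of_pos (show 0 < 5 by omega) (Nat.pair i y)
  have := Nat.right_le_pair i y
  simp only [decE]; rw [decF]; simp only [Nat.unpair_pair]
  rw [decF_fuel dM _ (y+1) y (by omega) (by omega)]
theorem decE_encode (eM : M → ℕ) (h : ∀ m, dM (eM m) = m) (φ : EF M) : decE dM (φ.encode eM) = φ := by
  induction φ with
  | pred n t => simp only [EF.encode, decE_pred, decT_code]
  | eq s t => simp only [EF.encode, decE_eq, decT_code]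
  | neg φ ih => simp only [EF.encode, decE_neg, ih]
  | and φ ψ ih1 ih2 => simp only [EF.encode, decE_and, ih1, ih2]
  | ex φ ih => simp only [EF.encode, decE_ex, ih]
  | box m φ ih => simp only [EF.encode, decE_box, ih, h]
end

/-! ### being a code is primitive recursive -/
def CodeStep (K c x : ℕ) : Prop :=
  x.unpair.1 = 0 ∨ x.unpair.1 = 1 ∨ (x.unpair.1 = 2 ∧ bt c x.unpair.2) ∨
  (x.unpair.1 = 3 ∧ bt c x.unpair.2.unpair.1 ∧ bt c x.unpair.2.unpair.2) ∨
  (x.unpair.1 = 4 ∧ bt c x.unpair.2) ∨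
  (x.unpair.1 = 5 ∧ x.unpair.2.unpair.1 < K ∧ bt c x.unpair.2.unpair.2)

def IsCode (K N : ℕ) : Prop := ∃ c < 2 ^ (N+1), bt c N ∧ ∀ x ≤ N, bt c x → CodeStep K c x

@[fun_prop] theorem pr_un1 {α : Type} [Primcodable α] {f : α → ℕ} (hf : Primrec f) :
    Primrec fun a => (f a).unpair.1 := Primrec.fst.comp (Primrec.unpair.comp hf)
@[fun_prop] theorem pr_un2 {α : Type} [Primcodable α] {f : α → ℕ} (hf : Primrec f) :
    Primrec fun a => (f a).unpair.2 := Primrec.snd.comp (Primrec.unpair.comp hf)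

theorem PP_isCode (K : ℕ) : PP (IsCode K) := by
  unfold IsCode CodeStep
  repeat' first
    | apply PP.ex_lt
    | apply PP.and
    | apply PP.all_le
    | apply PP.or
    | apply PP.bt
    | apply PP.imp
    | apply PP.eq
    | apply PP.lt
  all_goals fun_prop

theorem isCode_iff {M : Type} (eM : M → ℕ) (dM : ℕ → M) (K : ℕ) (h1 : ∀ i < K, eM (dM i) = i)
    (h2 : ∀ m, eM m < K) (N : ℕ) : IsCode K N ↔ ∃ φ : EF M, φ.encode eM = N := by
  constructor
  · rintro ⟨c, -, hN, hc⟩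
    have key : ∀ x ≤ N, bt c x → ∃ φ : EF M, φ.encode eM = x := by
      intro x
      induction x using Nat.strong_induction_on with
      | _ x ih =>
        intro hxN hx
        have hs := hc x hxN hx
        have e := Nat.pair_unpair x
        have e2 := Nat.pair_unpair x.unpair.2
        unfold CodeStep at hs
        generalize x.unpair.1 = a at *
        generalize x.unpair.2 = b at *
        generalize b.unpair.1 = p at *
        generalize b.unpair.2 = q at *
        have l1 := Nat.left_le_pair p q
        have l2 := Nat.right_le_pair p q
        rw [e2] at l1 l2
        have l3 : 0 < a → b < x := fun h => by rw [← e]; exact lt_pair_of_pos h b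
        rcases hs with rfl | rfl | ⟨rfl, h⟩ | ⟨rfl, h, h'⟩ | ⟨rfl, h⟩ | ⟨rfl, h, h'⟩
        · refine ⟨.pred p (decT q), ?_⟩
          have : (decT q).code = q := by cases q <;> rfl
          rw [EF.encode, this, e2, e]
        · refine ⟨.eq (decT p) (decT q), ?_⟩
          have h1 : (decT q).code = q := by cases q <;> rfl
          have h2 : (decT p).code = p := by cases p <;> rfl
          rw [EF.encode, h1, h2, e2, e]
        · obtain ⟨φ, hφ⟩ := ih b (l3 (by omega)) (by have := l3 (by omega); omega) h
          exact ⟨.neg φ, by rw [EF.encode, hφ, e]⟩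
        · have := l3 (by omega)
          obtain ⟨φ, hφ⟩ := ih p (by omega) (by omega) h
          obtain ⟨ψ, hψ⟩ := ih q (by omega) (by omega) h'
          exact ⟨.and φ ψ, by rw [EF.encode, hφ, hψ, e2, e]⟩
        · obtain ⟨φ, hφ⟩ := ih b (l3 (by omega)) (by have := l3 (by omega); omega) h
          exact ⟨.ex φ, by rw [EF.encode, hφ, e]⟩
        · have := l3 (by omega)
          obtain ⟨ψ, hψ⟩ := ih q (by omega) (by omega) h'
          exact ⟨.box (dM p) ψ, by rw [EF.encode, h1 p h, hψ, e2, e]⟩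
    exact key N le_rfl hN
  · rintro ⟨φ, hφ⟩
    obtain ⟨c, hc, hb⟩ := bt_exists (N+1) fun x => ∃ φ : EF M, φ.encode eM = x
    refine ⟨c, hc, (hb N (by omega)).2 ⟨φ, hφ⟩, ?_⟩
    intro x hx hcx
    obtain ⟨ψ, rfl⟩ := (hb x (by omega)).1 hcx
    unfold CodeStep
    cases ψ with
    | pred n t => simp [EF.encode]
    | eq s t => simp [EF.encode]
    | neg ψ =>
      have := lt_pair_of_pos (show 0 < 2 by omega) (ψ.encode eM)
      simp only [EF.encode] at hx ⊢
      simp only [Nat.unpair_pair, hb (ψ.encode eM) (by omega)]; simp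
    | ex ψ =>
      have := lt_pair_of_pos (show 0 < 4 by omega) (ψ.encode eM)
      simp only [EF.encode] at hx ⊢
      simp only [Nat.unpair_pair, hb (ψ.encode eM) (by omega)]; simp
    | and ψ χ =>
      have := lt_pair_of_pos (show 0 < 3 by omega) (Nat.pair (ψ.encode eM) (χ.encode eM))
      have := Nat.left_le_pair (ψ.encode eM) (χ.encode eM)
      have := Nat.right_le_pair (ψ.encode eM) (χ.encode eM)
      simp only [EF.encode] at hx ⊢
      simp only [Nat.unpair_pair, hb (ψ.encode eM) (by omega), hb (χ.encode eM) (by omega)]; simp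
    | box m χ =>
      have := lt_pair_of_pos (show 0 < 5 by omega) (Nat.pair (eM m) (χ.encode eM))
      have := Nat.right_le_pair (eM m) (χ.encode eM)
      simp only [EF.encode] at hx ⊢
      simp only [Nat.unpair_pair, hb (χ.encode eM) (by omega)]; simp [h2 m]
end OneVarEq

namespace OneVarEq
open Function

/-! ### types -/
def fb (τ x : ℕ) : Prop := bt τ (2*x)
def cb (τ k : ℕ) : Prop := bt τ (2*k+1)
theorem PP.fb {α : Type} [Primcodable α] {g h : α → ℕ} (hg : Primrec g) (hh : Primrec h) :
    PP fun a => fb (g a) (h a) := PP.bt hg (by fun_prop)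
theorem PP.cb {α : Type} [Primcodable α] {g h : α → ℕ} (hg : Primrec g) (hh : Primrec h) :
    PP fun a => cb (g a) (h a) := PP.bt hg (by fun_prop)

def hascb (N τ : ℕ) : Prop := ∃ k ≤ N, cb τ k

def RowC (N : ℕ) (C : List ℕ) (τ : ℕ) : Prop :=
  (∀ n ≤ N, ∀ k ≤ N, Nat.pair 0 (Nat.pair n (k+1)) ≤ N → (fb τ (Nat.pair 0 (Nat.pair n (k+1))) ↔
    ∃ σ ∈ C, cb σ k ∧ fb σ (Nat.pair 0 (Nat.pair n 0)))) ∧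
  (Nat.pair 1 (Nat.pair 0 0) ≤ N → fb τ (Nat.pair 1 (Nat.pair 0 0))) ∧
  (∀ k ≤ N, Nat.pair 1 (Nat.pair 0 (k+1)) ≤ N → (fb τ (Nat.pair 1 (Nat.pair 0 (k+1))) ↔ cb τ k)) ∧
  (∀ k ≤ N, Nat.pair 1 (Nat.pair (k+1) 0) ≤ N → (fb τ (Nat.pair 1 (Nat.pair (k+1) 0)) ↔ cb τ k)) ∧
  (∀ k ≤ N, ∀ j ≤ N, Nat.pair 1 (Nat.pair (k+1) (j+1)) ≤ N →
    (fb τ (Nat.pair 1 (Nat.pair (k+1) (j+1))) ↔ ∃ σ ∈ C, cb σ k ∧ cb σ j)) ∧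
  (∀ y ≤ N, Nat.pair 2 y ≤ N → (fb τ (Nat.pair 2 y) ↔ ¬ fb τ y)) ∧
  (∀ x ≤ N, ∀ y ≤ N, Nat.pair 3 (Nat.pair x y) ≤ N →
    (fb τ (Nat.pair 3 (Nat.pair x y)) ↔ fb τ x ∧ fb τ y)) ∧
  (∀ y ≤ N, Nat.pair 4 y ≤ N → (fb τ (Nat.pair 4 y) ↔ ∃ σ ∈ C, fb σ y)) ∧
  (∀ k ≤ N, ∃ σ ∈ C, cb σ k) ∧
  (∀ k ≤ N, ∀ σ ∈ C, cb σ k → cb τ k → σ = τ)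

def RowL (N : ℕ) (C : List ℕ) : Prop := ∀ τ ∈ C, RowC N C τ

theorem PP_hascb {α : Type} [Primcodable α] {g h : α → ℕ} (hg : Primrec g) (hh : Primrec h) :
    PP fun a => hascb (g a) (h a) := by
  unfold hascb
  apply PP.ex_le hg
  apply PP.cb
  all_goals fun_prop

theorem PP_rowL {α : Type} [Primcodable α] {g : α → ℕ} {h : α → List ℕ} (hg : Primrec g) (hh : Primrec h) :
    PP fun a => RowL (g a) (h a) := by
  unfold RowL RowC
  repeat' with_reducible first
    | apply PP.fb
    | apply PP.cb
    | apply PP.and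
    | apply PP.all_le
    | apply PP.all_mem
    | apply PP.ex_mem
    | apply PP.iff
    | apply PP.not
    | apply PP.imp
    | apply PP.eq
    | apply PP.le
    | exact Primrec.fst
    | exact Primrec.snd
    | exact Primrec.const _
    | apply pr_npair
    | apply pr_add
    | apply pr_fst
    | apply pr_snd
    | exact hg
    | exact hh
    | refine hg.comp ?_
    | refine hh.comp ?_

structure Labelled {M : Type} (N : ℕ) (eM : M → ℕ) (F : KFrame M) (D : Type) (dom : F.W → Set D)
    (τ : F.W → D → ℕ) : Prop where
  ne : ∀ w, (dom w).Nonempty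
  expand : ∀ (m : M) (w v : F.W), F.R m w v → dom w ⊆ dom v
  row : ∀ w, ∃ C : List ℕ, (∀ σ, σ ∈ C ↔ ∃ d ∈ dom w, τ w d = σ) ∧ RowL N C
  uniq : ∀ w, ∀ d ∈ dom w, ∀ d' ∈ dom w, hascb N (τ w d) → τ w d = τ w d' → d = d'
  box : ∀ m w, ∀ d ∈ dom w, ∀ y, Nat.pair 5 (Nat.pair (eM m) y) ≤ N →
    (fb (τ w d) (Nat.pair 5 (Nat.pair (eM m) y)) ↔ ∀ v, F.R m w v → fb (τ v d) y)

theorem pair_le_const (n k : ℕ) : Nat.pair 0 (Nat.pair n 0) ≤ Nat.pair 0 (Nat.pair n (k+1)) :=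
  (Nat.pair_lt_pair_right 0 (Nat.pair_lt_pair_right n (by omega))).le

theorem Labelled.model {M : Type} {N : ℕ} {eM : M → ℕ} {F : KFrame M} {D : Type} {dom : F.W → Set D}
    {τ : F.W → D → ℕ} (L : Labelled N eM F D dom τ) {C : Set (KFrame M)} (hF : F ∈ C) (φ : EF M)
    (hN : φ.encode eM = N) (w0 : F.W) (d0 : D) (hd0 : d0 ∈ dom w0) (h0 : ¬ fb (τ w0 d0) N) :
    φ ∉ LogED DSem.xd C := by
  classical
  have hc : ∀ w k, ∃ d ∈ dom w, k ≤ N → cb (τ w d) k := by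
    intro w k
    obtain ⟨d, hd⟩ := L.ne w
    by_cases hk : k ≤ N
    · obtain ⟨C, hC, hR⟩ := L.row w
      obtain ⟨σ, hσ, hcb⟩ := (hR _ ((hC _).2 ⟨d, hd, rfl⟩)).2.2.2.2.2.2.2.2.1 k hk
      obtain ⟨d', hd', rfl⟩ := (hC σ).1 hσ
      exact ⟨d', hd', fun _ => hcb⟩
    · exact ⟨d, hd, fun h => absurd h hk⟩
  choose cst hcm hcb using hc
  let 𝔪 : EModel F := ⟨D, dom, L.ne, L.expand, fun w n => {d | fb (τ w d) (Nat.pair 0 (Nat.pair n 0))}, cst, hcm⟩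
  have hcu : ∀ w k, k ≤ N → ∀ d ∈ dom w, (cb (τ w d) k ↔ d = cst w k) := by
    intro w k hk d hd
    constructor
    · intro h
      obtain ⟨C, hC, hR⟩ := L.row w
      have h2 := (hR _ ((hC _).2 ⟨d, hd, rfl⟩)).2.2.2.2.2.2.2.2.2 k hk _
        ((hC _).2 ⟨_, hcm w k, rfl⟩) (hcb w k hk) h
      exact L.uniq w d hd _ (hcm w k) ⟨k, hk, h⟩ h2.symm
    · rintro rfl; exact hcb w k hk
  have key : ∀ ψ : EF M, ψ.encode eM ≤ N → ∀ w, ∀ d ∈ dom w, (𝔪.eval ψ w d ↔ fb (τ w d) (ψ.encode eM)) := by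
    intro ψ
    induction ψ with
    | pred n t =>
      intro hle w d hd
      cases t with
      | var => exact Iff.rfl
      | const k =>
        obtain ⟨C, hC, hR⟩ := L.row w
        simp only [EF.encode, ETm.code] at hle ⊢
        have l1 := Nat.right_le_pair 0 (Nat.pair n (k+1))
        have l2 := Nat.right_le_pair n (k+1)
        have l3 := Nat.left_le_pair n (k+1)
        rw [(hR _ ((hC _).2 ⟨d, hd, rfl⟩)).1 n (by omega) k (by omega) hle]
        constructor
        · intro h
          exact ⟨_, (hC _).2 ⟨_, hcm w k, rfl⟩, hcb w k (by omega), h⟩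
        · rintro ⟨σ, hσ, h1, h2⟩
          obtain ⟨d', hd', rfl⟩ := (hC σ).1 hσ
          rw [(hcu w k (by omega) d' hd').1 h1] at h2
          exact h2
    | eq s t =>
      intro hle w d hd
      obtain ⟨C, hC, hR⟩ := L.row w
      have hR := hR _ ((hC _).2 ⟨d, hd, rfl⟩)
      cases s with
      | var =>
        cases t with
        | var => exact iff_of_true rfl (hR.2.1 hle)
        | const k =>
          simp only [EF.encode, ETm.code] at hle ⊢
          have l1 := Nat.right_le_pair 1 (Nat.pair 0 (k+1))
          have l2 := Nat.right_le_pair 0 (k+1)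
          rw [hR.2.2.1 k (by omega) hle, hcu w k (by omega) d hd]
          exact Iff.rfl
      | const j =>
        cases t with
        | var =>
          simp only [EF.encode, ETm.code] at hle ⊢
          have l1 := Nat.right_le_pair 1 (Nat.pair (j+1) 0)
          have l2 := Nat.left_le_pair (j+1) 0
          rw [hR.2.2.2.1 j (by omega) hle, hcu w j (by omega) d hd]
          exact eq_comm
        | const k =>
          simp only [EF.encode, ETm.code] at hle ⊢
          have l1 := Nat.right_le_pair 1 (Nat.pair (j+1) (k+1))
          have l2 := Nat.left_le_pair (j+1) (k+1)
          have l3 := Nat.right_le_pair (j+1) (k+1)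
          rw [hR.2.2.2.2.1 j (by omega) k (by omega) hle]
          constructor
          · intro (h : cst w j = cst w k)
            refine ⟨_, (hC _).2 ⟨_, hcm w j, rfl⟩, hcb w j (by omega), ?_⟩
            rw [h]; exact hcb w k (by omega)
          · rintro ⟨σ, hσ, h1, h2⟩
            obtain ⟨d', hd', rfl⟩ := (hC σ).1 hσ
            exact ((hcu w j (by omega) d' hd').1 h1).symm.trans ((hcu w k (by omega) d' hd').1 h2)
    | neg ψ ih =>
      intro hle w d hd
      obtain ⟨C, hC, hR⟩ := L.row w
      have hR := hR _ ((hC _).2 ⟨d, hd, rfl⟩)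
      simp only [EF.encode] at hle ⊢
      have l1 := Nat.right_le_pair 2 (ψ.encode eM)
      rw [hR.2.2.2.2.2.1 _ (by omega) hle, eval_neg', ih (by omega) w d hd]
    | and ψ χ ih1 ih2 =>
      intro hle w d hd
      obtain ⟨C, hC, hR⟩ := L.row w
      have hR := hR _ ((hC _).2 ⟨d, hd, rfl⟩)
      simp only [EF.encode] at hle ⊢
      have l1 := Nat.right_le_pair 3 (Nat.pair (ψ.encode eM) (χ.encode eM))
      have l2 := Nat.left_le_pair (ψ.encode eM) (χ.encode eM)
      have l3 := Nat.right_le_pair (ψ.encode eM) (χ.encode eM)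
      rw [hR.2.2.2.2.2.2.1 _ (by omega) _ (by omega) hle, eval_and', ih1 (by omega) w d hd, ih2 (by omega) w d hd]
    | ex ψ ih =>
      intro hle w d hd
      obtain ⟨C, hC, hR⟩ := L.row w
      have hR := hR _ ((hC _).2 ⟨d, hd, rfl⟩)
      simp only [EF.encode] at hle ⊢
      have l1 := Nat.right_le_pair 4 (ψ.encode eM)
      rw [hR.2.2.2.2.2.2.2.1 _ (by omega) hle, eval_ex']
      constructor
      · rintro ⟨b, hb, h⟩
        exact ⟨_, (hC _).2 ⟨b, hb, rfl⟩, (ih (by omega) w b hb).1 h⟩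
      · rintro ⟨σ, hσ, h⟩
        obtain ⟨d', hd', rfl⟩ := (hC σ).1 hσ
        exact ⟨d', hd', (ih (by omega) w d' hd').2 h⟩
    | box m ψ ih =>
      intro hle w d hd
      simp only [EF.encode] at hle ⊢
      have l1 := Nat.right_le_pair 5 (Nat.pair (eM m) (ψ.encode eM))
      have l3 := Nat.right_le_pair (eM m) (ψ.encode eM)
      rw [L.box m w d hd _ hle, eval_box']
      exact forall₂_congr fun v hv => ih (by omega) v d (L.expand m w v hv hd)
  intro hφ
  have := hφ F hF 𝔪 (by intro h; cases h) w0 d0 hd0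
  exact h0 (hN ▸ (key φ hN.le w0 d0 hd0).1 this)

theorem Labelled.of_not_mem {M : Type} {N : ℕ} {eM : M → ℕ} {dM : ℕ → M} (hM : ∀ m, dM (eM m) = m)
    {C : Set (KFrame M)} (φ : EF M) (hN : φ.encode eM = N) (h : φ ∉ LogED DSem.xd C) :
    ∃ F ∈ C, ∃ (D : Type) (dom : F.W → Set D) (τ : F.W → D → ℕ), Labelled N eM F D dom τ ∧
      (∀ w d, τ w d < 2 ^ (2*N+2)) ∧ ∃ w0, ∃ d0 ∈ dom w0, ¬ fb (τ w0 d0) N := by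
  classical
  simp only [LogED, Set.mem_ofPred_eq, EModel.TrueIn, EModel.TrueAt, not_forall] at h
  obtain ⟨F, hF, 𝔪, -, w0, d0, hd0, h⟩ := h
  have hτ : ∀ w d, ∃ c < 2 ^ (2*N+2), ∀ i < 2*N+2, (bt c i ↔
      if i % 2 = 0 then 𝔪.eval (decE dM (i/2)) w d else d = 𝔪.cst w (i/2)) := fun w d => bt_exists _ _
  choose τ hlt hb using hτ
  have hf : ∀ w d x, x ≤ N → (fb (τ w d) x ↔ 𝔪.eval (decE dM x) w d) := by
    intro w d x hx
    have := hb w d (2*x) (by omega)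
    rw [if_pos (by omega), show 2*x/2 = x by omega] at this
    exact this
  have hc : ∀ w d x, x ≤ N → (cb (τ w d) x ↔ d = 𝔪.cst w x) := by
    intro w d x hx
    have := hb w d (2*x+1) (by omega)
    rw [if_neg (by omega), show (2*x+1)/2 = x by omega] at this
    exact this
  refine ⟨F, hF, 𝔪.D, 𝔪.dom, τ, ⟨𝔪.domNe, 𝔪.expand, ?_, ?_, ?_⟩, hlt, w0, d0, hd0, ?_⟩
  · intro w
    have hC : ∀ σ, σ ∈ (List.range (2 ^ (2*N+2))).filter (fun σ => ∃ d ∈ 𝔪.dom w, τ w d = σ) ↔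
        ∃ d ∈ 𝔪.dom w, τ w d = σ := by
      intro σ
      simp only [List.mem_filter, List.mem_range, decide_eq_true_eq, and_iff_right_iff_imp]
      rintro ⟨d, _, rfl⟩; exact hlt w d
    have hex : ∀ P : ℕ → Prop, (∃ σ ∈ (List.range (2 ^ (2*N+2))).filter (fun σ => ∃ d ∈ 𝔪.dom w, τ w d = σ), P σ) ↔
        ∃ d ∈ 𝔪.dom w, P (τ w d) := by
      intro P
      constructor
      · rintro ⟨σ, hσ, h⟩
        obtain ⟨d, hd, rfl⟩ := (hC σ).1 hσ
        exact ⟨d, hd, h⟩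
      · rintro ⟨d, hd, h⟩
        exact ⟨_, (hC _).2 ⟨d, hd, rfl⟩, h⟩
    refine ⟨_, hC, ?_⟩
    intro τ' hτ'
    obtain ⟨d, hd, rfl⟩ := (hC _).1 hτ'
    refine ⟨?_, ?_, ?_, ?_, ?_, ?_, ?_, ?_, ?_, ?_⟩
    · intro n hn k hk hle
      rw [hex, hf w d _ hle, decE_pred]
      have := (pair_le_const n k).trans hle
      constructor
      · intro h
        refine ⟨_, 𝔪.cstMem w k, (hc w _ k hk).2 rfl, ?_⟩
        rw [hf w _ _ this, decE_pred]; exact h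
      · rintro ⟨d', hd', h1, h2⟩
        rw [hf w _ _ this, decE_pred] at h2
        rw [hc w _ k hk] at h1
        subst h1; exact h2
    · intro hle
      rw [hf w d _ hle, decE_eq]; exact rfl
    · intro k hk hle
      rw [hf w d _ hle, decE_eq, hc w d k hk]; exact Iff.rfl
    · intro k hk hle
      rw [hf w d _ hle, decE_eq, hc w d k hk]; exact eq_comm
    · intro k hk j hj hle
      rw [hex, hf w d _ hle, decE_eq]
      constructor
      · intro (h : 𝔪.cst w k = 𝔪.cst w j)
        exact ⟨_, 𝔪.cstMem w k, (hc w _ k hk).2 rfl, (hc w _ j hj).2 h⟩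
      · rintro ⟨d', hd', h1, h2⟩
        exact ((hc w _ k hk).1 h1).symm.trans ((hc w _ j hj).1 h2)
    · intro y hy hle
      rw [hf w d _ hle, decE_neg, hf w d y hy]; rfl
    · intro x hx y hy hle
      rw [hf w d _ hle, decE_and, hf w d y hy, hf w d x hx]; rfl
    · intro y hy hle
      rw [hex, hf w d _ hle, decE_ex, eval_ex']
      exact exists_congr fun d' => and_congr_right fun _ => (hf w d' y hy).symm
    · intro k hk
      rw [hex]
      exact ⟨_, 𝔪.cstMem w k, (hc w _ k hk).2 rfl⟩
    · intro k hk σ hσ h1 h2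
      obtain ⟨d', hd', rfl⟩ := (hC _).1 hσ
      rw [(hc w _ k hk).1 h1, (hc w _ k hk).1 h2]
  · rintro w d hd d' hd' ⟨k, hk, h1⟩ h2
    rw [(hc w _ k hk).1 h1]
    rw [h2] at h1
    rw [(hc w _ k hk).1 h1]
  · intro m w d hd y hle
    have l1 := Nat.right_le_pair 5 (Nat.pair (eM m) y)
    have l3 := Nat.right_le_pair (eM m) y
    rw [hf w d _ hle, decE_box, hM, eval_box']
    exact forall₂_congr fun v _ => (hf v d y (by omega)).symm
  · rw [hf w0 d0 N le_rfl, ← hN, decE_encode dM eM hM]; exact h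
end OneVarEq

namespace OneVarEq
open Function

/-! ### configurations for finite time -/
def bS (y : ℕ) : ℕ := Nat.pair 5 (Nat.pair 0 y)
def bL (y : ℕ) : ℕ := Nat.pair 5 (Nat.pair 1 y)
def tE (N : ℕ) : ℕ := 2 ^ (2*N+2)

def scT (N τ σ : ℕ) : Prop := ∀ y ≤ N, (bS y ≤ N → (fb τ (bS y) ↔ fb σ y)) ∧
  (bL y ≤ N → (fb τ (bL y) ↔ fb σ y ∧ fb σ (bL y)))
def fiT (N τ : ℕ) : Prop := ∀ y ≤ N, (bS y ≤ N → fb τ (bS y)) ∧ (bL y ≤ N → fb τ (bL y))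

structure VC (N : ℕ) (C : List ℕ) : Prop where
  ne : C ≠ []
  lt : ∀ τ ∈ C, τ < tE N
  row : RowL N C
  cnt : ∀ τ ∈ C, hascb N τ → C.count τ ≤ 1

def startC (N : ℕ) (C : List ℕ) : Prop := VC N C ∧ ∃ τ ∈ C, ¬ fb τ N
def stepC (N : ℕ) (C C' : List ℕ) : Prop := VC N C' ∧ ∃ A R, C' = A ++ R ∧ List.Forall₂ (scT N) C A
def ReachC (N : ℕ) (C : List ℕ) : Prop := ∃ C0, startC N C0 ∧ Relation.ReflTransGen (stepC N) C0 C
def SatT (N : ℕ) : Prop := ∃ C, ReachC N C ∧ ∀ τ ∈ C, fiT N τ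

theorem RowL.congr {N : ℕ} {C C' : List ℕ} (h : ∀ σ, σ ∈ C ↔ σ ∈ C') (hC : RowL N C) : RowL N C' := by
  intro τ hτ
  have := hC τ ((h τ).2 hτ)
  simp only [RowC, h] at this
  exact this

theorem ReachC.vc {N : ℕ} {C : List ℕ} (h : ReachC N C) : VC N C := by
  obtain ⟨C0, h0, h⟩ := h
  cases h with
  | refl => exact h0.1
  | tail _ h => exact h.1

/-- shrinking a configuration -/
theorem VC.shrink {N : ℕ} {C A : List ℕ} (h : VC N C) (hA : A.Subperm C) :
    ∃ R, R.length ≤ tE N ∧ VC N (A ++ R) ∧ (A ++ R).Subperm C := by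
  have hp : (A ++ C.diff A).Perm C := List.subperm_append_diff_self_of_count_le
    (fun x _ => hA.count_le x)
  have hs : (A ++ (C.diff A).dedup).Subperm C :=
    ((List.Sublist.refl A).append (List.dedup_sublist _)).subperm.trans hp.subperm
  have hm : ∀ σ, σ ∈ C ↔ σ ∈ A ++ (C.diff A).dedup := by
    intro σ
    rw [← hp.mem_iff]; simp
  refine ⟨(C.diff A).dedup, ?_, ⟨?_, ?_, h.row.congr hm, ?_⟩, hs⟩
  · have : (C.diff A).dedup.Subperm (List.range (tE N)) := by
      refine (List.nodup_dedup _).subperm ?_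
      intro x hx
      rw [List.mem_range]
      exact h.lt x ((hm x).2 (List.mem_append_right _ hx))
    simpa using this.length_le
  · intro h0
    obtain ⟨x, hx⟩ := List.exists_mem_of_ne_nil _ h.ne
    rw [hm, h0] at hx
    simp at hx
  · intro τ hτ; exact h.lt τ ((hm τ).2 hτ)
  · intro τ hτ hc
    exact (hs.count_le τ).trans (h.cnt τ ((hm τ).2 hτ) hc)

theorem forall₂_sublist {α β : Type} {r : α → β → Prop} {b C : List α} (h : b.Sublist C) :
    ∀ {A : List β}, List.Forall₂ r C A → ∃ A', A'.Sublist A ∧ List.Forall₂ r b A' := by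
  induction h with
  | slnil => intro A hA; exact ⟨A, List.Sublist.refl _, hA⟩
  | cons a _ ih =>
    intro A hA
    cases hA with
    | cons h1 h2 =>
      obtain ⟨A', h3, h4⟩ := ih h2
      exact ⟨A', h3.cons _, h4⟩
  | cons_cons a _ ih =>
    intro A hA
    cases hA with
    | cons h1 h2 =>
      obtain ⟨A', h3, h4⟩ := ih h2
      exact ⟨_ :: A', h3.cons_cons _, .cons h1 h4⟩

theorem forall₂_subperm {α β : Type} {r : α → β → Prop} {b C : List α} (h : b.Subperm C)
    {A : List β} (hA : List.Forall₂ r C A) : ∃ A', A'.Subperm A ∧ List.Forall₂ r b A' := by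
  obtain ⟨b', hb', hs⟩ := h
  obtain ⟨A1, h1, h2⟩ := forall₂_sublist hs hA
  obtain ⟨A2, h3, h4⟩ := List.perm_comp_forall₂ hb'.symm h2
  exact ⟨A2, h4.subperm.trans h1.subperm, h3⟩

/-- certificate of unsatisfiability -/
def UCert (N : ℕ) (B : List (List ℕ)) : Prop :=
  (∀ R : List ℕ, R.length ≤ tE N → (∀ x ∈ R, x < tE N) → startC N R → ∃ b ∈ B, b.Subperm R) ∧
  (∀ b ∈ B, ∀ A : List ℕ, A.length ≤ b.length → (∀ x ∈ A, x < tE N) →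
    ∀ R : List ℕ, R.length ≤ tE N → (∀ x ∈ R, x < tE N) →
    List.Forall₂ (scT N) b A → VC N (A ++ R) → ∃ b' ∈ B, b'.Subperm (A ++ R)) ∧
  (∀ b ∈ B, ¬ ∀ τ ∈ b, fiT N τ)

theorem UCert.sound {N : ℕ} {B : List (List ℕ)} (hB : UCert N B) : ¬ SatT N := by
  rintro ⟨C, hC, hf⟩
  suffices ∃ b ∈ B, b.Subperm C by
    obtain ⟨b, hb, hs⟩ := this
    exact hB.2.2 b hb fun τ hτ => hf τ (hs.subset hτ)
  clear hf
  obtain ⟨C0, h0, h⟩ := hC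
  induction h with
  | refl =>
    obtain ⟨hv, τ, hτ, hn⟩ := h0
    have hmem : ∀ σ, σ ∈ C0 ↔ σ ∈ C0.dedup := by simp
    have hv' : VC N C0.dedup := by
      refine ⟨?_, ?_, hv.row.congr hmem, ?_⟩
      · intro h
        have := (hmem τ).1 hτ
        rw [h] at this; simp at this
      · intro x hx; exact hv.lt x ((hmem x).2 hx)
      · intro x hx _; exact List.nodup_iff_count_le_one.1 (List.nodup_dedup _) x
    have hl : C0.dedup.length ≤ tE N := by
      have : C0.dedup.Subperm (List.range (tE N)) := by
        refine (List.nodup_dedup _).subperm ?_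
        intro x hx
        rw [List.mem_range]
        exact hv'.lt x hx
      simpa using this.length_le
    obtain ⟨b, hb, hs⟩ := hB.1 C0.dedup hl hv'.lt ⟨hv', τ, (hmem τ).1 hτ, hn⟩
    exact ⟨b, hb, hs.trans (List.dedup_sublist _).subperm⟩
  | tail _ h ih =>
    obtain ⟨b, hb, hs⟩ := ih
    obtain ⟨hv, A, R, rfl, hA⟩ := h
    obtain ⟨A', h1, h2⟩ := forall₂_subperm hs hA
    obtain ⟨R', h3, h4, h5⟩ := hv.shrink (h1.trans (List.sublist_append_left A R).subperm)
    obtain ⟨b', hb', hs'⟩ := hB.2.1 b hb A' h2.length_eq.ge (fun x hx => h4.lt x (List.mem_append_left _ hx)) R' h3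
      (fun x hx => h4.lt x (List.mem_append_right _ hx)) h2 h4
    exact ⟨b', hb', hs'.trans h5⟩

theorem UCert.exists {N : ℕ} (h : ¬ SatT N) : ∃ B, UCert N B := by
  classical
  obtain ⟨B, hB, hB'⟩ : ∃ B : Finset (List ℕ), (∀ b ∈ B, ReachC N b) ∧ ∀ C, ReachC N C → ∃ b ∈ B, b.Sublist C := by
    by_contra hc
    push Not at hc
    obtain ⟨f, hf, hf'⟩ := exists_seq_of_forall_finset_exists (ReachC N) (fun x y => ¬ x.Sublist y) hc
    have hfin : (Set.Iio (tE N)).PartiallyWellOrderedOn (· = ·) :=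
      (Set.finite_Iio _).partiallyWellOrderedOn
    have := Set.PartiallyWellOrderedOn.partiallyWellOrderedOn_sublistForall₂ (· = ·) hfin
    obtain ⟨m, n, hmn, hs⟩ := this (fun n => ⟨f n, fun x hx => (hf n).vc.lt x hx⟩)
    replace hs : List.SublistForall₂ (· = ·) (f m) (f n) := hs
    rw [List.sublistForall₂_iff] at hs
    obtain ⟨l, hl, hs⟩ := hs
    rw [List.forall₂_eq_eq_eq] at hl
    subst hl
    exact hf' m n hmn hs
  refine ⟨B.toList, ?_, ?_, ?_⟩
  · intro R _ _ hR
    obtain ⟨b, hb, hs⟩ := hB' R ⟨R, hR, .refl⟩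
    exact ⟨b, by simpa using hb, hs.subperm⟩
  · intro b hb A _ _ R _ _ hA hv
    rw [Finset.mem_toList] at hb
    obtain ⟨C0, h0, h1⟩ := hB b hb
    obtain ⟨b', hb', hs⟩ := hB' (A ++ R) ⟨C0, h0, h1.tail ⟨hv, A, R, rfl, hA⟩⟩
    exact ⟨b', by simpa using hb', hs.subperm⟩
  · intro b hb hf
    rw [Finset.mem_toList] at hb
    exact h ⟨b, hB b hb, hf⟩

theorem satT_compl (N : ℕ) : ¬ SatT N ↔ ∃ B, UCert N B :=
  ⟨UCert.exists, fun ⟨_, h⟩ => h.sound⟩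
end OneVarEq

namespace OneVarEq
open Function

section PRL
variable {α : Type} [Primcodable α]
theorem PP.all_list {l e : α → ℕ} {p : α → List ℕ → Prop} (hl : Primrec l) (he : Primrec e)
    (hp : PP fun x : α × List ℕ => p x.1 x.2) :
    PP fun a => ∀ R : List ℕ, R.length ≤ l a → (∀ x ∈ R, x < e a) → p a R := by
  have h1 : Primrec fun x : (α × ℕ) × ℕ => (List.range x.1.2).map (dg (e x.1.1) x.2) := by
    refine Primrec.list_map (f := fun x : (α × ℕ) × ℕ => List.range x.1.2) (by fun_prop)
      (g := fun x i => dg (e x.1.1) x.2 i) ?_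
    exact pr_dg (he.comp (pr_fst (pr_fst Primrec.fst))) (pr_snd Primrec.fst) Primrec.snd
  have : PP fun a => ∀ k ≤ l a, ∀ c < (e a)^k, p a ((List.range k).map (dg (e a) c)) := by
    refine PP.all_le hl (PP.all_lt (by fun_prop) ?_)
    exact hp.comp (f := fun x : (α × ℕ) × ℕ => (x.1.1, (List.range x.1.2).map (dg (e x.1.1) x.2)))
      ((pr_fst Primrec.fst).pair h1)
  refine (this.and (PP.imp (p := fun a => e a = 0) (q := fun a => p a []) (PP.eq he (Primrec.const 0))
    (hp.comp (f := fun a => (a, [])) (by fun_prop)))).of_iff fun a => ?_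
  constructor
  · intro h
    refine ⟨fun k hk c hc => ?_, fun h0 => h [] (by simp) (by simp)⟩
    by_cases hk0 : k = 0
    · subst hk0; exact h [] (by simp) (by simp)
    have he0 : 0 < e a := by
      rcases Nat.eq_zero_or_pos (e a) with h0 | h0
      · rw [h0, zero_pow hk0] at hc; omega
      · exact h0
    refine h _ (by simpa using hk) ?_
    intro x hx
    simp only [List.mem_map] at hx
    obtain ⟨i, _, rfl⟩ := hx
    exact dg_lt he0
  · rintro ⟨h, -⟩ R hR hx
    obtain ⟨c, hc, hd⟩ := dg_exists (e a) R.length (fun i => R.getD i 0) (by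
      intro i hi
      rw [List.getD_eq_getElem _ _ hi]; exact hx _ (List.getElem_mem hi))
    have := h R.length hR c hc
    convert this using 1
    apply List.ext_getElem
    · simp
    · intro i h1 h2
      simp only [List.getElem_map, List.getElem_range]
      rw [hd i h1, List.getD_eq_getElem _ _ h1]

@[fun_prop] theorem pr_count {f : α → ℕ} {g : α → List ℕ} (hf : Primrec f) (hg : Primrec g) :
    Primrec fun a => (g a).count (f a) := by
  classical
  have h : PrimrecRel fun (b a : ℕ) => b = a := Primrec.eq
  have h2 := Primrec.list_length.comp ((PrimrecRel.listFilter h).comp hg hf)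
  refine h2.of_eq fun a => ?_
  rw [List.count_eq_length_filter]
  congr 1
@[fun_prop] theorem pr_append {f g : α → List ℕ} (hf : Primrec f) (hg : Primrec g) :
    Primrec fun a => f a ++ g a := Primrec.list_append.comp hf hg
end PRL

theorem PP_scT : PP fun x : ℕ × ℕ × ℕ => scT x.1 x.2.1 x.2.2 := by
  unfold scT bS bL
  repeat' with_reducible first
    | apply PP.fb
    | apply PP.and
    | apply PP.all_le
    | apply PP.iff
    | apply PP.imp
    | apply PP.le
    | exact Primrec.fst
    | exact Primrec.snd
    | exact Primrec.const _
    | apply pr_npair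
    | apply pr_fst
    | apply pr_snd
theorem PP_fiT : PP fun x : ℕ × ℕ => fiT x.1 x.2 := by
  unfold fiT bS bL
  repeat' with_reducible first
    | apply PP.fb
    | apply PP.and
    | apply PP.all_le
    | apply PP.iff
    | apply PP.imp
    | apply PP.le
    | exact Primrec.fst
    | exact Primrec.snd
    | exact Primrec.const _
    | apply pr_npair
    | apply pr_fst
    | apply pr_snd
@[fun_prop] theorem pr_tE {α : Type} [Primcodable α] {f : α → ℕ} (hf : Primrec f) : Primrec fun a => tE (f a) := by
  unfold tE
  fun_prop

theorem PP_VC : PP fun x : ℕ × List ℕ => VC x.1 x.2 := by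
  have : PP fun x : ℕ × List ℕ => x.2.length ≠ 0 ∧ (∀ τ ∈ x.2, τ < tE x.1) ∧ RowL x.1 x.2 ∧
      ∀ τ ∈ x.2, hascb x.1 τ → x.2.count τ ≤ 1 := by
    refine PP.and (PP.ne (by fun_prop) (by fun_prop)) (PP.and (PP.all_mem (by fun_prop) (PP.lt (by fun_prop) (by fun_prop)))
      (PP.and (PP_rowL (by fun_prop) (by fun_prop)) (PP.all_mem (by fun_prop) (PP.imp (PP_hascb (by fun_prop) (by fun_prop))
       (PP.le (by fun_prop) (by fun_prop))))))
  refine this.of_iff fun x => ?_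
  constructor
  · rintro ⟨h1, h2, h3, h4⟩
    exact ⟨by simpa using h1, h2, h3, h4⟩
  · rintro ⟨h1, h2, h3, h4⟩
    exact ⟨by simpa using h1, h2, h3, h4⟩

theorem PP_startC : PP fun x : ℕ × List ℕ => startC x.1 x.2 :=
  PP_VC.and (PP.ex_mem (by fun_prop) (PP.not (PP.fb (by fun_prop) (by fun_prop))))

theorem PP_forall₂ {α : Type} [Primcodable α] {n : α → ℕ} {f g : α → List ℕ} (hn : Primrec n) (hf : Primrec f) (hg : Primrec g) :
    PP fun a => List.Forall₂ (scT (n a)) (f a) (g a) := by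
  have : PP fun a => (f a).length = (g a).length ∧ ∀ i < (f a).length, scT (n a) ((f a).getD i 0) ((g a).getD i 0) := by
    refine PP.and (PP.eq (by fun_prop) (by fun_prop)) (PP.all_lt (by fun_prop) ?_)
    exact PP_scT.comp (f := fun x : α × ℕ => (n x.1, (f x.1).getD x.2 0, (g x.1).getD x.2 0)) (by fun_prop)
  refine this.of_iff fun a => ?_
  rw [List.forall₂_iff_get]
  constructor
  · rintro ⟨h1, h2⟩
    refine ⟨h1, fun i hi => ?_⟩
    rw [List.getD_eq_getElem _ _ hi, List.getD_eq_getElem _ _ (h1 ▸ hi)]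
    exact h2 i hi (h1 ▸ hi)
  · rintro ⟨h1, h2⟩
    refine ⟨h1, fun i hi hi' => ?_⟩
    have := h2 i hi
    rw [List.getD_eq_getElem _ _ hi, List.getD_eq_getElem _ _ hi'] at this
    exact this

theorem PP_subperm {α : Type} [Primcodable α] {f g : α → List ℕ} (hf : Primrec f) (hg : Primrec g) :
    PP fun a => (f a).Subperm (g a) := by
  refine (PP.all_mem (p := fun a x => (f a).count x ≤ (g a).count x) hf
    (PP.le (by fun_prop) (by fun_prop))).of_iff fun a => List.subperm_ext_iff

theorem PP_UCert : PP fun x : ℕ × List (List ℕ) => UCert x.1 x.2 := by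
  unfold UCert
  refine PP.and ?_ (PP.and ?_ ?_)
  · refine PP.all_list (by fun_prop) (by fun_prop) (PP.imp ?_ (PP.ex_mem (by fun_prop) (PP_subperm (by fun_prop) (by fun_prop))))
    exact PP_startC.comp (f := fun x : (ℕ × List (List ℕ)) × List ℕ => (x.1.1, x.2)) (by fun_prop)
  · refine PP.all_mem (by fun_prop) (PP.all_list (by fun_prop) (by fun_prop) (PP.all_list (by fun_prop) ?_ (PP.imp ?_ (PP.imp ?_ ?_))))
    · exact pr_tE (pr_fst (pr_fst Primrec.fst))
    · exact PP_forall₂ (pr_fst (pr_fst (pr_fst Primrec.fst))) (pr_snd (pr_fst Primrec.fst)) (pr_snd Primrec.fst)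
    · exact PP_VC.comp (f := fun x : (((ℕ × List (List ℕ)) × List ℕ) × List ℕ) × List ℕ => (x.1.1.1.1, x.1.2 ++ x.2))
        ((pr_fst (pr_fst (pr_fst Primrec.fst))).pair (pr_append (pr_snd Primrec.fst) Primrec.snd))
    · refine PP.ex_mem (pr_snd (pr_fst (pr_fst Primrec.fst))) (PP_subperm Primrec.snd (pr_append ?_ ?_))
      · exact pr_snd (pr_fst Primrec.fst)
      · exact pr_snd Primrec.fst
  · refine PP.all_mem (by fun_prop) (PP.not (PP.all_mem (by fun_prop) ?_))
    exact PP_fiT.comp (f := fun x : ((ℕ × List (List ℕ)) × List ℕ) × ℕ => (x.1.1.1, x.2)) (by fun_prop)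

def SCert (N : ℕ) (l : List (List ℕ)) : Prop :=
  startC N (l.getD 0 []) ∧ (∀ i < l.length - 1, VC N (l.getD (i+1) []) ∧ (l.getD i []).length ≤ (l.getD (i+1) []).length ∧
    ∀ j < (l.getD i []).length, scT N ((l.getD i []).getD j 0) ((l.getD (i+1) []).getD j 0)) ∧
  (∀ τ ∈ l.getD (l.length - 1) [], fiT N τ)

theorem PP_SCert : PP fun x : ℕ × List (List ℕ) => SCert x.1 x.2 := by
  unfold SCert
  refine PP.and ?_ (PP.and (PP.all_lt (by fun_prop) (PP.and ?_ (PP.and (PP.le (by fun_prop) (by fun_prop)) (PP.all_lt ?_ ?_)))) (PP.all_mem (by fun_prop) ?_))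
  · exact PP_startC.comp (f := fun x : (ℕ × List (List ℕ)) => (x.1, x.2.getD 0 [])) (by fun_prop)
  · exact PP_VC.comp (f := fun x : (ℕ × List (List ℕ)) × ℕ => (x.1.1, x.1.2.getD (x.2+1) [])) (by fun_prop)
  · fun_prop
  · refine PP_scT.comp (f := fun x : ((ℕ × List (List ℕ)) × ℕ) × ℕ =>
      (x.1.1.1, (x.1.1.2.getD x.1.2 []).getD x.2 0, (x.1.1.2.getD (x.1.2+1) []).getD x.2 0)) ?_
    refine (pr_fst (pr_fst Primrec.fst)).pair ((pr_getD _ (pr_getD _ ?_ ?_) ?_).pair (pr_getD _ (pr_getD _ ?_ (pr_add ?_ ?_)) ?_))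
    · exact pr_snd (pr_fst Primrec.fst)
    · exact pr_snd Primrec.fst
    · exact Primrec.snd
    · exact pr_snd (pr_fst Primrec.fst)
    · exact pr_snd Primrec.fst
    · exact Primrec.const 1
    · exact Primrec.snd
  · exact PP_fiT.comp (f := fun x : (ℕ × List (List ℕ)) × ℕ => (x.1.1, x.2)) (by fun_prop)

theorem stepC_iff {N : ℕ} {C C' : List ℕ} : stepC N C C' ↔ VC N C' ∧ C.length ≤ C'.length ∧
    ∀ j < C.length, scT N (C.getD j 0) (C'.getD j 0) := by
  unfold stepC
  refine and_congr_right fun _ => ?_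
  constructor
  · rintro ⟨A, R, rfl, h⟩
    rw [List.forall₂_iff_get] at h
    refine ⟨by simp [h.1], fun j hj => ?_⟩
    have hj' : j < A.length := h.1 ▸ hj
    rw [List.getD_append _ _ _ _ hj', List.getD_eq_getElem _ _ hj, List.getD_eq_getElem _ _ hj']
    exact h.2 j hj hj'
  · rintro ⟨h1, h2⟩
    refine ⟨C'.take C.length, C'.drop C.length, (List.take_append_drop _ _).symm, ?_⟩
    rw [List.forall₂_iff_get]
    refine ⟨by simp [h1], fun i hi hi' => ?_⟩
    have := h2 i hi
    rw [List.getD_eq_getElem _ _ hi, List.getD_eq_getElem _ _ (by omega)] at this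
    simpa using this

theorem SCert.sat {N : ℕ} {l : List (List ℕ)} (h : SCert N l) : SatT N := by
  refine ⟨_, ⟨_, h.1, ?_⟩, h.2.2⟩
  have : ∀ i ≤ l.length - 1, Relation.ReflTransGen (stepC N) (l.getD 0 []) (l.getD i []) := by
    intro i
    induction i with
    | zero => intro _; exact .refl
    | succ i ih => intro hi; exact (ih (by omega)).tail (stepC_iff.2 (h.2.1 i (by omega)))
  exact this _ le_rfl

theorem SatT.path {N : ℕ} (h : SatT N) : ∃ (n : ℕ) (f : ℕ → List ℕ), startC N (f 0) ∧ (∀ i < n, stepC N (f i) (f (i+1))) ∧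
    ∀ τ ∈ f n, fiT N τ := by
  obtain ⟨C, ⟨C0, h0, hr⟩, hf⟩ := h
  suffices ∃ (n : ℕ) (f : ℕ → List ℕ), f 0 = C0 ∧ f n = C ∧ (∀ i < n, stepC N (f i) (f (i+1))) by
    obtain ⟨n, f, rfl, rfl, h⟩ := this
    exact ⟨n, f, h0, h, hf⟩
  clear hf
  induction hr with
  | refl => exact ⟨0, fun _ => C0, rfl, rfl, by simp⟩
  | @tail C1 C2 _ hs ih =>
    obtain ⟨n, f, h1, h2, h3⟩ := ih
    refine ⟨n+1, fun i => if i ≤ n then f i else C2, by simp [h1], by simp, ?_⟩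
    intro i hi
    by_cases hin : i < n
    · simp only [show i ≤ n by omega, if_true, show i + 1 ≤ n by omega]; exact h3 i hin
    · have : i = n := by omega
      subst this
      simp [h2, hs]

theorem SatT.cert {N : ℕ} (h : SatT N) : ∃ l, SCert N l := by
  obtain ⟨n, f, h1, h2, h3⟩ := h.path
  have hg : ∀ i ≤ n, ((List.range (n+1)).map f).getD i [] = f i := by
    intro i hi
    rw [List.getD_eq_getElem _ _ (by simpa using Nat.lt_succ_of_le hi)]; simp
  refine ⟨(List.range (n+1)).map f, ?_, ?_, ?_⟩
  · rw [hg 0 (by omega)]; exact h1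
  · intro i hi
    simp only [List.length_map, List.length_range, Nat.add_sub_cancel] at hi
    rw [hg i (by omega), hg (i+1) (by omega)]
    exact stepC_iff.1 (h2 i hi)
  · simp only [List.length_map, List.length_range, Nat.add_sub_cancel]
    rw [hg n le_rfl]; exact h3

theorem satT_iff (N : ℕ) : SatT N ↔ ∃ l, SCert N l := ⟨SatT.cert, fun ⟨_, h⟩ => h.sat⟩

theorem satT_computable : ComputablePred fun N => ¬ SatT N := by
  rw [ComputablePred.computable_iff_re_compl_re']
  constructor
  · exact (PP.re_ex' (p := fun N B => UCert N B) PP_UCert).of_eq fun N => (satT_compl N).symm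
  · refine (PP.re_ex' (p := fun N B => SCert N B) PP_SCert).of_eq fun N => ?_
    rw [not_not, satT_iff]
end OneVarEq

namespace OneVarEq
open Function

theorem SatT.model {N : ℕ} (h : SatT N) (φ : EF Bool) (hN : φ.encode eB = N) : φ ∉ LogED DSem.xd Cftime := by
  obtain ⟨n, C, ⟨h0, τ0, hτ0, hn0⟩, h2, h3⟩ := h.path
  have hv : ∀ i ≤ n, VC N (C i) := by
    intro i hi
    cases i with
    | zero => exact h0
    | succ i => exact (h2 i (by omega)).1
  obtain ⟨d0, hd0, hd0'⟩ := List.mem_iff_getElem.1 hτ0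
  let dom : (chainF n).W → Set ℕ := fun w => {d | d < (C (w : Fin (n+1)).val).length}
  let τ : (chainF n).W → ℕ → ℕ := fun w d => (C (w : Fin (n+1)).val).getD d 0
  have hlen : ∀ i j, i ≤ j → j ≤ n → (C i).length ≤ (C j).length := by
    intro i j hij
    induction j, hij using Nat.le_induction with
    | base => intro _; exact le_rfl
    | succ j hj ih =>
      intro hjn
      exact (ih (by omega)).trans (stepC_iff.1 (h2 j (by omega))).2.1
  have hsc : ∀ i < n, ∀ d < (C i).length, scT N ((C i).getD d 0) ((C (i+1)).getD d 0) :=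
    fun i hi => (stepC_iff.1 (h2 i hi)).2.2
  have hbS : ∀ i ≤ n, ∀ d < (C i).length, ∀ y, bS y ≤ N → (fb ((C i).getD d 0) (bS y) ↔
      (i < n → fb ((C (i+1)).getD d 0) y)) := by
    intro i hi d hd y hy
    have hyN : y ≤ N := ((Nat.right_le_pair _ _).trans (Nat.right_le_pair _ _)).trans hy
    by_cases hin : i < n
    · rw [(hsc i hin d hd y hyN).1 hy]; simp [hin]
    · have : i = n := by omega
      subst this
      refine iff_of_true ((h3 _ ?_ y hyN).1 hy) (fun h => absurd h hin)
      rw [List.getD_eq_getElem _ _ hd]; exact List.getElem_mem hd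
  have hbL : ∀ k i, i + k = n → ∀ d < (C i).length, ∀ y, bL y ≤ N → (fb ((C i).getD d 0) (bL y) ↔
      ∀ j, i < j → j ≤ n → fb ((C j).getD d 0) y) := by
    intro k
    induction k with
    | zero =>
      intro i hi d hd y hy
      have hyN : y ≤ N := ((Nat.right_le_pair _ _).trans (Nat.right_le_pair _ _)).trans hy
      have : i = n := by omega
      subst this
      refine iff_of_true ((h3 _ ?_ y hyN).2 hy) (fun j _ _ => by omega)
      rw [List.getD_eq_getElem _ _ hd]; exact List.getElem_mem hd
    | succ k ih =>
      intro i hi d hd y hy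
      have hyN : y ≤ N := ((Nat.right_le_pair _ _).trans (Nat.right_le_pair _ _)).trans hy
      rw [(hsc i (by omega) d hd y hyN).2 hy, ih (i+1) (by omega) d (lt_of_lt_of_le hd (hlen _ _ (by omega) (by omega))) y hy]
      constructor
      · rintro ⟨h1, h2⟩ j hj hjn
        by_cases hj' : j = i+1
        · rw [hj']; exact h1
        · exact h2 j (by omega) hjn
      · intro h
        exact ⟨h (i+1) (by omega) (by omega), fun j hj hjn => h j (by omega) hjn⟩
  have L : Labelled N eB (chainF n) ℕ dom τ := by
    refine ⟨?_, ?_, ?_, ?_, ?_⟩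
    · intro (w : Fin (n+1))
      exact ⟨0, List.length_pos_of_ne_nil (hv w.val (by omega)).ne⟩
    · intro m (w : Fin (n+1)) (v : Fin (n+1)) hwv d hd
      have hle : w.val ≤ v.val := by
        cases m with
        | false => have : w.val + 1 = v.val := hwv
                   omega
        | true => have : w < v := hwv
                  exact this.le
      exact lt_of_lt_of_le hd (hlen _ _ hle (by omega))
    · intro (w : Fin (n+1))
      refine ⟨C w.val, fun σ => ?_, (hv w.val (by omega)).row⟩
      rw [List.mem_iff_getElem]
      constructor
      · rintro ⟨i, hi, h⟩
        refine ⟨i, hi, ?_⟩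
        rw [← h]; exact List.getD_eq_getElem _ _ hi
      · rintro ⟨i, hi, h⟩
        refine ⟨i, hi, ?_⟩
        rw [← h]; exact (List.getD_eq_getElem _ _ hi).symm
    · intro (w : Fin (n+1)) d hd d' hd' hc he
      have e1 : τ w d = (C w.val)[d]'hd := List.getD_eq_getElem _ _ hd
      have e2 : τ w d' = (C w.val)[d']'hd' := List.getD_eq_getElem _ _ hd'
      have := (hv w.val (by omega)).cnt (τ w d) (e1 ▸ List.getElem_mem _) hc
      by_contra hne
      have h2 : List.Duplicate (τ w d) (C w.val) := by
        rcases lt_or_gt_of_ne hne with h | h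
        · exact List.duplicate_iff_exists_distinct_get.2 ⟨⟨d, hd⟩, ⟨d', hd'⟩, h, e1, he ▸ e2⟩
        · exact List.duplicate_iff_exists_distinct_get.2 ⟨⟨d', hd'⟩, ⟨d, hd⟩, h, he ▸ e2, e1⟩
      have := List.duplicate_iff_two_le_count.1 h2
      omega
    · intro m (w : Fin (n+1)) d hd y hy
      cases m with
      | false =>
        refine (hbS w.val (by omega) d hd y hy).trans ?_
        constructor
        · intro h (v : Fin (n+1)) (hvv : w.val + 1 = v.val)
          have := h (by omega)
          rw [hvv] at this; exact this
        · intro h hlt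
          exact h (⟨w.val+1, by omega⟩ : Fin (n+1)) rfl
      | true =>
        refine (hbL (n - w.val) w.val (by omega) d hd y hy).trans ?_
        constructor
        · intro h (v : Fin (n+1)) (hvv : w < v)
          exact h v.val hvv (by omega)
        · intro h j hj hjn
          exact h (⟨j, by omega⟩ : Fin (n+1)) hj
  refine L.model (chainF_mem n) φ hN (0 : Fin (n+1)) d0 hd0 ?_
  have : τ (0 : Fin (n+1)) d0 = τ0 := by
    rw [← hd0']; exact List.getD_eq_getElem _ _ hd0
  rw [this]; exact hn0

theorem exists_cover {D : Type} {dom : Set D} {τ : D → ℕ} (C : List ℕ) (hC : ∀ σ, σ ∈ C ↔ ∃ d ∈ dom, τ d = σ)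
    (es : List D) (hnd : es.Nodup) (hes : ∀ d ∈ es, d ∈ dom) :
    ∃ ex : List D, (es ++ ex).Nodup ∧ (∀ d ∈ es ++ ex, d ∈ dom) ∧ ∀ σ, σ ∈ C ↔ σ ∈ (es ++ ex).map τ := by
  classical
  have : ∀ C' : List ℕ, (∀ σ ∈ C', σ ∈ C) → ∃ ex : List D, (es ++ ex).Nodup ∧ (∀ d ∈ es ++ ex, d ∈ dom) ∧
      ∀ σ ∈ C', σ ∈ (es ++ ex).map τ := by
    intro C'
    induction C' with
    | nil => intro _; exact ⟨[], by simpa using hnd, by simpa using hes, by simp⟩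
    | cons σ C' ih =>
      intro h
      obtain ⟨ex, h1, h2, h3⟩ := ih fun σ hσ => h σ (List.mem_cons_of_mem _ hσ)
      by_cases hσ : σ ∈ (es ++ ex).map τ
      · refine ⟨ex, h1, h2, ?_⟩
        intro σ' hσ'
        rcases List.mem_cons.1 hσ' with rfl | hσ'
        · exact hσ
        · exact h3 _ hσ'
      · obtain ⟨d, hd, rfl⟩ := (hC σ).1 (h σ (by simp))
        have hdn : d ∉ es ++ ex := fun hd' => hσ (List.mem_map_of_mem hd')
        refine ⟨ex ++ [d], ?_, ?_, ?_⟩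
        · rw [← List.append_assoc]
          exact List.Nodup.append h1 (List.nodup_singleton d) (by simpa using hdn)
        · rw [← List.append_assoc]
          intro d' hd'
          rcases List.mem_append.1 hd' with hd' | hd'
          · exact h2 _ hd'
          · rw [List.mem_singleton.1 hd']; exact hd
        · rw [← List.append_assoc]
          intro σ' hσ'
          rw [List.map_append, List.mem_append]
          rcases List.mem_cons.1 hσ' with rfl | hσ'
          · right; simp
          · left; exact h3 _ hσ'
  obtain ⟨ex, h1, h2, h3⟩ := this C (fun _ h => h)
  refine ⟨ex, h1, h2, fun σ => ⟨h3 σ, fun h => ?_⟩⟩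
  obtain ⟨d, hd, rfl⟩ := List.mem_map.1 h
  exact (hC _).2 ⟨d, h2 d hd, rfl⟩

theorem SatT.of_labelled {N : ℕ} {F : KFrame Bool} (hF : F ∈ Cftime) {D : Type} {dom : F.W → Set D} {τ : F.W → D → ℕ}
    (L : Labelled N eB F D dom τ) (hlt : ∀ w d, τ w d < 2 ^ (2*N+2)) {w0 : F.W} {d0 : D} (hd0 : d0 ∈ dom w0)
    (h0 : ¬ fb (τ w0 d0) N) : SatT N := by
  classical
  have ext : ∀ w, ∀ es : List D, es.Nodup → (∀ d ∈ es, d ∈ dom w) → ∃ ex : List D, (es ++ ex).Nodup ∧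
      (∀ d ∈ es ++ ex, d ∈ dom w) ∧ VC N ((es ++ ex).map (τ w)) := by
    intro w es hes hd
    obtain ⟨C, hC, hR⟩ := L.row w
    obtain ⟨ex, h1, h2, h3⟩ := exists_cover C hC es hes hd
    refine ⟨ex, h1, h2, ?_, ?_, hR.congr h3, ?_⟩
    · intro h
      obtain ⟨d, hd⟩ := L.ne w
      have := (h3 _).1 ((hC _).2 ⟨d, hd, rfl⟩)
      rw [h] at this; simp at this
    · intro σ hσ
      obtain ⟨d, _, rfl⟩ := List.mem_map.1 hσ
      exact hlt w d
    · intro σ hσ hc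
      obtain ⟨d, hd, rfl⟩ := List.mem_map.1 hσ
      rw [List.count, List.countP_map]
      rw [show (es ++ ex).countP ((fun x => x == τ w d) ∘ τ w) = (es ++ ex).count d from ?_]
      · exact List.nodup_iff_count_le_one.1 h1 d
      · rw [List.count]
        refine List.countP_congr fun d' hd' => ?_
        simp only [comp, beq_iff_eq]
        exact ⟨fun h => (L.uniq w d (h2 d hd) d' (h2 d' hd') hc h.symm).symm, fun h => by rw [h]⟩
  have main : ∀ w, ∀ es : List D, es.Nodup → (∀ d ∈ es, d ∈ dom w) → ReachC N (es.map (τ w)) → SatT N := by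
    intro w
    induction w using (Cftime_wf hF).induction with
    | _ w ih =>
      intro es hnd hes hr
      by_cases hs : ∃ v, F.R false w v
      · obtain ⟨v, hv⟩ := hs
        have hv' : F.R true w v := (Cftime_succ hF w v).2 (Or.inl hv)
        have hex := L.expand _ _ _ hv
        obtain ⟨ex, h1, h2, h3⟩ := ext v es hnd fun d hd => hex (hes d hd)
        refine ih v hv' _ h1 h2 ?_
        obtain ⟨C0, h4, h5⟩ := hr
        refine ⟨C0, h4, h5.tail ⟨h3, es.map (τ v), ex.map (τ v), List.map_append, ?_⟩⟩
        rw [List.forall₂_map_left_iff, List.forall₂_map_right_iff, List.forall₂_same]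
        intro d hd y hy
        constructor
        · intro hle
          refine (L.box false w d (hes d hd) y hle).trans ?_
          exact ⟨fun h => h v hv, fun h u hu => Cftime_fun hF w v u hv hu ▸ h⟩
        · intro hle
          refine (L.box true w d (hes d hd) y hle).trans ?_
          have h6 := L.box true v d (hex (hes d hd)) y hle
          refine Iff.trans ?_ (and_congr_right' h6).symm
          constructor
          · intro h
            exact ⟨h v hv', fun u hu => h u ((Cftime_succ hF w u).2 (Or.inr ⟨v, hv, hu⟩))⟩
          · rintro ⟨h7, h8⟩ u hu
            rcases (Cftime_succ hF w u).1 hu with h9 | ⟨v', h9, h10⟩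
            · rw [← Cftime_fun hF w v u hv h9]; exact h7
            · rw [← Cftime_fun hF w v v' hv h9] at h10; exact h8 u h10
      · refine ⟨_, hr, ?_⟩
        intro σ hσ y hy
        obtain ⟨d, hd, rfl⟩ := List.mem_map.1 hσ
        constructor
        · intro hle
          exact (L.box false w d (hes d hd) y hle).2 fun v hv => absurd ⟨v, hv⟩ hs
        · intro hle
          refine (L.box true w d (hes d hd) y hle).2 fun v hv => ?_
          rcases (Cftime_succ hF w v).1 hv with h | ⟨u, h, _⟩
          · exact absurd ⟨_, h⟩ hs
          · exact absurd ⟨_, h⟩ hs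
  obtain ⟨ex, h1, h2, h3⟩ := ext w0 [d0] (List.nodup_singleton _) (by simpa using hd0)
  exact main w0 _ h1 h2 ⟨_, ⟨h3, τ w0 d0, by simp, h0⟩, .refl⟩

/-- assembling decidability from a decidable combinatorial condition -/
theorem decidable_of_sat {M : Type} (eM : M → ℕ) (dM : ℕ → M) (K : ℕ) (h1 : ∀ i < K, eM (dM i) = i) (h2 : ∀ m, eM m < K)
    (L : Set (EF M)) (S : ℕ → Prop) (hS : ComputablePred fun N => ¬ S N)
    (h : ∀ φ : EF M, φ ∉ L ↔ S (φ.encode eM)) : DecidableELogic eM L := by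
  classical
  have : ComputablePred fun N => IsCode K N ∧ ¬ S N := by
    obtain ⟨_, h1⟩ := (PP_isCode K).computable
    obtain ⟨_, h2⟩ := hS
    refine ⟨inferInstance, ?_⟩
    refine ((Primrec.and.to_comp).comp h1 h2).of_eq fun N => ?_
    simp
  refine ComputablePred.of_eq this fun N => ?_
  constructor
  · rintro ⟨hc, hs⟩
    obtain ⟨φ, rfl⟩ := (isCode_iff eM dM K h1 h2 N).1 hc
    exact ⟨φ, not_not.1 fun h' => hs ((h φ).1 h'), rfl⟩
  · rintro ⟨φ, hφ, rfl⟩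
    exact ⟨(isCode_iff eM dM K h1 h2 _).2 ⟨φ, rfl⟩, fun hs => (h φ).2 hs hφ⟩

theorem part2 : DecidableELogic eB (LogED DSem.xd Cftime) := by
  refine decidable_of_sat eB (fun i => decide (i = 1)) 2 ?_ ?_ _ SatT satT_computable ?_
  · intro i hi
    interval_cases i <;> rfl
  · intro m; cases m <;> decide
  · intro φ
    constructor
    · intro h
      obtain ⟨F, hF, D, dom, τ, L, hlt, w0, d0, hd0, h0⟩ := Labelled.of_not_mem (eM := eB) (dM := fun i => decide (i = 1))
        (by intro m; cases m <;> rfl) φ rfl h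
      exact SatT.of_labelled hF L hlt hd0 h0
    · intro h; exact h.model φ rfl
end OneVarEq

namespace OneVarEq
open Function

/-! ### grids for difference frames -/
open Classical in
/-- capped cardinality -/
noncomputable def cap {α : Type} (A : Set α) : ℕ := if A = ∅ then 0 else if A.Subsingleton then 1 else 2

theorem cap_eq_zero {α : Type} {A : Set α} : cap A = 0 ↔ A = ∅ := by
  unfold cap; split_ifs <;> simp_all
theorem cap_le_one {α : Type} {A : Set α} : cap A ≤ 1 ↔ A.Subsingleton := by
  unfold cap; split_ifs with h1 h2
  · subst h1; simp
  · simp [h2]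
  · simp [h2]
theorem cap_le_two {α : Type} (A : Set α) : cap A ≤ 2 := by
  unfold cap; split_ifs <;> omega
theorem cap_eq_two {α : Type} {A : Set α} : cap A = 2 ↔ ¬ A.Subsingleton := by
  rw [← cap_le_one]; have := cap_le_two A; omega
theorem cap_ne_zero {α : Type} {A : Set α} : cap A ≠ 0 ↔ A.Nonempty := by
  rw [Ne, cap_eq_zero, Set.nonempty_iff_ne_empty]

def gE (N : ℕ) : ℕ := 2 * 2 ^ (2*N+2)
def supp (E : ℕ) (p : ℕ → ℕ) : List ℕ := (List.range E).filter (fun t => p t ≠ 0)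
theorem mem_supp {E : ℕ} {p : ℕ → ℕ} {t : ℕ} : t ∈ supp E p ↔ t < E ∧ p t ≠ 0 := by
  simp [supp]

def RowP (N : ℕ) (p : ℕ → ℕ) : Prop :=
  RowL N ((supp (gE N) p).map (· / 2)) ∧ (∀ t ∈ supp (gE N) p, hascb N (t/2) → p t ≤ 1) ∧
  (∀ t ∈ supp (gE N) p, ∀ t' ∈ supp (gE N) p, t % 2 = t' % 2)
def ColP (N : ℕ) (q : ℕ → ℕ) : Prop :=
  ∀ σ ∈ supp (gE N) q, ∀ y ≤ N, bS y ≤ N → (fb (σ/2) (bS y) ↔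
    (∀ σ' ∈ supp (gE N) q, σ' ≠ σ → fb (σ'/2) y) ∧ ((q σ = 2 ∨ σ % 2 = 1) → fb (σ/2) y))
def SideP (b : Bool) (N : ℕ) (p : ℕ → ℕ) : Prop := if b then RowP N p else ColP N p

theorem SideP.congr {b : Bool} {N : ℕ} {p p' : ℕ → ℕ} (h : ∀ t < gE N, p t = p' t) (hp : SideP b N p) :
    SideP b N p' := by
  have hs : supp (gE N) p = supp (gE N) p' := by
    unfold supp
    refine List.filter_congr fun t ht => ?_
    rw [h t (List.mem_range.1 ht)]
  cases b with
  | true =>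
    obtain ⟨h1, h2, h3⟩ := (hp : RowP N p)
    rw [hs] at h1 h2 h3
    exact (⟨h1, fun t ht hc => by rw [← h t (mem_supp.1 ht).1]; exact h2 t ht hc, h3⟩ : RowP N p')
  | false =>
    intro σ hσ y hy hle
    have hp : ColP N p := hp
    rw [← hs] at hσ ⊢
    rw [← h σ (mem_supp.1 hσ).1]
    exact hp σ hσ y hy hle

structure Grid (N : ℕ) (W D : Type) (f : W → D → ℕ) : Prop where
  lt : ∀ w d, f w d < gE N
  row : ∀ w, RowP N (fun t => cap {d | f w d = t})
  col : ∀ d, ColP N (fun t => cap {w | f w d = t})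
  tgt : ∃ w d, ¬ fb (f w d / 2) N

def GSat (N : ℕ) : Prop := ∃ (W D : Type) (f : W → D → ℕ), Grid N W D f

theorem mem_supp_cap {N : ℕ} {D : Type} {g : D → ℕ} (h : ∀ d, g d < gE N) {t : ℕ} :
    t ∈ supp (gE N) (fun t => cap {d | g d = t}) ↔ ∃ d, g d = t := by
  rw [mem_supp, cap_ne_zero]
  constructor
  · rintro ⟨_, d, hd⟩; exact ⟨d, hd⟩
  · rintro ⟨d, rfl⟩; exact ⟨h d, d, rfl⟩

@[reducible] def gridF {N : ℕ} {W D : Type} {f : W → D → ℕ} (_ : Grid N W D f) (hW : Nonempty W) : KFrame Unit :=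
  ⟨W, hW, fun _ w v => w ≠ v ∨ ∃ d, f w d % 2 = 1⟩

theorem GSat.model {N : ℕ} (h : GSat N) (φ : EF Unit) (hN : φ.encode eU = N) : φ ∉ LogED DSem.xd Cdiff := by
  obtain ⟨W, D, f, G⟩ := h
  obtain ⟨w0, d0, h0⟩ := G.tgt
  have hF : gridF G ⟨w0⟩ ∈ Cdiff := by
    rw [mem_Cdiff_iff]
    constructor
    · intro (x : W) (y : W) hxy
      by_cases h : x = y
      · subst h; exact hxy
      · exact Or.inl (Ne.symm h)
    · intro (x : W) (y : W) (z : W) hxy hxz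
      by_cases hne : z = y
      · exact Or.inl hne
      · exact Or.inr (Or.inl hne)
  have hpar : ∀ w d d', f w d % 2 = f w d' % 2 := fun w d d' =>
    (G.row w).2.2 _ ((mem_supp_cap (G.lt w)).2 ⟨d, rfl⟩) _ ((mem_supp_cap (G.lt w)).2 ⟨d', rfl⟩)
  have L : Labelled N eU (gridF G ⟨w0⟩) D (fun _ => Set.univ) (fun (w : W) d => f w d / 2) := by
    refine ⟨fun w => ⟨d0, trivial⟩, fun _ _ _ _ => le_rfl, ?_, ?_, ?_⟩
    · intro (w : W)
      refine ⟨_, fun σ => ?_, (G.row w).1⟩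
      rw [List.mem_map]
      constructor
      · rintro ⟨t, ht, rfl⟩
        obtain ⟨d, rfl⟩ := (mem_supp_cap (G.lt w)).1 ht
        exact ⟨d, trivial, rfl⟩
      · rintro ⟨d, _, rfl⟩
        exact ⟨_, (mem_supp_cap (G.lt w)).2 ⟨d, rfl⟩, rfl⟩
    · intro (w : W) d _ d' _ hc (he : f w d / 2 = f w d' / 2)
      have e : f w d = f w d' := by have := hpar w d d'; omega
      have := (G.row w).2.1 _ ((mem_supp_cap (G.lt w)).2 ⟨d, rfl⟩) hc
      exact (cap_le_one.1 this) rfl e.symm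
    · intro m (w : W) d _ y hy
      have hyN : y ≤ N := ((Nat.right_le_pair _ _).trans (Nat.right_le_pair _ _)).trans hy
      refine (G.col d _ ((mem_supp_cap (fun w => G.lt w d)).2 ⟨w, rfl⟩) y hyN hy).trans ?_
      constructor
      · rintro ⟨h1, h2⟩ (v : W) (hv : w ≠ v ∨ ∃ d, f w d % 2 = 1)
        by_cases he : f v d = f w d
        · show fb (f v d / 2) y
          rw [he]
          refine h2 ?_
          rcases hv with hv | ⟨d', hd'⟩
          · left
            exact cap_eq_two.2 fun hs => hv (hs rfl he)
          · right; rw [hpar w d d']; exact hd'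
        · exact h1 _ ((mem_supp_cap (fun w => G.lt w d)).2 ⟨v, rfl⟩) he
      · intro (h : ∀ v : W, (w ≠ v ∨ ∃ d, f w d % 2 = 1) → fb (f v d / 2) y)
        constructor
        · intro σ hσ hne
          obtain ⟨v, rfl⟩ := (mem_supp_cap (fun w => G.lt w d)).1 hσ
          exact h v (Or.inl fun e => hne (by rw [e]))
        · rintro (h2 | h2)
          · have h3 := cap_eq_two.1 h2
            have : ∃ v, w ≠ v ∧ f v d = f w d := by
              by_contra hc
              push Not at hc
              refine h3 fun a ha a' ha' => ?_
              have e1 : a = w := by by_contra hh; exact hc a (Ne.symm hh) ha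
              have e2 : a' = w := by by_contra hh; exact hc a' (Ne.symm hh) ha'
              rw [e1, e2]
            obtain ⟨v, hv, he⟩ := this
            rw [← he]; exact h v (Or.inl hv)
          · exact h w (Or.inr ⟨d, h2⟩)
  exact L.model hF φ hN w0 d0 trivial h0

theorem GSat.of_not_mem (φ : EF Unit) (h : φ ∉ LogED DSem.xd Cdiff) : GSat (φ.encode eU) := by
  classical
  obtain ⟨F, hF, D, dom, τ, L, hlt, w0, d0, hd0, h0⟩ := Labelled.of_not_mem (eM := eU) (dM := fun _ => ())
    (fun _ => rfl) φ rfl h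
  rw [mem_Cdiff_iff] at hF
  obtain ⟨hsym, htr⟩ := hF
  set N := φ.encode eU
  let W := {v : F.W // v = w0 ∨ F.R () w0 v}
  let D' := {d : D // d ∈ dom w0}
  have hdom : ∀ w : W, dom w.1 = dom w0 := by
    rintro ⟨w, hw⟩
    rcases hw with rfl | hw
    · rfl
    · exact Set.Subset.antisymm (L.expand () _ _ (hsym _ _ hw)) (L.expand () _ _ hw)
  have hR : ∀ w v : W, w ≠ v → F.R () w.1 v.1 := by
    rintro ⟨w, hw⟩ ⟨v, hv⟩ hne
    have hne' : w ≠ v := fun e => hne (Subtype.ext e)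
    show F.R () w v
    rcases hw with rfl | hw
    · rcases hv with rfl | hv
      · exact absurd rfl hne'
      · exact hv
    · rcases hv with rfl | hv
      · exact hsym _ _ hw
      · exact (htr _ _ _ hv hw).resolve_left hne'
  have hRW : ∀ w : W, ∀ v, F.R () w.1 v → v = w0 ∨ F.R () w0 v := by
    rintro ⟨w, hw⟩ v (hv : F.R () w v)
    rcases hw with rfl | hw
    · exact Or.inr hv
    · by_cases e : w0 = v
      · exact Or.inl e.symm
      · exact Or.inr ((htr _ _ _ hv (hsym _ _ hw)).resolve_left e)
  let r : W → ℕ := fun w => if F.R () w.1 w.1 then 1 else 0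
  have hr : ∀ w, r w < 2 := by intro w; simp only [r]; split_ifs <;> omega
  have hr1 : ∀ w, r w = 1 ↔ F.R () w.1 w.1 := by intro w; simp only [r]; split_ifs <;> simp_all
  let f : W → D' → ℕ := fun w d => 2 * τ w.1 d.1 + r w
  have hf2 : ∀ w d, f w d / 2 = τ w.1 d.1 := by intro w d; have := hr w; simp only [f]; omega
  have hfm : ∀ w d, f w d % 2 = r w := by intro w d; have := hr w; simp only [f]; omega
  have hflt : ∀ w d, f w d < gE N := by
    intro w d
    have h1 := hr w; have h2 := hlt w.1 d.1
    simp only [f, gE]; omega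
  refine ⟨W, D', f, hflt, ?_, ?_, ⟨w0, Or.inl rfl⟩, ⟨d0, hd0⟩, ?_⟩
  · intro w
    refine ⟨?_, ?_, ?_⟩
    · obtain ⟨C, hC, hR⟩ := L.row w.1
      refine hR.congr fun σ => ?_
      rw [hC, List.mem_map]
      constructor
      · rintro ⟨d, hd, rfl⟩
        refine ⟨f w ⟨d, hdom w ▸ hd⟩, (mem_supp_cap (hflt w)).2 ⟨_, rfl⟩, hf2 _ _⟩
      · rintro ⟨t, ht, rfl⟩
        obtain ⟨d, rfl⟩ := (mem_supp_cap (hflt w)).1 ht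
        exact ⟨d.1, (hdom w).symm ▸ d.2, (hf2 _ _).symm⟩
    · intro t ht hc
      refine cap_le_one.2 ?_
      rintro d rfl d' (hd' : f w d' = f w d)
      rw [hf2] at hc
      exact Subtype.ext (L.uniq w.1 d.1 ((hdom w).symm ▸ d.2) d'.1 ((hdom w).symm ▸ d'.2) hc
        (by rw [← hf2, ← hf2, hd']))
    · intro t ht t' ht'
      obtain ⟨d, rfl⟩ := (mem_supp_cap (hflt w)).1 ht
      obtain ⟨d', rfl⟩ := (mem_supp_cap (hflt w)).1 ht'
      rw [hfm, hfm]
  · intro d σ hσ y hy hle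
    obtain ⟨w, rfl⟩ := (mem_supp_cap (fun w => hflt w d)).1 hσ
    rw [hf2]
    refine (L.box () w.1 d.1 ((hdom w).symm ▸ d.2) y hle).trans ?_
    constructor
    · intro h
      constructor
      · intro σ' hσ' hne
        obtain ⟨v, rfl⟩ := (mem_supp_cap (fun w => hflt w d)).1 hσ'
        rw [hf2]
        exact h v.1 (hR w v fun e => hne (by rw [e]))
      · rintro (h2 | h2)
        · have h3 := cap_eq_two.1 h2
          have : ∃ v, w ≠ v ∧ f v d = f w d := by
            by_contra hc
            push Not at hc
            refine h3 fun a ha a' ha' => ?_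
            have e1 : a = w := by by_contra hh; exact hc a (Ne.symm hh) ha
            have e2 : a' = w := by by_contra hh; exact hc a' (Ne.symm hh) ha'
            rw [e1, e2]
          obtain ⟨v, hv, he⟩ := this
          rw [← hf2, ← he, hf2]; exact h v.1 (hR w v hv)
        · rw [hfm, hr1] at h2
          exact h w.1 h2
    · rintro ⟨h1, h2⟩ v hv
      have hv' := hRW w v hv
      set v' : W := ⟨v, hv'⟩ with hv'd
      show fb (τ v'.1 d.1) y
      rw [← hf2]
      by_cases he : f v' d = f w d
      · rw [he, hf2]
        refine h2 ?_
        by_cases hwv : w = v'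
        · right
          rw [hfm, hr1]
          have : w.1 = v := by rw [hwv]
          rw [← this] at hv; exact hv
        · left
          exact cap_eq_two.2 fun hs => hwv (hs rfl he)
      · exact h1 _ ((mem_supp_cap (fun w => hflt w d)).2 ⟨v', rfl⟩) he
  · rw [hf2]; exact h0
end OneVarEq

namespace OneVarEq
open Function

/-! ### finite certificates for grids -/
theorem cap_of {α : Type} [DecidableEq α] {A : Set α} {q : ℕ} (s : Finset α) (hs : ∀ y ∈ s, y ∈ A) (h2 : q ≤ 2)
    (h : q ≤ s.card) (h' : q < 2 → (∀ y ∈ A, y ∈ s) ∧ s.card ≤ q) : cap A = q := by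
  rcases Nat.lt_or_ge q 2 with hq | hq
  · obtain ⟨h3, h4⟩ := h' hq
    have hA : A = (s : Set α) := by
      ext y; exact ⟨h3 y, hs y⟩
    have hc : s.card = q := le_antisymm h4 h
    interval_cases q
    · rw [cap_eq_zero, hA, Finset.card_eq_zero.1 hc]; simp
    · obtain ⟨y, rfl⟩ := Finset.card_eq_one.1 hc
      have h5 : cap A ≤ 1 := by rw [cap_le_one, hA]; simp
      have h6 : cap A ≠ 0 := by rw [cap_ne_zero, hA]; simp
      omega
  · have : q = 2 := by omega
    subst this
    rw [cap_eq_two]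
    intro hss
    obtain ⟨a, ha, b, hb, hab⟩ := Finset.one_lt_card.1 (show 1 < s.card by omega)
    exact hab (hss (hs a ha) (hs b hb))

theorem cap_subtype {α : Type} (P Q : α → Prop) : cap {y : {y // P y} | Q y.1} = cap {y | P y ∧ Q y} := by
  have h0 : cap {y : {y // P y} | Q y.1} = 0 ↔ cap {y | P y ∧ Q y} = 0 := by
    simp only [cap_eq_zero, Set.eq_empty_iff_forall_notMem, Set.mem_ofPred_eq, Subtype.forall]
    tauto
  have h1 : cap {y : {y // P y} | Q y.1} ≤ 1 ↔ cap {y | P y ∧ Q y} ≤ 1 := by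
    simp only [cap_le_one]
    constructor
    · rintro h x ⟨hx, hx'⟩ y ⟨hy, hy'⟩
      exact congrArg Subtype.val (@h ⟨x, hx⟩ hx' ⟨y, hy⟩ hy')
    · rintro h x hx y hy
      exact Subtype.ext (h ⟨x.2, hx⟩ ⟨y.2, hy⟩)
  have := cap_le_two {y : {y // P y} | Q y.1}
  have := cap_le_two {y | P y ∧ Q y}
  omega

def tr (c : ℕ → ℕ → ℕ) (b : Bool) (i j : ℕ) : ℕ := if b then c i j else c j i
theorem tr_not (c : ℕ → ℕ → ℕ) (b : Bool) (i j : ℕ) : tr c (!b) i j = tr c b j i := by cases b <;> rfl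

def cnt (m : Bool → ℕ) (c : ℕ → ℕ → ℕ) (b : Bool) (i t : ℕ) : ℕ :=
  ((Finset.range (m (!b))).filter fun j => tr c b i j = t).card
def kcnt (m : Bool → ℕ) (K : Bool → ℕ → Bool) (c : ℕ → ℕ → ℕ) (b : Bool) (i t : ℕ) : ℕ :=
  ((Finset.range (m (!b))).filter fun j => K (!b) j = true ∧ tr c b i j = t).card
def acc (m : Bool → ℕ) (p : Bool → ℕ → ℕ → ℕ) (K : Bool → ℕ → Bool) (c : ℕ → ℕ → ℕ) (b : Bool) (i t : ℕ) : Prop :=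
  p b i t = 2 ∨ (p b i t = 1 ∧ kcnt m K c b i t = 0)

structure Cert (N : ℕ) (m : Bool → ℕ) (p : Bool → ℕ → ℕ → ℕ) (K G : Bool → ℕ → Bool) (c : ℕ → ℕ → ℕ) : Prop where
  side : ∀ b, ∀ i < m b, SideP b N (p b i)
  ple : ∀ b, ∀ i < m b, ∀ t < gE N, p b i t ≤ 2
  lt : ∀ b, ∀ i < m b, ∀ j < m (!b), tr c b i j < gE N
  c2 : ∀ b, ∀ i < m b, ∀ t < gE N, p b i t < 2 → cnt m c b i t ≤ p b i t
  c3 : ∀ b, ∀ i < m b, K b i = true → ∀ t < gE N, p b i t ≤ cnt m c b i t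
  c4 : ∀ b, ∀ i < m b, K b i = true → ∀ j < m (!b), G (!b) j = true → p b i (tr c b i j) = 2
  c5 : ∀ i < m true, K true i = false → ∀ j < m false, K false j = false → ∃ t < gE N, p true i t = 2 ∧ p false j t = 2
  c6 : ∀ b, ∀ i < m b, K b i = false → ∀ t < gE N, cnt m c b i t < p b i t →
    ∃ j < m (!b), G (!b) j = true ∧ acc m p K c (!b) j t
  c7 : ∀ b, ∀ i < m b, G b i = true → ∀ t < gE N, kcnt m K c b i t < p b i t →
    ∃ j < m (!b), G (!b) j = true ∧ acc m p K c (!b) j t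
  c8 : ∀ b, ∀ i < m b, G b i = true → K b i = false
  tgt : ∃ i < m true, ∃ j < m false, ¬ fb (c i j / 2) N

inductive Nm : Type
  | ini (i : ℕ) : Nm
  | wit (x : Nm) (t s : ℕ) : Nm

theorem Nm.ne_wit (x : Nm) (t s : ℕ) : x ≠ .wit x t s := by
  intro h
  have := congrArg sizeOf h
  simp at this
  omega

section build
variable (N : ℕ) (m : Bool → ℕ) (p : Bool → ℕ → ℕ → ℕ) (K G : Bool → ℕ → Bool) (c : ℕ → ℕ → ℕ)

open Classical in
noncomputable def sel (b : Bool) (t : ℕ) : ℕ :=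
  if h : ∃ j < m b, G b j = true ∧ acc m p K c b j t then h.choose else 0
theorem sel_spec {b : Bool} {t : ℕ} (h : ∃ j < m b, G b j = true ∧ acc m p K c b j t) :
    sel m p K G c b t < m b ∧ G b (sel m p K G c b t) = true ∧ acc m p K c b (sel m p K G c b t) t := by
  unfold sel
  rw [dif_pos h]
  exact h.choose_spec

noncomputable def rep (b : Bool) : Nm → ℕ
  | .ini i => i
  | .wit _ t _ => sel m p K G c b t
noncomputable def base (b : Bool) : Nm → ℕ → ℕ
  | .ini i, t => cnt m c b i t
  | .wit _ t0 _, t => (if t0 = t then 1 else 0) + kcnt m K c b (sel m p K G c b t0) t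
noncomputable def need (b : Bool) (x : Nm) (t : ℕ) : ℕ := p b (rep m p K G c b x) t - base m p K G c b x t
def kg (b : Bool) : Nm → Bool
  | .ini i => K b i
  | .wit _ _ _ => false
def valid : Bool → Nm → Prop
  | b, .ini i => i < m b
  | b, .wit x t s => valid (!b) x ∧ kg K (!b) x = false ∧ t < gE N ∧ s < need m p K G c (!b) x t

open Classical in
noncomputable def gn (i j : ℕ) : ℕ :=
  if h : ∃ t < gE N, p true i t = 2 ∧ p false j t = 2 then h.choose else 0

def isI : Nm → Bool
  | .ini _ => true
  | .wit _ _ _ => false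

open Classical in
noncomputable def parT (x : Nm) : Nm → Option ℕ
  | .ini _ => none
  | .wit z t _ => if z = x then some t else none

noncomputable def dflt (b : Bool) (x y : Nm) : ℕ :=
  if (isI x && isI y) || kg K b x || kg K (!b) y then tr c b (rep m p K G c b x) (rep m p K G c (!b) y)
  else tr (gn N p) b (rep m p K G c b x) (rep m p K G c (!b) y)
noncomputable def cell (b : Bool) (x y : Nm) : ℕ :=
  (parT x y).getD ((parT y x).getD (dflt N m p K G c b x y))

theorem parT_self (x y : Nm) (t u : ℕ) (h : parT x y = some t) (h' : parT y x = some u) : False := by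
  cases x with
  | ini => cases h'
  | wit z t s =>
    cases y with
    | ini => cases h
    | wit z' t' s' =>
      simp only [parT] at h h'
      split_ifs at h with h1
      split_ifs at h' with h2
      have h3 := congrArg sizeOf h1
      have h4 := congrArg sizeOf h2
      simp at h3 h4
      omega

theorem cell_not (b : Bool) (x y : Nm) : cell N m p K G c (!b) y x = cell N m p K G c b x y := by
  have hd : dflt N m p K G c (!b) y x = dflt N m p K G c b x y := by
    unfold dflt
    rw [Bool.not_not, tr_not, tr_not]
    have : (((isI y && isI x) || kg K (!b) y) || kg K b x) = (((isI x && isI y) || kg K b x) || kg K (!b) y) := by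
      cases isI y <;> cases isI x <;> cases kg K (!b) y <;> cases kg K b x <;> rfl
    rw [this]
  unfold cell
  rw [hd]
  cases h1 : parT x y with
  | none => simp
  | some t =>
    cases h2 : parT y x with
    | none => simp
    | some u => exact (parT_self x y t u h1 h2).elim

end build

section verify
variable {N : ℕ} {m : Bool → ℕ} {p : Bool → ℕ → ℕ → ℕ} {K G : Bool → ℕ → Bool} {c : ℕ → ℕ → ℕ}

theorem Cert.wit_spec (C : Cert N m p K G c) : ∀ {x : Nm} {b : Bool} {t s : ℕ}, valid N m p K G c b (.wit x t s) →
    sel m p K G c b t < m b ∧ G b (sel m p K G c b t) = true ∧ acc m p K c b (sel m p K G c b t) t := by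
  intro x
  induction x with
  | ini i =>
    rintro b t s ⟨h1, h2, h3, h4⟩
    have h1 : i < m (!b) := h1
    have h2 : K (!b) i = false := h2
    have h4 : s < p (!b) i t - cnt m c (!b) i t := h4
    have := C.c6 (!b) i h1 h2 t h3 (by omega)
    rw [Bool.not_not] at this
    exact sel_spec m p K G c this
  | wit z t0 s0 ih =>
    rintro b t s ⟨h1, h2, h3, h4⟩
    have h4 : s < p (!b) (sel m p K G c (!b) t0) t - ((if t0 = t then 1 else 0) +
      kcnt m K c (!b) (sel m p K G c (!b) t0) t) := h4
    obtain ⟨h5, h6, h7⟩ := ih h1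
    have := C.c7 (!b) _ h5 h6 t h3 (by omega)
    rw [Bool.not_not] at this
    exact sel_spec m p K G c this

theorem Cert.rep_lt (C : Cert N m p K G c) {b : Bool} {x : Nm} (h : valid N m p K G c b x) : rep m p K G c b x < m b := by
  cases x with
  | ini i => exact h
  | wit z t s => exact (C.wit_spec h).1

theorem Cert.rep_kg (C : Cert N m p K G c) {b : Bool} {x : Nm} (h : valid N m p K G c b x) :
    K b (rep m p K G c b x) = kg K b x := by
  cases x with
  | ini i => rfl
  | wit z t s => exact C.c8 b _ (C.wit_spec h).1 (C.wit_spec h).2.1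

theorem Cert.gn_spec (C : Cert N m p K G c) {b : Bool} {i j : ℕ} (hi : i < m b) (hi' : K b i = false) (hj : j < m (!b))
    (hj' : K (!b) j = false) : tr (gn N p) b i j < gE N ∧ p b i (tr (gn N p) b i j) = 2 := by
  cases b with
  | true =>
    have h := C.c5 i hi hi' j hj hj'
    simp only [tr, if_true, gn, dif_pos h]
    exact ⟨h.choose_spec.1, h.choose_spec.2.1⟩
  | false =>
    have h := C.c5 j hj hj' i hi hi'
    simp only [tr, Bool.false_eq_true, if_false, gn, dif_pos h]
    exact ⟨h.choose_spec.1, h.choose_spec.2.2⟩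

theorem Cert.cell_lt (C : Cert N m p K G c) {b : Bool} {x y : Nm} (hx : valid N m p K G c b x)
    (hy : valid N m p K G c (!b) y) : cell N m p K G c b x y < gE N := by
  classical
  have hd : dflt N m p K G c b x y < gE N := by
    unfold dflt
    split_ifs with h
    · exact C.lt b _ (C.rep_lt hx) _ (C.rep_lt hy)
    · simp only [Bool.or_eq_true, not_or, Bool.not_eq_true] at h
      refine (C.gn_spec (C.rep_lt hx) ?_ (C.rep_lt hy) ?_).1
      · rw [C.rep_kg hx]; exact h.1.2
      · rw [C.rep_kg hy]; exact h.2
  have hp : ∀ (b : Bool) (x y : Nm) (t : ℕ), valid N m p K G c b y → parT x y = some t → t < gE N := by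
    intro b x y t hy h
    cases y with
    | ini => cases h
    | wit z t' s =>
      simp only [parT] at h
      split_ifs at h
      cases h
      exact hy.2.2.1
  unfold cell
  cases h1 : parT x y with
  | some t => exact hp _ _ _ _ hy h1
  | none =>
    cases h2 : parT y x with
    | some t => exact hp _ _ _ _ hx h2
    | none => exact hd

theorem cell_wit (b : Bool) (x : Nm) (t s : ℕ) : cell N m p K G c b x (.wit x t s) = t := by
  simp [cell, parT]
theorem cell_wit' (b : Bool) (x : Nm) (t s : ℕ) : cell N m p K G c b (.wit x t s) x = t := by
  rw [← cell_not, cell_wit]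
theorem cell_other (b : Bool) (x y : Nm) (h1 : ∀ t s, y ≠ .wit x t s) (h2 : ∀ t s, x ≠ .wit y t s) :
    cell N m p K G c b x y = dflt N m p K G c b x y := by
  have e1 : parT x y = none := by
    cases y with
    | ini => rfl
    | wit z t s =>
      simp only [parT]
      rw [if_neg]
      rintro rfl
      exact h1 t s rfl
  have e2 : parT y x = none := by
    cases x with
    | ini => rfl
    | wit z t s =>
      simp only [parT]
      rw [if_neg]
      rintro rfl
      exact h2 t s rfl
  rw [cell, e1, e2]; rfl

theorem Cert.gen_case (C : Cert N m p K G c) {b : Bool} {x y : Nm} (hx : valid N m p K G c b x)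
    (hy : valid N m p K G c (!b) y) (kx : kg K b x = false) (ky : kg K (!b) y = false)
    (hi : (isI x && isI y) = false)
    (h1 : ∀ t s, y ≠ .wit x t s) (h2 : ∀ t s, x ≠ .wit y t s) :
    p b (rep m p K G c b x) (cell N m p K G c b x y) = 2 := by
  rw [cell_other b x y h1 h2, dflt, if_neg (by simp [kx, ky, hi])]
  refine (C.gn_spec (C.rep_lt hx) ?_ (C.rep_lt hy) ?_).2
  · rw [C.rep_kg hx]; exact kx
  · rw [C.rep_kg hy]; exact ky

theorem inj_ini : Function.Injective Nm.ini := fun _ _ h => by cases h; rfl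
theorem inj_wit (x : Nm) (t : ℕ) : Function.Injective (Nm.wit x t) := fun _ _ h => by cases h; rfl

theorem Cert.cap_eq (C : Cert N m p K G c) {b : Bool} {x : Nm} (hx : valid N m p K G c b x) {t : ℕ} (ht : t < gE N) :
    cap {y | valid N m p K G c (!b) y ∧ cell N m p K G c b x y = t} = p b (rep m p K G c b x) t := by
  classical
  have hle := C.ple b _ (C.rep_lt hx) t ht
  cases x with
  | ini i =>
    have hi : i < m b := hx
    have hle : p b i t ≤ 2 := hle
    have hcell : ∀ j, cell N m p K G c b (.ini i) (.ini j) = tr c b i j := by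
      intro j
      rw [cell_other _ _ _ (by simp) (by simp)]; rfl
    let s1 : Finset Nm := ((Finset.range (m (!b))).filter fun j => tr c b i j = t).image Nm.ini
    have hs1 : s1.card = cnt m c b i t := Finset.card_image_of_injective _ inj_ini
    have hm1 : ∀ y ∈ s1, valid N m p K G c (!b) y ∧ cell N m p K G c b (.ini i) y = t := by
      intro y hy
      obtain ⟨j, hj, rfl⟩ := Finset.mem_image.1 hy
      rw [Finset.mem_filter, Finset.mem_range] at hj
      exact ⟨hj.1, (hcell j).trans hj.2⟩
    have hm1' : ∀ j, valid N m p K G c (!b) (.ini j) ∧ cell N m p K G c b (.ini i) (.ini j) = t → Nm.ini j ∈ s1 := by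
      rintro j ⟨h1, h2⟩
      rw [hcell] at h2
      exact Finset.mem_image_of_mem _ (Finset.mem_filter.2 ⟨Finset.mem_range.2 h1, h2⟩)
    cases hK : K b i with
    | true =>
      show cap _ = p b i t
      refine cap_of s1 hm1 hle ?_ ?_
      · rw [hs1]; exact C.c3 b i hi hK t ht
      · intro hlt
        refine ⟨?_, by rw [hs1]; exact C.c2 b i hi t ht hlt⟩
        rintro y ⟨hy, hc⟩
        cases y with
        | ini j => exact hm1' j ⟨hy, hc⟩
        | wit z t' s =>
          exfalso
          rw [cell_other] at hc
          · rw [dflt, if_pos (by simp [kg, hK])] at hc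
            have h4 := C.c4 b i hi hK _ (C.wit_spec hy).1 (C.wit_spec hy).2.1
            have hc : tr c b i (sel m p K G c (!b) t') = t := hc
            rw [hc] at h4; omega
          · rintro t'' s'' h
            cases h
            have h5 : kg K (!!b) (.ini i) = false := hy.2.1
            rw [Bool.not_not] at h5
            have h5 : K b i = false := h5
            rw [hK] at h5; cases h5
          · intro _ _ h; cases h
    | false =>
      let nd := need m p K G c b (.ini i) t
      have hnd : nd = p b i t - cnt m c b i t := rfl
      let s2 : Finset Nm := (Finset.range nd).image (Nm.wit (.ini i) t)
      have hs2 : s2.card = nd := by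
        rw [Finset.card_image_of_injective _ (inj_wit _ _), Finset.card_range]
      have hdis : Disjoint s1 s2 := by
        rw [Finset.disjoint_left]
        intro y h1 h2
        obtain ⟨j, _, rfl⟩ := Finset.mem_image.1 h1
        obtain ⟨s, _, h⟩ := Finset.mem_image.1 h2
        cases h
      have hcard : (s1 ∪ s2).card = cnt m c b i t + nd := by
        rw [Finset.card_union_of_disjoint hdis, hs1, hs2]
      show cap _ = p b i t
      refine cap_of (s1 ∪ s2) ?_ hle ?_ ?_
      · intro y hy
        rcases Finset.mem_union.1 hy with hy | hy
        · exact hm1 y hy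
        · obtain ⟨s, hs, rfl⟩ := Finset.mem_image.1 hy
          refine ⟨⟨?_, ?_, ht, ?_⟩, cell_wit _ _ _ _⟩
          · rw [Bool.not_not]; exact hx
          · rw [Bool.not_not]; exact hK
          · rw [Bool.not_not]; exact Finset.mem_range.1 hs
      · omega
      · intro hlt
        have := C.c2 b i hi t ht hlt
        refine ⟨?_, by omega⟩
        rintro y ⟨hy, hc⟩
        rw [Finset.mem_union]
        cases y with
        | ini j => exact Or.inl (hm1' j ⟨hy, hc⟩)
        | wit z t' s =>
          by_cases hz : z = .ini i
          · subst hz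
            rw [cell_wit] at hc
            subst hc
            right
            refine Finset.mem_image_of_mem _ (Finset.mem_range.2 ?_)
            have := hy.2.2.2
            rw [Bool.not_not] at this; exact this
          · exfalso
            have h4 := C.gen_case hx hy hK rfl rfl (by rintro _ _ h; cases h; exact hz rfl) (by rintro _ _ h; cases h)
            rw [hc] at h4
            have h4 : p b i t = 2 := h4
            omega
  | wit z t0 s0 =>
    obtain ⟨w1, w2, w3⟩ := C.wit_spec hx
    set l := sel m p K G c b t0 with hl
    have hle : p b l t ≤ 2 := hle
    have hz : valid N m p K G c (!b) z := hx.1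
    have hzk : kg K (!b) z = false := hx.2.1
    let s0' : Finset Nm := if t0 = t then {z} else ∅
    let s1 : Finset Nm := ((Finset.range (m (!b))).filter fun j => K (!b) j = true ∧ tr c b l j = t).image Nm.ini
    let nd := need m p K G c b (.wit z t0 s0) t
    have hnd : nd = p b l t - ((if t0 = t then 1 else 0) + kcnt m K c b l t) := rfl
    let s2 : Finset Nm := (Finset.range nd).image (Nm.wit (.wit z t0 s0) t)
    have hs0 : s0'.card = if t0 = t then 1 else 0 := by
      simp only [s0']; split_ifs <;> simp
    have hs1 : s1.card = kcnt m K c b l t := Finset.card_image_of_injective _ inj_ini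
    have hs2 : s2.card = nd := by
      rw [Finset.card_image_of_injective _ (inj_wit _ _), Finset.card_range]
    have hms0 : ∀ y, y ∈ s0' ↔ t0 = t ∧ y = z := by
      intro y; simp only [s0']; split_ifs with h <;> simp [h]
    have hms1 : ∀ y, y ∈ s1 ↔ ∃ j, j < m (!b) ∧ K (!b) j = true ∧ tr c b l j = t ∧ y = .ini j := by
      intro y
      simp only [s1, Finset.mem_image, Finset.mem_filter, Finset.mem_range]
      constructor
      · rintro ⟨j, ⟨h1, h2, h3⟩, rfl⟩; exact ⟨j, h1, h2, h3, rfl⟩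
      · rintro ⟨j, h1, h2, h3, rfl⟩; exact ⟨j, ⟨h1, h2, h3⟩, rfl⟩
    have hms2 : ∀ y, y ∈ s2 ↔ ∃ s < nd, y = .wit (.wit z t0 s0) t s := by
      intro y
      simp only [s2, Finset.mem_image, Finset.mem_range]
      constructor
      · rintro ⟨j, h1, rfl⟩; exact ⟨j, h1, rfl⟩
      · rintro ⟨j, h1, rfl⟩; exact ⟨j, h1, rfl⟩
    have hd1 : Disjoint s0' s1 := by
      rw [Finset.disjoint_left]
      intro y h1 h2
      obtain ⟨_, rfl⟩ := (hms0 y).1 h1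
      obtain ⟨j, _, h3, _, rfl⟩ := (hms1 y).1 h2
      have hzk : K (!b) j = false := hzk
      rw [hzk] at h3; cases h3
    have hd2 : Disjoint (s0' ∪ s1) s2 := by
      rw [Finset.disjoint_left]
      intro y h1 h2
      obtain ⟨s, _, rfl⟩ := (hms2 y).1 h2
      rcases Finset.mem_union.1 h1 with h1 | h1
      · have := ((hms0 _).1 h1).2
        have := congrArg sizeOf this
        simp at this
        omega
      · obtain ⟨_, _, _, _, h⟩ := (hms1 _).1 h1
        cases h
    have hcard : (s0' ∪ s1 ∪ s2).card = (if t0 = t then 1 else 0) + kcnt m K c b l t + nd := by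
      rw [Finset.card_union_of_disjoint hd2, Finset.card_union_of_disjoint hd1, hs0, hs1, hs2]
    have hking : ∀ j, K (!b) j = true → cell N m p K G c b (.wit z t0 s0) (.ini j) = tr c b l j := by
      intro j hj
      rw [cell_other, dflt, if_pos (by simp [kg, hj])]
      · rfl
      · intro _ _ h; cases h
      · intro _ _ h; cases h
        have hzk : K (!b) j = false := hzk
        rw [hzk] at hj; cases hj
    have hkc : kcnt m K c b l t ≤ cnt m c b l t := by
      refine Finset.card_le_card fun j hj => ?_
      rw [Finset.mem_filter] at hj ⊢
      exact ⟨hj.1, hj.2.2⟩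
    show cap _ = p b l t
    refine cap_of (s0' ∪ s1 ∪ s2) ?_ hle (by omega) ?_
    · intro y hy
      rcases Finset.mem_union.1 hy with hy | hy
      · rcases Finset.mem_union.1 hy with hy | hy
        · obtain ⟨rfl, rfl⟩ := (hms0 y).1 hy
          exact ⟨hz, cell_wit' _ _ _ _⟩
        · obtain ⟨j, h1, h2, h3, rfl⟩ := (hms1 y).1 hy
          exact ⟨h1, (hking j h2).trans h3⟩
      · obtain ⟨s, hs, rfl⟩ := (hms2 y).1 hy
        refine ⟨⟨?_, rfl, ht, ?_⟩, cell_wit _ _ _ _⟩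
        · rw [Bool.not_not]; exact hx
        · rw [Bool.not_not]; exact hs
    · intro hlt
      constructor
      · rintro y ⟨hy, hc⟩
        rw [Finset.mem_union, Finset.mem_union, hms0, hms1, hms2]
        by_cases e1 : y = z
        · subst e1
          rw [cell_wit'] at hc
          exact Or.inl (Or.inl ⟨hc, rfl⟩)
        cases hk : kg K (!b) y with
        | true =>
          cases y with
          | wit => cases hk
          | ini j =>
            have hk : K (!b) j = true := hk
            rw [hking j hk] at hc
            exact Or.inl (Or.inr ⟨j, hy, hk, hc, rfl⟩)
        | false =>
          by_cases e2 : ∃ t' s, y = .wit (.wit z t0 s0) t' s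
          · obtain ⟨t', s, rfl⟩ := e2
            rw [cell_wit] at hc
            subst hc
            right
            have := hy.2.2.2
            rw [Bool.not_not] at this
            exact ⟨s, this, rfl⟩
          · exfalso
            have h4 := C.gen_case hx hy rfl hk rfl (fun t s h => e2 ⟨t, s, h⟩) (by rintro _ _ h; cases h; exact e1 rfl)
            rw [hc] at h4
            have h4 : p b l t = 2 := h4
            omega
      · have h5 := C.c2 b l w1 t ht hlt
        have : (if t0 = t then 1 else 0) + kcnt m K c b l t ≤ p b l t := by
          split_ifs with e
          · subst e
            rcases w3 with w3 | ⟨w3, w4⟩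
            · omega
            · omega
          · omega
        omega

theorem Cert.gsat (C : Cert N m p K G c) : GSat N := by
  refine ⟨{x // valid N m p K G c true x}, {y // valid N m p K G c false y}, fun x y => cell N m p K G c true x.1 y.1, ?_, ?_, ?_, ?_⟩
  · intro x y
    exact C.cell_lt x.2 y.2
  · intro x
    have h := C.side true _ (C.rep_lt x.2)
    refine SideP.congr (b := true) (fun t ht => ?_) h
    rw [← C.cap_eq x.2 ht]
    exact (cap_subtype (fun y => valid N m p K G c false y) (fun y => cell N m p K G c true x.1 y = t)).symm
  · intro y
    have h := C.side false _ (C.rep_lt y.2)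
    refine SideP.congr (b := false) (fun t ht => ?_) h
    rw [← C.cap_eq y.2 ht]
    refine (cap_subtype (fun x => valid N m p K G c true x) (fun x => cell N m p K G c false y.1 x = t)).symm.trans ?_
    congr 1
    ext x
    show cell N m p K G c (!true) y.1 x.1 = t ↔ _
    rw [cell_not]; rfl
  · obtain ⟨i, hi, j, hj, h⟩ := C.tgt
    refine ⟨⟨.ini i, hi⟩, ⟨.ini j, hj⟩, ?_⟩
    have : cell N m p K G c true (.ini i) (.ini j) = c i j := by
      rw [cell_other _ _ _ (by simp) (by simp)]; rfl
    show ¬ fb (cell N m p K G c true (.ini i) (.ini j) / 2) N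
    rw [this]; exact h
end verify
end OneVarEq

namespace OneVarEq
open Function

/-! ### certificates from grids -/
theorem fin_small {A K : Type} (k : A → K) (h : (Set.range k).Finite) : {a | {a' | k a' = k a}.Finite}.Finite := by
  have : {a | {a' | k a' = k a}.Finite} ⊆ ⋃ κ ∈ {κ | κ ∈ Set.range k ∧ {a' | k a' = κ}.Finite}, {a' | k a' = κ} := by
    intro a ha
    simp only [Set.mem_iUnion]
    exact ⟨k a, ⟨⟨a, rfl⟩, ha⟩, rfl⟩
  refine Set.Finite.subset (Set.Finite.biUnion (h.subset fun κ hκ => hκ.1) fun κ hκ => hκ.2) this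

theorem exists_cap {A : Type} (S : Set A) : ∃ s : Finset A, (∀ a ∈ s, a ∈ S) ∧ cap S ≤ s.card := by
  classical
  by_cases h : S.Subsingleton
  · by_cases h' : S = ∅
    · exact ⟨∅, by simp, by simp [cap_eq_zero.2 h']⟩
    · obtain ⟨a, ha⟩ := Set.nonempty_iff_ne_empty.2 h'
      exact ⟨{a}, by simpa using ha, by simpa using cap_le_one.2 h⟩
  · obtain ⟨a, ha, b, hb, hab⟩ := Set.not_subsingleton_iff.1 h
    refine ⟨{a, b}, ?_, ?_⟩
    · intro x hx
      rcases Finset.mem_insert.1 hx with rfl | hx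
      · exact ha
      · rw [Finset.mem_singleton.1 hx]; exact hb
    · rw [Finset.card_pair hab]; exact cap_le_two S

theorem card_le_cap {A : Type} {S : Set A} (h : cap S < 2) (s : Finset A) (hs : ∀ a ∈ s, a ∈ S) : s.card ≤ cap S := by
  by_cases h0 : cap S = 0
  · have : s = ∅ := by
      rw [Finset.eq_empty_iff_forall_notMem]
      intro a ha
      have := hs a ha
      rw [cap_eq_zero.1 h0] at this
      exact this
    simp [this]
  · have h1 : cap S = 1 := by omega
    rw [h1, Finset.card_le_one]
    intro a ha b hb
    exact cap_le_one.1 h1.le (hs a ha) (hs b hb)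

section half
variable {A B : Type} (g : A → B → ℕ)

noncomputable def prof (a : A) (t : ℕ) : ℕ := cap {b | g a b = t}
def King (a : A) : Prop := {a' | prof g a' = prof g a}.Finite
noncomputable def key (a : A) : (ℕ → ℕ) × ({b // King (flip g) b} → ℕ) := (prof g a, fun b => g a b.1)
def Exc (a : A) : Prop := {a' | key g a' = key g a}.Finite

variable {g} {E : ℕ}

theorem range_prof (hg : ∀ a b, g a b < E) : (Set.range (prof g)).Finite := by
  refine (Set.finite_range (fun (r : Fin E → Fin 3) (t : ℕ) => if h : t < E then (r ⟨t, h⟩ : ℕ) else 0)).subset ?_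
  rintro _ ⟨a, rfl⟩
  refine ⟨fun t => ⟨prof g a t, Nat.lt_succ_of_le (cap_le_two _)⟩, ?_⟩
  funext t
  by_cases h : t < E
  · simp [h]
  · simp only [h, dif_neg, not_false_eq_true]
    symm
    rw [prof, cap_eq_zero, Set.eq_empty_iff_forall_notMem]
    intro b hb
    exact h (hb ▸ hg a b)

theorem king_finite (hg : ∀ a b, g a b < E) : {a | King g a}.Finite := fin_small _ (range_prof hg)

theorem range_key (hg : ∀ a b, g a b < E) : (Set.range (key g)).Finite := by
  have h1 := range_prof hg
  have hk : Finite {b // King (flip g) b} := king_finite (g := flip g) (E := E) fun b a => hg a b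
  have h2 : (Set.range (fun (r : {b // King (flip g) b} → Fin E) b => (r b : ℕ))).Finite := Set.finite_range _
  refine (h1.prod h2).subset ?_
  rintro _ ⟨a, rfl⟩
  exact ⟨⟨a, rfl⟩, ⟨fun b => ⟨g a b.1, hg _ _⟩, rfl⟩⟩

theorem exc_finite (hg : ∀ a b, g a b < E) : {a | Exc g a}.Finite := fin_small _ (range_key hg)

theorem King.exc {a : A} (h : King g a) : Exc g a := by
  refine Set.Finite.subset h fun a' ha' => ?_
  exact congrArg Prod.fst ha'

theorem key_prof {a a' : A} (h : key g a = key g a') : prof g a = prof g a' := congrArg Prod.fst h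
theorem key_king {a a' : A} (h : key g a = key g a') {b : B} (hb : King (flip g) b) : g a b = g a' b :=
  congrFun (congrArg Prod.snd h) ⟨b, hb⟩

theorem exists_A0 (hg : ∀ a b, g a b < E) (a0 : A) : ∃ A0 GA : Finset A, (∀ a, Exc g a → a ∈ A0) ∧
    (∀ c ∈ GA, c ∈ A0 ∧ ¬ Exc g c) ∧ (∀ a, ¬ Exc g a → ∃ c ∈ GA, key g c = key g a) ∧
    (∀ b, King (flip g) b → ∀ t < E, ∃ s : Finset A, (∀ a ∈ s, a ∈ A0 ∧ g a b = t) ∧ prof (flip g) b t ≤ s.card) ∧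
    a0 ∈ A0 := by
  classical
  obtain ⟨G', hG1, hG2⟩ := Set.exists_subset_bijOn {a | ¬ Exc g a} (key g)
  have hGf : G'.Finite := by
    refine Set.Finite.of_finite_image ?_ hG2.injOn
    exact (range_key hg).subset (Set.image_subset_range _ _)
  choose ws hws1 hws2 using fun (b : B) (t : ℕ) => exists_cap {a | g a b = t}
  have hk : {b | King (flip g) b}.Finite := king_finite (g := flip g) (E := E) fun b a => hg a b
  let Wt : Finset A := hk.toFinset.biUnion fun b => (Finset.range E).biUnion fun t => ws b t
  refine ⟨(exc_finite hg).toFinset ∪ hGf.toFinset ∪ Wt ∪ {a0}, hGf.toFinset, ?_, ?_, ?_, ?_, ?_⟩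
  · intro a ha
    have : a ∈ (exc_finite hg).toFinset := by rw [Set.Finite.mem_toFinset]; exact ha
    simp only [Finset.mem_union]; tauto
  · intro c hc
    refine ⟨?_, hG1 ((Set.Finite.mem_toFinset _).1 hc)⟩
    simp only [Finset.mem_union]; tauto
  · intro a ha
    obtain ⟨c, hc, he⟩ := hG2.surjOn ⟨a, ha, rfl⟩
    exact ⟨c, (Set.Finite.mem_toFinset _).2 hc, he⟩
  · intro b hb t ht
    refine ⟨ws b t, fun a ha => ⟨?_, hws1 b t a ha⟩, hws2 b t⟩
    have : a ∈ Wt := Finset.mem_biUnion.2 ⟨b, (Set.Finite.mem_toFinset _).2 hb, Finset.mem_biUnion.2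
      ⟨t, Finset.mem_range.2 ht, ha⟩⟩
    simp only [Finset.mem_union]; tauto
  · simp

/-- acceptance -/
def Acc (g : A → B → ℕ) (b : B) (t : ℕ) : Prop :=
  prof (flip g) b t = 2 ∨ (prof (flip g) b t = 1 ∧ ∀ a, King g a → g a b ≠ t)

theorem acc_of {a : A} {d c : B} {t : ℕ} (ha : ¬ King g a) (hd : g a d = t) (hc : key (flip g) c = key (flip g) d) :
    Acc g c t := by
  have h1 : prof (flip g) d t ≠ 0 := cap_ne_zero.2 ⟨a, hd⟩
  have h2 : prof (flip g) d t ≤ 2 := cap_le_two _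
  unfold Acc
  rw [key_prof hc]
  by_cases h3 : prof (flip g) d t = 2
  · exact Or.inl h3
  · refine Or.inr ⟨by omega, fun a' ha' he => ?_⟩
    have h4 : g a' d = t := by
      have := key_king hc (b := a') ha'
      exact this.symm.trans he
    have : a' = a := cap_le_one.1 (show cap {a | flip g d a = t} ≤ 1 by
      have : cap {a | flip g d a = t} = prof (flip g) d t := rfl
      omega) h4 hd
    exact ha (this ▸ ha')

theorem half_c4 {a : A} (ha : King g a) {c : B} (hc : ¬ Exc (flip g) c) : prof g a (g a c) = 2 := by
  refine cap_eq_two.2 fun hs => hc ?_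
  refine hs.finite.subset fun c' hc' => ?_
  exact key_king (g := flip g) hc' (b := a) ha

theorem half_c5 (hg : ∀ a b, g a b < E) {a : A} (ha : ¬ King g a) {b : B} (hb : ¬ King (flip g) b) :
    ∃ t < E, prof g a t = 2 ∧ prof (flip g) b t = 2 := by
  classical
  by_contra hcon
  push Not at hcon
  obtain ⟨R, hR1, hR2⟩ := Set.Infinite.exists_subset_card_eq ha (E+1)
  let bad : Set B := ⋃ r ∈ R, ⋃ t ∈ (Finset.range E).filter (fun t => prof g a t ≤ 1), {b' | g r b' = t}
  have hbad : bad.Finite := by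
    refine Set.Finite.biUnion R.finite_toSet fun r hr => Set.Finite.biUnion (Finset.finite_toSet _) fun t ht => ?_
    have h1 : prof g r t ≤ 1 := by
      rw [show prof g r = prof g a from hR1 hr]
      exact (Finset.mem_filter.1 ht).2
    exact (cap_le_one.1 h1).finite
  obtain ⟨q, hq, hqb⟩ := (Set.Infinite.sdiff hb hbad).nonempty
  have hq : prof (flip g) q = prof (flip g) b := hq
  obtain ⟨r, hr, r', hr', hne, he⟩ := Finset.exists_ne_map_eq_of_card_lt_of_maps_to (s := R) (t := Finset.range E)
    (f := fun r => g r q) (by rw [hR2]; simp) (fun r _ => Finset.mem_coe.2 (Finset.mem_range.2 (hg r q)))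
  have h1 : ¬ prof g a (g r q) ≤ 1 := by
    intro h
    apply hqb
    simp only [bad, Set.mem_iUnion]
    exact ⟨r, hr, g r q, Finset.mem_filter.2 ⟨Finset.mem_range.2 (hg r q), h⟩, rfl⟩
  have h2 : prof g a (g r q) ≤ 2 := cap_le_two _
  have h3 := hcon _ (hg r q) (by omega)
  rw [← hq] at h3
  refine h3 (cap_eq_two.2 fun hs => hne (hs rfl he.symm))

theorem half_c7 {l : A} (hl : ¬ Exc g l) {t : ℕ} {GB : Finset B}
    (hGB : ∀ b, ¬ Exc (flip g) b → ∃ c ∈ GB, key (flip g) c = key (flip g) b) (hfin : {b | Exc (flip g) b}.Finite)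
    (h : ∀ s : Finset B, (∀ b, b ∈ s ↔ King (flip g) b ∧ g l b = t) → s.card < prof g l t)
    (hk : {b | King (flip g) b}.Finite) :
    ∃ c ∈ GB, Acc g c t := by
  classical
  have hlk : ∀ l', key g l' = key g l → ¬ King g l' := by
    intro l' h1 h2
    have := h2.exc
    unfold Exc at this
    rw [h1] at this
    exact hl this
  have hd : ∀ l', key g l' = key g l → ∃ d, ¬ King (flip g) d ∧ g l' d = t := by
    intro l' hl'
    by_contra hcon
    push Not at hcon
    have hsub : {b | g l' b = t} ⊆ {b | King (flip g) b} := fun b hb => by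
      by_contra h; exact hcon b h hb
    have hf := hk.subset hsub
    have h2 := h hf.toFinset (by
      intro b
      rw [Set.Finite.mem_toFinset]
      constructor
      · intro hb
        exact ⟨hsub hb, (key_king hl' (hsub hb)).symm.trans hb⟩
      · rintro ⟨h3, h4⟩
        exact (key_king hl' h3).trans h4)
    rw [← key_prof hl'] at h2
    have h4 : prof g l' t = cap {b | g l' b = t} := rfl
    obtain ⟨s, hs1, hs2⟩ := exists_cap {b | g l' b = t}
    have h5 : s.card ≤ hf.toFinset.card := Finset.card_le_card fun b hb => (Set.Finite.mem_toFinset _).2 (hs1 b hb)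
    omega
  have : Nonempty B := ⟨(hd l rfl).choose⟩
  choose! d hd1 hd2 using hd
  by_cases hex : ∃ l', key g l' = key g l ∧ ¬ Exc (flip g) (d l')
  · obtain ⟨l', h1, h2⟩ := hex
    obtain ⟨c, hc, hc'⟩ := hGB _ h2
    exact ⟨c, hc, acc_of (hlk l' h1) (hd2 l' h1) hc'⟩
  · push Not at hex
    have hl : ({l' | key g l' = key g l} : Set A).Infinite := hl
    obtain ⟨l1, h1, l2, h2, hne, he⟩ := hl.exists_ne_map_eq_of_mapsTo (f := d) (t := {b | Exc (flip g) b})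
      (fun l' hl' => hex l' hl') hfin
    have h3 : prof (flip g) (d l1) t = 2 := by
      refine cap_eq_two.2 fun hs => hne (hs (hd2 l1 h1) ?_)
      show g l2 (d l1) = t
      rw [he]; exact hd2 l2 h2
    have h4 : ({b | prof (flip g) b = prof (flip g) (d l1)} : Set B).Infinite := hd1 l1 h1
    obtain ⟨b, hb1, hb2⟩ := (h4.sdiff hfin).nonempty
    obtain ⟨c, hc, hc'⟩ := hGB b hb2
    refine ⟨c, hc, Or.inl ?_⟩
    rw [key_prof hc', show prof (flip g) b = prof (flip g) (d l1) from hb1, h3]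
end half

theorem exists_enum {A : Type} (s : Finset A) (a0 : A) : ∃ e : ℕ → A, (∀ i < s.card, e i ∈ s) ∧
    (∀ a ∈ s, ∃ i < s.card, e i = a) ∧ (∀ i < s.card, ∀ j < s.card, e i = e j → i = j) := by
  classical
  refine ⟨fun i => if h : i < s.card then (s.equivFin.symm ⟨i, h⟩ : A) else a0, ?_, ?_, ?_⟩
  · intro i hi; simp only [hi, dif_pos]; exact Subtype.prop _
  · intro a ha
    refine ⟨s.equivFin ⟨a, ha⟩, (s.equivFin ⟨a, ha⟩).2, ?_⟩
    simp
  · intro i hi j hj h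
    simp only [hi, hj, dif_pos] at h
    have := s.equivFin.symm.injective (Subtype.ext h)
    simpa using this

section idx
variable {A B : Type} {g : A → B → ℕ} {E : ℕ}

/-- one side of the certificate, at the level of indices -/
structure Half (E : ℕ) (g : A → B → ℕ) (m m' : ℕ) (e : ℕ → A) (e' : ℕ → B) (K K' G G' : ℕ → Bool) : Prop where
  c2 : ∀ i < m, ∀ t < E, prof g (e i) t < 2 → ((Finset.range m').filter fun j => g (e i) (e' j) = t).card ≤ prof g (e i) t
  c3 : ∀ i < m, K i = true → ∀ t < E, prof g (e i) t ≤ ((Finset.range m').filter fun j => g (e i) (e' j) = t).card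
  c4 : ∀ i < m, K i = true → ∀ j < m', G' j = true → prof g (e i) (g (e i) (e' j)) = 2
  c6 : ∀ i < m, K i = false → ∀ t < E, ((Finset.range m').filter fun j => g (e i) (e' j) = t).card < prof g (e i) t →
    ∃ j < m', G' j = true ∧ (prof (flip g) (e' j) t = 2 ∨ (prof (flip g) (e' j) t = 1 ∧
      ((Finset.range m).filter fun i => K i = true ∧ g (e i) (e' j) = t).card = 0))
  c7 : ∀ i < m, G i = true → ∀ t < E,
    ((Finset.range m').filter fun j => K' j = true ∧ g (e i) (e' j) = t).card < prof g (e i) t →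
    ∃ j < m', G' j = true ∧ (prof (flip g) (e' j) t = 2 ∨ (prof (flip g) (e' j) t = 1 ∧
      ((Finset.range m).filter fun i => K i = true ∧ g (e i) (e' j) = t).card = 0))
  c8 : ∀ i < m, G i = true → K i = false

theorem half_of {A0 GA : Finset A} {B0 GB : Finset B} (hg : ∀ a b, g a b < E)
    (hG : ∀ c ∈ GA, c ∈ A0 ∧ ¬ Exc g c) 
    (hB1 : ∀ b, Exc (flip g) b → b ∈ B0) (hB2 : ∀ c ∈ GB, c ∈ B0 ∧ ¬ Exc (flip g) c)
    (hB3 : ∀ b, ¬ Exc (flip g) b → ∃ c ∈ GB, key (flip g) c = key (flip g) b)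
    (hB4 : ∀ a, King g a → ∀ t < E, ∃ s : Finset B, (∀ b ∈ s, b ∈ B0 ∧ g a b = t) ∧ prof g a t ≤ s.card)
    {e : ℕ → A} {e' : ℕ → B} {K K' G G' : ℕ → Bool}
    (he1 : ∀ i < A0.card, e i ∈ A0)
    (he'1 : ∀ i < B0.card, e' i ∈ B0) (he'2 : ∀ b ∈ B0, ∃ i < B0.card, e' i = b)
    (he'3 : ∀ i < B0.card, ∀ j < B0.card, e' i = e' j → i = j)
    (hK : ∀ i, K i = true ↔ King g (e i)) (hK' : ∀ i, K' i = true ↔ King (flip g) (e' i))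
    (hGi : ∀ i, G i = true ↔ e i ∈ GA) (hGi' : ∀ i, G' i = true ↔ e' i ∈ GB) :
    Half E g A0.card B0.card e e' K K' G G' := by
  classical
  have himg : ∀ (P : B → Prop) (Q : ℕ → Prop) [DecidablePred Q], (∀ i < B0.card, (Q i ↔ P (e' i))) →
      ∃ s : Finset B, (∀ b, b ∈ s ↔ b ∈ B0 ∧ P b) ∧ s.card = ((Finset.range B0.card).filter Q).card := by
    intro P Q _ h
    refine ⟨B0.filter P, fun b => Finset.mem_filter, ?_⟩
    symm
    refine Finset.card_bij (fun i _ => e' i) ?_ ?_ ?_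
    · intro i hi
      rw [Finset.mem_filter, Finset.mem_range] at hi
      exact Finset.mem_filter.2 ⟨he'1 i hi.1, (h i hi.1).1 hi.2⟩
    · intro i hi j hj hij
      rw [Finset.mem_filter, Finset.mem_range] at hi hj
      exact he'3 i hi.1 j hj.1 hij
    · intro b hb
      rw [Finset.mem_filter] at hb
      obtain ⟨i, hi, rfl⟩ := he'2 b hb.1
      exact ⟨i, Finset.mem_filter.2 ⟨Finset.mem_range.2 hi, (h i hi).2 hb.2⟩, rfl⟩
  have hGK : ∀ i < A0.card, G i = true → ¬ Exc g (e i) := fun i hi h => (hG _ ((hGi i).1 h)).2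
  have hacc : ∀ t, (∃ c ∈ GB, Acc g c t) → ∃ j < B0.card, G' j = true ∧ (prof (flip g) (e' j) t = 2 ∨ (prof (flip g) (e' j) t = 1 ∧
      ((Finset.range A0.card).filter fun i => K i = true ∧ g (e i) (e' j) = t).card = 0)) := by
    rintro t ⟨c, hc, ha⟩
    obtain ⟨j, hj, rfl⟩ := he'2 c (hB2 c hc).1
    refine ⟨j, hj, (hGi' j).2 hc, ?_⟩
    rcases ha with ha | ⟨ha, ha'⟩
    · exact Or.inl ha
    · refine Or.inr ⟨ha, ?_⟩
      rw [Finset.card_eq_zero, Finset.filter_eq_empty_iff]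
      rintro i _ ⟨h1, h2⟩
      exact ha' _ ((hK i).1 h1) h2
  refine ⟨?_, ?_, ?_, ?_, ?_, ?_⟩
  · intro i hi t ht h
    obtain ⟨s, hs1, hs2⟩ := himg (fun b => g (e i) b = t) (fun j => g (e i) (e' j) = t) (fun _ _ => Iff.rfl)
    rw [← hs2]
    exact card_le_cap h s fun b hb => ((hs1 b).1 hb).2
  · intro i hi hk t ht
    obtain ⟨s, hs1, hs2⟩ := himg (fun b => g (e i) b = t) (fun j => g (e i) (e' j) = t) (fun _ _ => Iff.rfl)
    rw [← hs2]
    obtain ⟨s', h1, h2⟩ := hB4 _ ((hK i).1 hk) t ht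
    exact h2.trans (Finset.card_le_card fun b hb => (hs1 b).2 (h1 b hb))
  · intro i hi hk j hj hG'
    exact half_c4 ((hK i).1 hk) (hB2 _ ((hGi' j).1 hG')).2
  · intro i hi hk t ht h
    obtain ⟨s, hs1, hs2⟩ := himg (fun b => g (e i) b = t) (fun j => g (e i) (e' j) = t) (fun _ _ => Iff.rfl)
    rw [← hs2] at h
    have hk : ¬ King g (e i) := fun h' => by rw [(hK i).2 h'] at hk; cases hk
    have : ∃ d, d ∉ B0 ∧ g (e i) d = t := by
      by_contra hcon
      push Not at hcon
      obtain ⟨s', h1, h2⟩ := exists_cap {b | g (e i) b = t}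
      have h3 : s'.card ≤ s.card := Finset.card_le_card fun b hb => (hs1 b).2
        ⟨by by_contra h'; exact hcon b h' (h1 b hb), h1 b hb⟩
      have h4 : prof g (e i) t = cap {b | g (e i) b = t} := rfl
      omega
    obtain ⟨d, hd, hd'⟩ := this
    obtain ⟨c, hc, hc'⟩ := hB3 d fun h' => hd (hB1 d h')
    exact hacc t ⟨c, hc, acc_of hk hd' hc'⟩
  · intro i hi hGi1 t ht h
    obtain ⟨s, hs1, hs2⟩ := himg (fun b => King (flip g) b ∧ g (e i) b = t) (fun j => K' j = true ∧ g (e i) (e' j) = t)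
      (fun j _ => by rw [hK'])
    rw [← hs2] at h
    refine hacc t (half_c7 (hGK i hi hGi1) hB3 (exc_finite (g := flip g) (E := E) fun b a => hg a b) ?_
      (king_finite (g := flip g) (E := E) fun b a => hg a b))
    intro s' hs'
    have : s' = s := by
      ext b
      rw [hs1, hs']
      exact ⟨fun h => ⟨hB1 b h.1.exc, h⟩, fun h => h.2⟩
    rw [this]; exact h
  · intro i hi hGi1
    have := hGK i hi hGi1
    cases hk : K i with
    | false => rfl
    | true => exact absurd ((hK i).1 hk).exc this
end idx

theorem Grid.cert {N : ℕ} {W D : Type} {f : W → D → ℕ} (H : Grid N W D f) : ∃ m p K G c, Cert N m p K G c := by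
  classical
  obtain ⟨w0, d0, h0⟩ := H.tgt
  have hg' : ∀ d w, flip f d w < gE N := fun d w => H.lt w d
  obtain ⟨A0, GA, hA1, hA2, hA3, hA4, hA5⟩ := exists_A0 H.lt w0
  obtain ⟨B0, GB, hB1, hB2, hB3, hB4, hB5⟩ := exists_A0 hg' d0
  obtain ⟨e, he1, he2, he3⟩ := exists_enum A0 w0
  obtain ⟨e', he'1, he'2, he'3⟩ := exists_enum B0 d0
  let K1 : ℕ → Bool := fun i => decide (King f (e i))
  let K2 : ℕ → Bool := fun i => decide (King (flip f) (e' i))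
  let G1 : ℕ → Bool := fun i => decide (e i ∈ GA)
  let G2 : ℕ → Bool := fun i => decide (e' i ∈ GB)
  have H1 : Half (gE N) f A0.card B0.card e e' K1 K2 G1 G2 := half_of H.lt hA2 hB1 hB2 hB3 hB4 he1 he'1 he'2 he'3
    (fun i => by simp [K1]) (fun i => by simp [K2]) (fun i => by simp [G1]) (fun i => by simp [G2])
  have H2 : Half (gE N) (flip f) B0.card A0.card e' e K2 K1 G2 G1 := half_of hg' hB2 hA1 hA2 hA3 hA4 he'1 he1 he2 he3
    (fun i => by simp [K2]) (fun i => by simp [K1]) (fun i => by simp [G2]) (fun i => by simp [G1])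
  obtain ⟨i0, hi0, hi0'⟩ := he2 _ hA5
  obtain ⟨j0, hj0, hj0'⟩ := he'2 _ hB5
  refine ⟨fun b => cond b A0.card B0.card, fun b i => cond b (prof f (e i)) (prof (flip f) (e' i)),
    fun b => cond b K1 K2, fun b => cond b G1 G2, fun i j => f (e i) (e' j), ?_, ?_, ?_, ?_, ?_, ?_, ?_, ?_, ?_, ?_, ?_⟩
  · intro b i hi
    cases b with
    | true => exact H.row (e i)
    | false => exact H.col (e' i)
  · intro b i hi t ht
    cases b with
    | true => exact cap_le_two _
    | false => exact cap_le_two _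
  · intro b i hi j hj
    cases b with
    | true => exact H.lt _ _
    | false => exact H.lt _ _
  · intro b
    cases b with
    | true => exact H1.c2
    | false => exact H2.c2
  · intro b
    cases b with
    | true => exact H1.c3
    | false => exact H2.c3
  · intro b
    cases b with
    | true => exact H1.c4
    | false => exact H2.c4
  · intro i hi hk j hj hk'
    exact half_c5 H.lt (of_decide_eq_false hk) (of_decide_eq_false hk')
  · intro b
    cases b with
    | true => exact H1.c6
    | false => exact H2.c6
  · intro b
    cases b with
    | true => exact H1.c7
    | false => exact H2.c7
  · intro b
    cases b with
    | true => exact H1.c8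
    | false => exact H2.c8
  · refine ⟨i0, hi0, j0, hj0, ?_⟩
    show ¬ fb (f (e i0) (e' j0) / 2) N
    rw [hi0', hj0']; exact h0

theorem gsat_iff_cert (N : ℕ) : GSat N ↔ ∃ m p K G c, Cert N m p K G c :=
  ⟨fun ⟨_, _, _, H⟩ => H.cert, fun ⟨_, _, _, _, _, C⟩ => C.gsat⟩
end OneVarEq

namespace OneVarEq
open Function

/-! ### certificates are primitive recursive -/
section P
variable {α : Type} [Primcodable α]

theorem pr_idd : Primrec fun a : α => a := Primrec.id
theorem pr_gE {f : α → ℕ} (hf : Primrec f) : Primrec fun a => gE (f a) := by unfold gE; fun_prop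
theorem pr_map {f : α → List ℕ} {g : α → ℕ → ℕ} (hf : Primrec f) (hg : Primrec fun x : α × ℕ => g x.1 x.2) :
    Primrec fun a => (f a).map (g a) := Primrec.list_map hf hg
theorem pr_supp {e : α → ℕ} {p : α → ℕ → ℕ} (he : Primrec e) (hp : Primrec fun x : α × ℕ => p x.1 x.2) :
    Primrec fun a => supp (e a) (p a) := by
  have h : PrimrecPred fun x : α × ℕ => p x.1 x.2 ≠ 0 := PP.ne hp (Primrec.const 0)
  have h2 : Primrec₂ fun (a : α) (t : ℕ) => if p a t ≠ 0 then some t else none :=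
    Primrec.ite h (Primrec.option_some.comp Primrec.snd) (Primrec.const none)
  refine (Primrec.listFilterMap (pr_range he) h2).of_eq fun a => ?_
  unfold supp
  induction List.range (e a) with
  | nil => rfl
  | cons t l ih =>
    by_cases ht : p a t = 0
    · simpa [ht] using ih
    · simpa [ht] using ih

theorem PP_sideP (b : Bool) {N : α → ℕ} {p : α → ℕ → ℕ} (hN : Primrec N) (hp : Primrec fun x : α × ℕ => p x.1 x.2) :
    PP fun a => SideP b (N a) (p a) := by
  have hs : Primrec fun a => supp (gE (N a)) (p a) := pr_supp (pr_gE hN) hp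
  have hdiv : Primrec fun x : α × ℕ => x.2 / 2 := pr_div Primrec.snd (Primrec.const 2)
  cases b with
  | true =>
    refine PP.and (PP_rowL hN (pr_map hs hdiv)) (PP.and ?_ ?_)
    · refine PP.all_mem hs (PP.imp (PP_hascb (hN.comp Primrec.fst) hdiv) (PP.le hp (Primrec.const 1)))
    · refine PP.all_mem hs (PP.all_mem (hs.comp Primrec.fst) (PP.eq ?_ ?_))
      · exact pr_mod (pr_snd Primrec.fst) (Primrec.const 2)
      · exact pr_mod Primrec.snd (Primrec.const 2)
  | false =>
    refine PP.all_mem hs (PP.all_le (hN.comp Primrec.fst) ?_)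
    have hbS : Primrec fun x : (α × ℕ) × ℕ => bS x.2 := by unfold bS; fun_prop
    have h1 : Primrec fun x : (α × ℕ) × ℕ => x.1.2 / 2 := by fun_prop
    have hN' : Primrec fun x : (α × ℕ) × ℕ => N x.1.1 := hN.comp (pr_fst Primrec.fst)
    refine PP.imp (PP.le hbS hN') (PP.iff (PP.fb h1 hbS) (PP.and ?_ (PP.imp (PP.or ?_ ?_) (PP.fb h1 Primrec.snd))))
    · refine PP.all_mem (hs.comp (pr_fst Primrec.fst)) (PP.imp (PP.ne Primrec.snd (pr_snd (pr_fst Primrec.fst))) (PP.fb ?_ (pr_snd Primrec.fst)))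
      exact pr_div Primrec.snd (Primrec.const 2)
    · exact PP.eq (hp.comp Primrec.fst) (Primrec.const 2)
    · exact PP.eq (pr_mod (pr_snd Primrec.fst) (Primrec.const 2)) (Primrec.const 1)
end P

/-- certificate codes: `N`, side data `(m, P, K, G)` for both sides, cell code -/
abbrev CQ : Type := ℕ × (ℕ × ℕ × ℕ × ℕ) × (ℕ × ℕ × ℕ × ℕ) × ℕ
def CQ.sd (x : CQ) (b : Bool) : ℕ × ℕ × ℕ × ℕ := cond b x.2.1 x.2.2.1
def CQ.m (x : CQ) (b : Bool) : ℕ := (x.sd b).1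
def CQ.p (x : CQ) (b : Bool) (i t : ℕ) : ℕ := dg 3 (x.sd b).2.1 (Nat.pair i t)
def CQ.k (x : CQ) (b : Bool) (i : ℕ) : ℕ := dg 2 (x.sd b).2.2.1 i
def CQ.g (x : CQ) (b : Bool) (i : ℕ) : ℕ := dg 2 (x.sd b).2.2.2 i
def CQ.c (x : CQ) (i j : ℕ) : ℕ := dg (gE x.1) x.2.2.2 (Nat.pair i j)
def CQ.t (x : CQ) (b : Bool) (i j : ℕ) : ℕ := tr x.c b i j
def CQ.cn (x : CQ) (b : Bool) (i t : ℕ) : ℕ := ((List.range (x.m (!b))).map fun j => x.t b i j).count t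
def CQ.kc (x : CQ) (b : Bool) (i t : ℕ) : ℕ :=
  ((List.range (x.m (!b))).map fun j => x.k (!b) j * (x.t b i j + 1)).count (t + 1)

def CQ.acc (x : CQ) (b : Bool) (i t : ℕ) : Prop := x.p b i t = 2 ∨ (x.p b i t = 1 ∧ x.kc b i t = 0)

theorem count_map_range (f : ℕ → ℕ) (n t : ℕ) (P : ℕ → Prop) [DecidablePred P] (h : ∀ j < n, (P j ↔ f j = t)) :
    ((List.range n).map f).count t = ((Finset.range n).filter P).card := by
  induction n with
  | zero => simp
  | succ n ih =>
    rw [List.range_succ, List.map_append, List.count_append, ih fun j hj => h j (by omega), Finset.range_add_one, Finset.filter_insert]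
    have h1 := h n (by omega)
    by_cases hp : P n
    · rw [if_pos hp, Finset.card_insert_of_notMem (by simp)]
      simp [h1.1 hp]
    · rw [if_neg hp]
      have : f n ≠ t := fun e => hp (h1.2 e)
      simp [this]

theorem CQ.cn_eq (x : CQ) (b i t) : x.cn b i t = cnt x.m x.c b i t := by
  unfold CQ.cn cnt
  exact count_map_range _ _ _ _ fun j _ => Iff.rfl
theorem CQ.kc_eq (x : CQ) (b i t) : x.kc b i t = kcnt x.m (fun b i => decide (x.k b i = 1)) x.c b i t := by
  unfold CQ.kc kcnt
  refine count_map_range _ _ _ _ fun j _ => ?_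
  have : x.k (!b) j < 2 := dg_lt (by omega)
  rcases Nat.lt_or_ge (x.k (!b) j) 1 with h | h
  · have h : x.k (!b) j = 0 := by omega
    simp [h]
  · have h : x.k (!b) j = 1 := by omega
    simp [h, CQ.t]

def CertQ (x : CQ) : Prop :=
  (∀ b ∈ [true, false],
    (∀ i < x.m b, SideP b x.1 (x.p b i)) ∧
    (∀ i < x.m b, ∀ t < gE x.1, x.p b i t < 2 → x.cn b i t ≤ x.p b i t) ∧
    (∀ i < x.m b, x.k b i = 1 → ∀ t < gE x.1, x.p b i t ≤ x.cn b i t) ∧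
    (∀ i < x.m b, x.k b i = 1 → ∀ j < x.m (!b), x.g (!b) j = 1 → x.p b i (x.t b i j) = 2) ∧
    (∀ i < x.m b, x.k b i ≠ 1 → ∀ t < gE x.1, x.cn b i t < x.p b i t → ∃ j < x.m (!b), x.g (!b) j = 1 ∧ x.acc (!b) j t) ∧
    (∀ i < x.m b, x.g b i = 1 → ∀ t < gE x.1, x.kc b i t < x.p b i t → ∃ j < x.m (!b), x.g (!b) j = 1 ∧ x.acc (!b) j t) ∧
    (∀ i < x.m b, x.g b i = 1 → x.k b i ≠ 1)) ∧
  (∀ i < x.m true, x.k true i ≠ 1 → ∀ j < x.m false, x.k false j ≠ 1 → ∃ t < gE x.1, x.p true i t = 2 ∧ x.p false j t = 2) ∧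
  (∃ i < x.m true, ∃ j < x.m false, ¬ fb (x.c i j / 2) x.1)

theorem gE_pos (N : ℕ) : 0 < gE N := by unfold gE; positivity

theorem certQ_iff (x : CQ) : CertQ x ↔ Cert x.1 x.m x.p (fun b i => decide (x.k b i = 1)) (fun b i => decide (x.g b i = 1)) x.c := by
  have hp : ∀ b i t, x.p b i t ≤ 2 := fun b i t => Nat.lt_succ_iff.1 (dg_lt (by omega))
  have hc : ∀ i j, x.c i j < gE x.1 := fun i j => dg_lt (gE_pos _)
  have hall : ∀ P : Bool → Prop, (∀ b ∈ [true, false], P b) ↔ ∀ b, P b := by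
    intro P; simp
  unfold CertQ
  rw [hall]
  simp only [CQ.acc, CQ.cn_eq, CQ.kc_eq, CQ.t]
  constructor
  · rintro ⟨h, h8, h9⟩
    refine ⟨fun b => (h b).1, fun b i _ t _ => hp b i t, ?_, fun b => (h b).2.1, ?_, ?_, ?_, ?_, ?_, ?_, h9⟩
    · intro b i _ j _; cases b <;> exact hc _ _
    · intro b i hi hk; exact (h b).2.2.1 i hi (of_decide_eq_true hk)
    · intro b i hi hk j hj hg; exact (h b).2.2.2.1 i hi (of_decide_eq_true hk) j hj (of_decide_eq_true hg)
    · intro i hi hk j hj hk'; exact h8 i hi (of_decide_eq_false hk) j hj (of_decide_eq_false hk')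
    · intro b i hi hk t ht hlt
      obtain ⟨j, hj, h1, h2⟩ := (h b).2.2.2.2.1 i hi (of_decide_eq_false hk) t ht hlt
      exact ⟨j, hj, decide_eq_true h1, h2⟩
    · intro b i hi hk t ht hlt
      obtain ⟨j, hj, h1, h2⟩ := (h b).2.2.2.2.2.1 i hi (of_decide_eq_true hk) t ht hlt
      exact ⟨j, hj, decide_eq_true h1, h2⟩
    · intro b i hi hg; exact decide_eq_false ((h b).2.2.2.2.2.2 i hi (of_decide_eq_true hg))
  · intro C
    refine ⟨fun b => ⟨C.side b, C.c2 b, ?_, ?_, ?_, ?_, ?_⟩, ?_, C.tgt⟩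
    · intro i hi hk; exact C.c3 b i hi (decide_eq_true hk)
    · intro i hi hk j hj hg; exact C.c4 b i hi (decide_eq_true hk) j hj (decide_eq_true hg)
    · intro i hi hk t ht hlt
      obtain ⟨j, hj, h1, h2⟩ := C.c6 b i hi (decide_eq_false hk) t ht hlt
      exact ⟨j, hj, of_decide_eq_true h1, h2⟩
    · intro i hi hk t ht hlt
      obtain ⟨j, hj, h1, h2⟩ := C.c7 b i hi (decide_eq_true hk) t ht hlt
      exact ⟨j, hj, of_decide_eq_true h1, h2⟩
    · intro i hi hg; exact of_decide_eq_false (C.c8 b i hi (decide_eq_true hg))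
    · intro i hi hk j hj hk'; exact C.c5 i hi (decide_eq_false hk) j hj (decide_eq_false hk')

section P2
variable {α : Type} [Primcodable α] {f : α → CQ} (b : Bool)
theorem pr_sd (hf : Primrec f) : Primrec fun a => (f a).sd b := by
  cases b with
  | true => exact pr_fst (pr_snd hf)
  | false => exact pr_fst (pr_snd (pr_snd hf))
theorem pr_m (hf : Primrec f) : Primrec fun a => (f a).m b := pr_fst (pr_sd b hf)
theorem pr_p (hf : Primrec f) {i t : α → ℕ} (hi : Primrec i) (ht : Primrec t) : Primrec fun a => (f a).p b (i a) (t a) :=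
  pr_dg (Primrec.const 3) (pr_fst (pr_snd (pr_sd b hf))) (pr_npair hi ht)
theorem pr_k (hf : Primrec f) {i : α → ℕ} (hi : Primrec i) : Primrec fun a => (f a).k b (i a) :=
  pr_dg (Primrec.const 2) (pr_fst (pr_snd (pr_snd (pr_sd b hf)))) hi
theorem pr_g (hf : Primrec f) {i : α → ℕ} (hi : Primrec i) : Primrec fun a => (f a).g b (i a) :=
  pr_dg (Primrec.const 2) (pr_snd (pr_snd (pr_snd (pr_sd b hf)))) hi
theorem pr_c (hf : Primrec f) {i j : α → ℕ} (hi : Primrec i) (hj : Primrec j) : Primrec fun a => (f a).c (i a) (j a) :=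
  pr_dg (pr_gE (pr_fst hf)) (pr_snd (pr_snd (pr_snd hf))) (pr_npair hi hj)
theorem pr_t (hf : Primrec f) {i j : α → ℕ} (hi : Primrec i) (hj : Primrec j) : Primrec fun a => (f a).t b (i a) (j a) := by
  cases b with
  | true => exact pr_c hf hi hj
  | false => exact pr_c hf hj hi
theorem pr_cn (hf : Primrec f) {i t : α → ℕ} (hi : Primrec i) (ht : Primrec t) : Primrec fun a => (f a).cn b (i a) (t a) :=
  pr_count ht (pr_map (pr_range (pr_m (!b) hf)) (pr_t b (hf.comp Primrec.fst) (hi.comp Primrec.fst) Primrec.snd))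
theorem pr_kc (hf : Primrec f) {i t : α → ℕ} (hi : Primrec i) (ht : Primrec t) : Primrec fun a => (f a).kc b (i a) (t a) :=
  pr_count (pr_add ht (Primrec.const 1)) (pr_map (pr_range (pr_m (!b) hf)) (pr_mul (pr_k (!b) (hf.comp Primrec.fst) Primrec.snd)
    (pr_add (pr_t b (hf.comp Primrec.fst) (hi.comp Primrec.fst) Primrec.snd) (Primrec.const 1))))
theorem PP_acc (hf : Primrec f) {i t : α → ℕ} (hi : Primrec i) (ht : Primrec t) : PP fun a => (f a).acc b (i a) (t a) :=
  PP.or (PP.eq (pr_p b hf hi ht) (Primrec.const 2)) (PP.and (PP.eq (pr_p b hf hi ht) (Primrec.const 1))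
    (PP.eq (pr_kc b hf hi ht) (Primrec.const 0)))
end P2

theorem PP_CertQ : PP CertQ := by
  unfold CertQ
  refine PP.and ?_ (PP.and ?_ ?_)
  · simp only [List.mem_cons, List.not_mem_nil, or_false, forall_eq_or_imp, forall_eq]
    repeat' with_reducible first
      | apply PP.and
      | apply PP.all_lt
      | apply PP.ex_lt
      | apply PP_sideP
      | apply PP_acc
      | apply PP.ne
      | apply PP.imp
      | apply PP.eq
      | apply PP.le
      | apply PP.lt
      | exact pr_idd
      | exact Primrec.fst
      | exact Primrec.snd
      | exact Primrec.const _
      | apply pr_m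
      | apply pr_p
      | apply pr_k
      | apply pr_g
      | apply pr_t
      | apply pr_cn
      | apply pr_kc
      | apply pr_gE
      | apply pr_fst
      | apply pr_snd
  · repeat' with_reducible first
      | apply PP.and
      | apply PP.all_lt
      | apply PP.ex_lt
      | apply PP.ne
      | apply PP.imp
      | apply PP.eq
      | exact pr_idd
      | exact Primrec.fst
      | exact Primrec.snd
      | exact Primrec.const _
      | apply pr_m
      | apply pr_p
      | apply pr_k
      | apply pr_gE
      | apply pr_fst
      | apply pr_snd
  · refine PP.ex_lt (pr_m true Primrec.id) (PP.ex_lt (pr_m false Primrec.fst) (PP.not (PP.fb (pr_div (pr_c (pr_fst Primrec.fst)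
      (pr_snd Primrec.fst) Primrec.snd) (Primrec.const 2)) (pr_fst (pr_fst Primrec.fst)))))

theorem Cert.congr {N : ℕ} {m : Bool → ℕ} {p p' : Bool → ℕ → ℕ → ℕ} {K K' G G' : Bool → ℕ → Bool} {c c' : ℕ → ℕ → ℕ}
    (C : Cert N m p K G c) (hp : ∀ b, ∀ i < m b, ∀ t < gE N, p b i t = p' b i t) (hK : ∀ b, ∀ i < m b, K b i = K' b i)
    (hG : ∀ b, ∀ i < m b, G b i = G' b i) (hc : ∀ i < m true, ∀ j < m false, c i j = c' i j) : Cert N m p' K' G' c' := by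
  have htr : ∀ b, ∀ i < m b, ∀ j < m (!b), tr c b i j = tr c' b i j := by
    intro b i hi j hj
    cases b with
    | true => exact hc i hi j hj
    | false => exact hc j hj i hi
  have hcnt : ∀ b, ∀ i < m b, ∀ t, cnt m c b i t = cnt m c' b i t := by
    intro b i hi t
    unfold cnt
    congr 1
    refine Finset.filter_congr fun j hj => ?_
    rw [htr b i hi j (Finset.mem_range.1 hj)]
  have hkc : ∀ b, ∀ i < m b, ∀ t, kcnt m K c b i t = kcnt m K' c' b i t := by
    intro b i hi t
    unfold kcnt
    congr 1
    refine Finset.filter_congr fun j hj => ?_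
    rw [htr b i hi j (Finset.mem_range.1 hj), hK _ j (Finset.mem_range.1 hj)]
  have hacc : ∀ b, ∀ i < m b, ∀ t < gE N, acc m p K c b i t → acc m p' K' c' b i t := by
    intro b i hi t ht
    unfold acc
    rw [hp b i hi t ht, hkc b i hi t]
    exact id
  refine ⟨?_, ?_, ?_, ?_, ?_, ?_, ?_, ?_, ?_, ?_, ?_⟩
  · intro b i hi; exact (C.side b i hi).congr (hp b i hi)
  · intro b i hi t ht; rw [← hp b i hi t ht]; exact C.ple b i hi t ht
  · intro b i hi j hj; rw [← htr b i hi j hj]; exact C.lt b i hi j hj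
  · intro b i hi t ht; rw [← hp b i hi t ht, ← hcnt b i hi]; exact C.c2 b i hi t ht
  · intro b i hi hk t ht; rw [← hK b i hi] at hk; rw [← hp b i hi t ht, ← hcnt b i hi]; exact C.c3 b i hi hk t ht
  · intro b i hi hk j hj hg
    rw [← hK b i hi] at hk; rw [← hG _ j hj] at hg
    rw [← htr b i hi j hj, ← hp b i hi _ (C.lt b i hi j hj)]; exact C.c4 b i hi hk j hj hg
  · intro i hi hk j hj hk'
    rw [← hK _ i hi] at hk; rw [← hK _ j hj] at hk'
    obtain ⟨t, ht, h1, h2⟩ := C.c5 i hi hk j hj hk'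
    exact ⟨t, ht, (hp _ i hi t ht) ▸ h1, (hp _ j hj t ht) ▸ h2⟩
  · intro b i hi hk t ht hlt
    rw [← hK b i hi] at hk
    rw [← hp b i hi t ht, ← hcnt b i hi] at hlt
    obtain ⟨j, hj, h1, h2⟩ := C.c6 b i hi hk t ht hlt
    exact ⟨j, hj, hG _ j hj ▸ h1, hacc _ j hj t ht h2⟩
  · intro b i hi hk t ht hlt
    rw [← hG b i hi] at hk
    rw [← hp b i hi t ht, ← hkc b i hi] at hlt
    obtain ⟨j, hj, h1, h2⟩ := C.c7 b i hi hk t ht hlt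
    exact ⟨j, hj, hG _ j hj ▸ h1, hacc _ j hj t ht h2⟩
  · intro b i hi hg
    rw [← hG b i hi] at hg; rw [← hK b i hi]; exact C.c8 b i hi hg
  · obtain ⟨i, hi, j, hj, h⟩ := C.tgt
    exact ⟨i, hi, j, hj, hc i hi j hj ▸ h⟩

theorem pair_lt_pair {a b c d : ℕ} (h1 : a < c) (h2 : b < d) : Nat.pair a b < Nat.pair c d :=
  (Nat.pair_lt_pair_left b h1).trans (Nat.pair_lt_pair_right c h2)

theorem gsat_iff_certQ (N : ℕ) : GSat N ↔ ∃ y, CertQ (N, y) := by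
  rw [gsat_iff_cert]
  constructor
  · rintro ⟨m, p, K, G, c, C⟩
    have hP : ∀ b, ∃ P, ∀ i < m b, ∀ t < gE N, dg 3 P (Nat.pair i t) = p b i t := by
      intro b
      obtain ⟨P, _, h⟩ := dg_exists 3 (Nat.pair (m b) (gE N)) (fun k => if k.unpair.1 < m b ∧ k.unpair.2 < gE N then p b k.unpair.1 k.unpair.2 else 0)
        (by
          intro k hk
          split_ifs with h
          · have := C.ple b _ h.1 _ h.2; omega
          · omega)
      refine ⟨P, fun i hi t ht => ?_⟩
      rw [h _ (pair_lt_pair hi ht)]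
      simp [hi, ht]
    have hB : ∀ (n : ℕ) (q : ℕ → Bool), ∃ P, ∀ i < n, q i = decide (dg 2 P i = 1) := by
      intro n q
      obtain ⟨P, _, h⟩ := dg_exists 2 n (fun i => (q i).toNat) (fun i _ => Bool.toNat_lt _)
      refine ⟨P, fun i hi => ?_⟩
      rw [h i hi]
      cases q i <;> rfl
    obtain ⟨cc, _, hcc⟩ := dg_exists (gE N) (Nat.pair (m true) (m false))
      (fun k => if k.unpair.1 < m true ∧ k.unpair.2 < m false then c k.unpair.1 k.unpair.2 else 0)
        (by
          intro k hk
          split_ifs with h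
          · exact C.lt true _ h.1 _ h.2
          · exact gE_pos N)
    choose P hP using hP
    choose Kc hKc using fun b => hB (m b) (K b)
    choose Gc hGc using fun b => hB (m b) (G b)
    refine ⟨((m true, P true, Kc true, Gc true), (m false, P false, Kc false, Gc false), cc), ?_⟩
    set x : CQ := (N, ((m true, P true, Kc true, Gc true), (m false, P false, Kc false, Gc false), cc)) with hx
    have hsd : ∀ b, x.sd b = (m b, P b, Kc b, Gc b) := by intro b; cases b <;> rfl
    have hm : x.m = m := by funext b; rw [CQ.m, hsd]
    rw [certQ_iff, hm]
    refine C.congr ?_ ?_ ?_ ?_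
    · intro b i hi t ht; rw [CQ.p, hsd]; exact (hP b i hi t ht).symm
    · intro b i hi; rw [CQ.k, hsd]; exact hKc b i hi
    · intro b i hi; rw [CQ.g, hsd]; exact hGc b i hi
    · intro i hi j hj
      show c i j = dg (gE N) cc (Nat.pair i j)
      rw [hcc _ (pair_lt_pair hi hj)]
      simp [hi, hj]
  · rintro ⟨y, h⟩
    exact ⟨_, _, _, _, _, (certQ_iff _).1 h⟩

theorem gsat_re : REPred GSat := by
  refine (PP.re_ex' (p := fun N y => CertQ (N, y)) (PP_CertQ.comp (f := fun x : ℕ × _ => (x.1, x.2)) ?_)).of_eq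
    fun N => (gsat_iff_certQ N).symm
  exact Primrec.id
end OneVarEq

namespace OneVarEq
open Function

/-! ### compactness: unsatisfiability is semi-decidable -/
def wn (i t s : ℕ) : ℕ := 1 + Nat.pair i (Nat.pair t s)

def HalfCon (b : Bool) (N n : ℕ) (F : ℕ → ℕ → ℕ) (P : ℕ → ℕ) (e e' : ℕ → ℕ → ℕ) : Prop :=
  (∀ i < n, e i i = 1 ∧ SideP b N (dg 3 (P i))) ∧
  (∀ i < n, ∀ j < n, e i j = 1 → e j i = 1 ∧ P i = P j) ∧
  (∀ i < n, ∀ j < n, ∀ k < n, e i j = 1 → e j k = 1 → e i k = 1) ∧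
  (∀ i < n, ∀ i' < n, ∀ j < n, e i i' = 1 → F i j = F i' j) ∧
  (∀ i < n, ∀ j < n, F i j < gE N ∧ dg 3 (P i) (F i j) ≠ 0) ∧
  (∀ i < n, ∀ j < n, ∀ j' < n, dg 3 (P i) (F i j) = 1 → F i j' = F i j → e' j j' = 1) ∧
  (∀ i < n, ∀ t < gE N, dg 3 (P i) t ≠ 0 → wn i t 0 < n → F i (wn i t 0) = t) ∧
  (∀ i < n, ∀ t < gE N, dg 3 (P i) t = 2 → wn i t 0 < n → wn i t 1 < n →
    F i (wn i t 1) = t ∧ e' (wn i t 0) (wn i t 1) ≠ 1)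

theorem HalfCon.congr {b : Bool} {N n n0 : ℕ} {F F' : ℕ → ℕ → ℕ} {P P' : ℕ → ℕ} {e e' d d' : ℕ → ℕ → ℕ}
    (H : HalfCon b N n F P e e') (hn : n0 ≤ n) (hF : ∀ i < n0, ∀ j < n0, F' i j = F i j)
    (hP : ∀ i < n0, P' i = P i) (he : ∀ i < n0, ∀ j < n0, d i j = e i j) (he' : ∀ i < n0, ∀ j < n0, d' i j = e' i j) :
    HalfCon b N n0 F' P' d d' := by
  obtain ⟨h1, h2, h3, h4, h5, h6, h7, h8⟩ := H
  refine ⟨?_, ?_, ?_, ?_, ?_, ?_, ?_, ?_⟩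
  · intro i hi; rw [he i hi i hi, hP i hi]; exact h1 i (by omega)
  · intro i hi j hj; rw [he i hi j hj, he j hj i hi, hP i hi, hP j hj]; exact h2 i (by omega) j (by omega)
  · intro i hi j hj k hk
    rw [he i hi j hj, he j hj k hk, he i hi k hk]; exact h3 i (by omega) j (by omega) k (by omega)
  · intro i hi j hj k hk
    rw [he i hi j hj, hF j hj k hk, hF i hi k hk]; exact h4 i (by omega) j (by omega) k (by omega)
  · intro i hi j hj
    rw [hF i hi j hj, hP i hi]; exact h5 i (by omega) j (by omega)
  · intro i hi j hj k hk
    rw [hF i hi j hj, hP i hi, hF i hi k hk, he' j hj k hk]; exact h6 i (by omega) j (by omega) k (by omega)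
  · intro i hi t ht hd hw
    rw [hF i hi _ hw]; rw [hP i hi] at hd; exact h7 i (by omega) t ht hd (by omega)
  · intro i hi t ht hd hw hw'
    rw [hF i hi _ hw', he' _ hw _ hw']; rw [hP i hi] at hd; exact h8 i (by omega) t ht hd (by omega) (by omega)

def sf (s : ℕ → ℕ) (i j : ℕ) : ℕ := s (Nat.pair 0 (Nat.pair i j))
def sp (s : ℕ → ℕ) (b : Bool) (i : ℕ) : ℕ := s (Nat.pair (cond b 1 2) i)
def se (s : ℕ → ℕ) (b : Bool) (i j : ℕ) : ℕ := s (Nat.pair (cond b 3 4) (Nat.pair i j))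

def Con (N n : ℕ) (s : ℕ → ℕ) : Prop :=
  HalfCon true N n (sf s) (sp s true) (se s true) (se s false) ∧
  HalfCon false N n (fun j i => sf s i j) (sp s false) (se s false) (se s true) ∧
  (0 < n → ¬ fb (sf s 0 0 / 2) N)

def cL (n : ℕ) : ℕ := Nat.pair 5 (Nat.pair n n)
def cM (N : ℕ) : ℕ := 3 ^ gE N + gE N + 2

theorem Con.congr {N n n0 : ℕ} {s s' : ℕ → ℕ} (H : Con N n s) (hn : n0 ≤ n) (h : ∀ k < cL n0, s' k = s k) : Con N n0 s' := by
  have hF : ∀ i < n0, ∀ j < n0, sf s' i j = sf s i j := fun i hi j hj =>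
    h _ (pair_lt_pair (by omega) (pair_lt_pair hi hj))
  have hP : ∀ b, ∀ i < n0, sp s' b i = sp s b i := fun b i hi =>
    h _ (pair_lt_pair (by cases b <;> simp) (hi.trans_le (Nat.left_le_pair _ _)))
  have he : ∀ b, ∀ i < n0, ∀ j < n0, se s' b i j = se s b i j := fun b i hi j hj =>
    h _ (pair_lt_pair (by cases b <;> simp) (pair_lt_pair hi hj))
  refine ⟨H.1.congr hn hF (hP _) (he _) (he _), H.2.1.congr hn (fun j hj i hi => hF i hi j hj) (hP _) (he _) (he _), ?_⟩
  intro h0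
  rw [hF 0 h0 0 h0]
  exact H.2.2 (by omega)

def ConZ (N n : ℕ) : Prop := ∃ z < cM N ^ cL n, Con N n (dg (cM N) z)

/-! from a grid to constraints -/
theorem exists_wit {A B : Type} (g : A → B → ℕ) (b0 : B) : ∃ wd : A → ℕ → ℕ → B, ∀ a t,
    (prof g a t ≠ 0 → g a (wd a t 0) = t) ∧ (prof g a t = 2 → g a (wd a t 1) = t ∧ wd a t 0 ≠ wd a t 1) := by
  have : ∀ a t, ∃ w : ℕ → B, (prof g a t ≠ 0 → g a (w 0) = t) ∧ (prof g a t = 2 → g a (w 1) = t ∧ w 0 ≠ w 1) := by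
    intro a t
    by_cases h0 : prof g a t = 0
    · exact ⟨fun _ => b0, fun h => absurd h0 h, fun h => by omega⟩
    · by_cases h2 : prof g a t = 2
      · obtain ⟨x, hx, y, hy, hne⟩ := Set.not_subsingleton_iff.1 (cap_eq_two.1 h2)
        exact ⟨fun s => if s = 0 then x else y, fun _ => by simpa using hx, fun _ => by simpa using ⟨hy, hne⟩⟩
      · obtain ⟨x, hx⟩ := cap_ne_zero.1 h0
        exact ⟨fun _ => x, fun _ => hx, fun h => absurd h h2⟩
  choose wd h using this
  exact ⟨wd, h⟩

theorem halfCon_of {b : Bool} {N : ℕ} {A B : Type} {g : A → B → ℕ} (hg : ∀ a b, g a b < gE N)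
    (hside : ∀ a, SideP b N (prof g a)) {νA : ℕ → A} {νB : ℕ → B} {wd : A → ℕ → ℕ → B}
    (hwd : ∀ a t, (prof g a t ≠ 0 → g a (wd a t 0) = t) ∧ (prof g a t = 2 → g a (wd a t 1) = t ∧ wd a t 0 ≠ wd a t 1))
    (hν : ∀ i t s, νB (wn i t s) = wd (νA i) t s) {cp : A → ℕ} (hcp : ∀ a, ∀ t < gE N, dg 3 (cp a) t = prof g a t)
    {e e' : ℕ → ℕ → ℕ} (he : ∀ i j, e i j = 1 ↔ νA i = νA j) (he' : ∀ i j, e' i j = 1 ↔ νB i = νB j) (n : ℕ) :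
    HalfCon b N n (fun i j => g (νA i) (νB j)) (fun i => cp (νA i)) e e' := by
  refine ⟨?_, ?_, ?_, ?_, ?_, ?_, ?_, ?_⟩
  · intro i hi
    exact ⟨(he i i).2 rfl, (hside (νA i)).congr fun t ht => (hcp _ t ht).symm⟩
  · intro i _ j _ h
    rw [he] at h ⊢
    exact ⟨h.symm, congrArg cp h⟩
  · intro i _ j _ k _ h1 h2
    rw [he] at h1 h2 ⊢
    exact h1.trans h2
  · intro i _ i' _ j _ h
    rw [he] at h
    show g (νA i) (νB j) = g (νA i') (νB j)
    rw [h]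
  · intro i _ j _
    refine ⟨hg _ _, ?_⟩
    rw [hcp _ _ (hg _ _)]
    exact cap_ne_zero.2 ⟨νB j, rfl⟩
  · intro i _ j _ j' _ h1 h2
    rw [hcp _ _ (hg _ _)] at h1
    rw [he']
    exact cap_le_one.1 (le_of_eq h1) rfl h2
  · intro i _ t ht h _
    rw [hcp _ _ ht] at h
    show g (νA i) (νB (wn i t 0)) = t
    rw [hν]; exact (hwd _ t).1 h
  · intro i _ t ht h _ _
    rw [hcp _ _ ht] at h
    have := (hwd _ t).2 h
    refine ⟨?_, ?_⟩
    · show g (νA i) (νB (wn i t 1)) = t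
      rw [hν]; exact this.1
    · rw [Ne, he', hν, hν]; exact this.2

noncomputable def nu {W D : Type} (w0 : W) (d0 : D) (wW : D → ℕ → ℕ → W) (wD : W → ℕ → ℕ → D) : ℕ → W × D
  | 0 => (w0, d0)
  | k+1 => 
    have : k.unpair.1 < k + 1 := Nat.lt_succ_of_le (Nat.unpair_left_le k)
    let v := nu w0 d0 wW wD k.unpair.1
    (wW v.2 k.unpair.2.unpair.1 k.unpair.2.unpair.2, wD v.1 k.unpair.2.unpair.1 k.unpair.2.unpair.2)

theorem nu_wn {W D : Type} (w0 : W) (d0 : D) (wW : D → ℕ → ℕ → W) (wD : W → ℕ → ℕ → D) (i t s : ℕ) :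
    nu w0 d0 wW wD (wn i t s) = (wW (nu w0 d0 wW wD i).2 t s, wD (nu w0 d0 wW wD i).1 t s) := by
  rw [wn, Nat.add_comm, nu]
  simp only [Nat.unpair_pair]

theorem GSat.con {N : ℕ} (h : GSat N) : ∀ n, ConZ N n := by
  classical
  obtain ⟨W, D, f, H⟩ := h
  obtain ⟨w0, d0, h0⟩ := H.tgt
  obtain ⟨wD, hwD⟩ := exists_wit f d0
  obtain ⟨wW, hwW⟩ := exists_wit (flip f) w0
  have hcode : ∀ q : ℕ → ℕ, (∀ t, q t ≤ 2) → ∃ c, c < 3 ^ gE N ∧ ∀ t < gE N, dg 3 c t = q t := by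
    intro q hq
    obtain ⟨c, h1, h2⟩ := dg_exists 3 (gE N) q (fun t _ => Nat.lt_succ_of_le (hq t))
    exact ⟨c, h1, h2⟩
  choose cW hcW1 hcW using fun w : W => hcode (prof f w) (fun t => cap_le_two _)
  choose cD hcD1 hcD using fun d : D => hcode (prof (flip f) d) (fun t => cap_le_two _)
  let ν := nu w0 d0 wW wD
  let s : ℕ → ℕ := fun k => 
    if k.unpair.1 = 0 then f (ν k.unpair.2.unpair.1).1 (ν k.unpair.2.unpair.2).2
    else if k.unpair.1 = 1 then cW (ν k.unpair.2).1
    else if k.unpair.1 = 2 then cD (ν k.unpair.2).2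
    else if k.unpair.1 = 3 then (if (ν k.unpair.2.unpair.1).1 = (ν k.unpair.2.unpair.2).1 then 1 else 0)
    else (if (ν k.unpair.2.unpair.1).2 = (ν k.unpair.2.unpair.2).2 then 1 else 0)
  have hs : ∀ k, s k < cM N := by
    intro k
    simp only [s, cM]
    have h1 := H.lt (ν k.unpair.2.unpair.1).1 (ν k.unpair.2.unpair.2).2
    have h2 := hcW1 (ν k.unpair.2).1
    have h3 := hcD1 (ν k.unpair.2).2
    split_ifs <;> omega
  have e1 : sf s = fun i j => f (ν i).1 (ν j).2 := by funext i j; simp [sf, s]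
  have e2 : sp s true = fun i => cW (ν i).1 := by funext i; simp [sp, s]
  have e3 : sp s false = fun i => cD (ν i).2 := by funext i; simp [sp, s]
  have e4 : ∀ i j, se s true i j = 1 ↔ (ν i).1 = (ν j).1 := by intro i j; simp [se, s]
  have e5 : ∀ i j, se s false i j = 1 ↔ (ν i).2 = (ν j).2 := by intro i j; simp [se, s]
  have hcon : ∀ n, Con N n s := by
    intro n
    refine ⟨?_, ?_, ?_⟩
    · rw [e1, e2]
      exact halfCon_of (b := true) (νA := fun i => (ν i).1) (νB := fun i => (ν i).2) (cp := cW) H.lt H.row hwD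
        (fun i t s => by simp only [ν, nu_wn]) hcW e4 e5 n
    · rw [e1, e3]
      exact halfCon_of (b := false) (g := flip f) (νA := fun i => (ν i).2) (νB := fun i => (ν i).1) (cp := cD) (fun d w => H.lt w d) H.col hwW
        (fun i t s => by simp only [ν, nu_wn]) hcD e5 e4 n
    · intro _
      rw [e1]
      have : ν 0 = (w0, d0) := by simp only [ν, nu]
      simp only [this]
      exact h0
  intro n
  obtain ⟨z, hz, hz'⟩ := dg_exists (cM N) (cL n) s (fun k _ => hs k)
  exact ⟨z, hz, (hcon n).congr le_rfl hz'⟩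

/-! from constraints to a grid -/
theorem cap_name {Q : Type} (q : ℕ → Q) (hq : Function.Surjective q) {ee : ℕ → ℕ → ℕ} (hee : ∀ j j', q j = q j' ↔ ee j j' = 1)
    (g : Q → ℕ) (P : ℕ → ℕ) (t w0 w1 : ℕ) (h0 : ∀ j, P (g (q j)) ≠ 0) 
    (h1 : ∀ j j', P (g (q j)) = 1 → g (q j') = g (q j) → ee j j' = 1) (h2 : P t ≠ 0 → g (q w0) = t)
    (h3 : P t = 2 → g (q w1) = t ∧ ee w0 w1 ≠ 1) (hP : P t ≤ 2) : cap {y | g y = t} = P t := by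
  rcases Nat.lt_or_ge 0 (P t) with hp | hp
  · rcases Nat.lt_or_ge 1 (P t) with hp' | hp'
    · have hp2 : P t = 2 := by omega
      rw [hp2, cap_eq_two]
      intro hs
      obtain ⟨h4, h5⟩ := h3 hp2
      exact h5 ((hee _ _).1 (hs (h2 (by omega)) h4))
    · have hp1 : P t = 1 := by omega
      have h4 : cap {y | g y = t} ≠ 0 := cap_ne_zero.2 ⟨q w0, h2 (by omega)⟩
      have h5 : cap {y | g y = t} ≤ 1 := by
        rw [cap_le_one]
        intro x hx y hy
        obtain ⟨j, rfl⟩ := hq x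
        obtain ⟨j', rfl⟩ := hq y
        have hx : g (q j) = t := hx
        have hy : g (q j') = t := hy
        exact (hee _ _).2 (h1 j j' (by rw [hx]; exact hp1) (hy.trans hx.symm))
      omega
  · have : P t = 0 := by omega
    rw [this, cap_eq_zero, Set.eq_empty_iff_forall_notMem]
    intro x hx
    obtain ⟨j, rfl⟩ := hq x
    have hx : g (q j) = t := hx
    exact h0 j (by rw [hx]; exact this)

theorem half_quot {b : Bool} {N : ℕ} {F : ℕ → ℕ → ℕ} {P : ℕ → ℕ} {e e' : ℕ → ℕ → ℕ}
    (H : ∀ n, HalfCon b N n F P e e') {Q : Type} (q : ℕ → Q) (hq : Function.Surjective q)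
    (hee : ∀ j j', q j = q j' ↔ e' j j' = 1) (i : ℕ) (g : Q → ℕ) (hg : ∀ j, g (q j) = F i j) :
    SideP b N (fun t => cap {y | g y = t}) := by
  have h := ((H (i+1)).1 i (by omega)).2
  refine h.congr fun t ht => ?_
  symm
  refine cap_name q hq hee g _ t (wn i t 0) (wn i t 1) ?_ ?_ ?_ ?_ ?_
  · intro j; rw [hg]; exact ((H (i+j+1)).2.2.2.2.1 i (by omega) j (by omega)).2
  · intro j j'
    rw [hg, hg]
    exact (H (i+j+j'+1)).2.2.2.2.2.1 i (by omega) j (by omega) j' (by omega)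
  · intro hp
    rw [hg]
    exact (H (i+wn i t 0+1)).2.2.2.2.2.2.1 i (by omega) t ht hp (by omega)
  · intro hp
    rw [hg]
    exact (H (i+wn i t 0+wn i t 1+1)).2.2.2.2.2.2.2 i (by omega) t ht hp (by omega) (by omega)
  · exact Nat.lt_succ_iff.1 (dg_lt (by omega))

def HalfCon.st {b : Bool} {N : ℕ} {F : ℕ → ℕ → ℕ} {P : ℕ → ℕ} {e e' : ℕ → ℕ → ℕ}
    (H : ∀ n, HalfCon b N n F P e e') : Setoid ℕ where
  r i j := e i j = 1
  iseqv := by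
    refine ⟨fun i => ((H (i+1)).1 i (by omega)).1, ?_, ?_⟩
    · intro i j h
      exact ((H (i+j+1)).2.1 i (by omega) j (by omega) h).1
    · intro i j k h1 h2
      exact (H (i+j+k+1)).2.2.1 i (by omega) j (by omega) k (by omega) h1 h2

theorem gsat_of_con {N : ℕ} {s : ℕ → ℕ} (h : ∀ n, Con N n s) : GSat N := by
  have H1 := fun n => (h n).1
  have H2 := fun n => (h n).2.1
  let S1 := HalfCon.st H1
  let S2 := HalfCon.st H2
  let f : Quotient S1 → Quotient S2 → ℕ := Quotient.lift₂ (sf s) (by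
    intro a b a' b' (h1 : se s true a a' = 1) (h2 : se s false b b' = 1)
    exact ((H1 (a+a'+b+1)).2.2.2.1 a (by omega) a' (by omega) b (by omega) h1).trans
      ((H2 (b+b'+a'+1)).2.2.2.1 b (by omega) b' (by omega) a' (by omega) h2))
  have hf : ∀ i j, f (Quotient.mk S1 i) (Quotient.mk S2 j) = sf s i j := fun i j => rfl
  have hq1 : ∀ i j, Quotient.mk S1 i = Quotient.mk S1 j ↔ se s true i j = 1 := fun i j => Quotient.eq
  have hq2 : ∀ i j, Quotient.mk S2 i = Quotient.mk S2 j ↔ se s false i j = 1 := fun i j => Quotient.eq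
  refine ⟨Quotient S1, Quotient S2, f, ?_, ?_, ?_, ?_⟩
  · intro x y
    induction x using Quotient.inductionOn with
    | _ i =>
      induction y using Quotient.inductionOn with
      | _ j => exact ((H1 (i+j+1)).2.2.2.2.1 i (by omega) j (by omega)).1
  · intro x
    induction x using Quotient.inductionOn with
    | _ i => exact half_quot H1 (Quotient.mk S2) Quotient.mk_surjective hq2 i (f (Quotient.mk S1 i)) (fun j => rfl)
  · intro y
    induction y using Quotient.inductionOn with
    | _ j => exact half_quot H2 (Quotient.mk S1) Quotient.mk_surjective hq1 j (fun x => f x (Quotient.mk S2 j)) (fun i => rfl)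
  · exact ⟨Quotient.mk S1 0, Quotient.mk S2 0, (h 1).2.2 (by omega)⟩

theorem gsat_of_conZ {N : ℕ} (h : ∀ n, ConZ N n) : GSat N := by
  choose z _ hz using h
  let U := Filter.hyperfilter ℕ
  have hM : 0 < cM N := by unfold cM; positivity
  have hlim : ∀ k, ∃ v, ∀ᶠ n in (U : Filter ℕ), dg (cM N) (z n) k = v := by
    intro k
    have h1 : ∀ᶠ n in (U : Filter ℕ), ∃ v ∈ Set.Iio (cM N), dg (cM N) (z n) k = v :=
      Filter.Eventually.of_forall fun n => ⟨_, dg_lt hM, rfl⟩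
    obtain ⟨v, _, hv⟩ := (Ultrafilter.eventually_exists_mem_iff (Set.finite_Iio (cM N))).1 h1
    exact ⟨v, hv⟩
  choose s hs using hlim
  refine gsat_of_con (s := s) fun n0 => ?_
  have h1 : ∀ᶠ n in (U : Filter ℕ), ∀ k ∈ Set.Iio (cL n0), dg (cM N) (z n) k = s k :=
    (Filter.eventually_all_finite (Set.finite_Iio _)).2 fun k _ => hs k
  have h2 : ∀ᶠ n in (U : Filter ℕ), n0 ≤ n := by
    have : (U : Filter ℕ) ≤ Filter.atTop := by
      rw [← Nat.cofinite_eq_atTop]; exact Filter.hyperfilter_le_cofinite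
    exact this (Filter.eventually_ge_atTop n0)
  obtain ⟨n, h3, h4⟩ := (h1.and h2).exists
  exact (hz n).congr h4 fun k hk => (h3 k hk).symm

theorem not_gsat_iff (N : ℕ) : ¬ GSat N ↔ ∃ n, ¬ ConZ N n := by
  rw [← not_forall]
  exact not_congr ⟨GSat.con, gsat_of_conZ⟩

section P
variable {α : Type} [Primcodable α]
theorem pr_wn {i t s : α → ℕ} (hi : Primrec i) (ht : Primrec t) (hs : Primrec s) : Primrec fun a => wn (i a) (t a) (s a) :=
  pr_add (Primrec.const 1) (pr_npair hi (pr_npair ht hs))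
theorem pr_cM {N : α → ℕ} (hN : Primrec N) : Primrec fun a => cM (N a) :=
  pr_add (pr_add (pr_pow (Primrec.const 3) (pr_gE hN)) (pr_gE hN)) (Primrec.const 2)
theorem pr_cL {n : α → ℕ} (hn : Primrec n) : Primrec fun a => cL (n a) := pr_npair (Primrec.const 5) (pr_npair hn hn)

theorem PP_halfCon (b : Bool) {N n : α → ℕ} {F e e' : α → ℕ → ℕ → ℕ} {P : α → ℕ → ℕ} (hN : Primrec N) (hn : Primrec n)
    (hF : ∀ {β : Type} [Primcodable β] {f : β → α} {i j : β → ℕ}, Primrec f → Primrec i → Primrec j → Primrec fun x => F (f x) (i x) (j x))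
    (he : ∀ {β : Type} [Primcodable β] {f : β → α} {i j : β → ℕ}, Primrec f → Primrec i → Primrec j → Primrec fun x => e (f x) (i x) (j x))
    (he' : ∀ {β : Type} [Primcodable β] {f : β → α} {i j : β → ℕ}, Primrec f → Primrec i → Primrec j → Primrec fun x => e' (f x) (i x) (j x))
    (hP : ∀ {β : Type} [Primcodable β] {f : β → α} {i : β → ℕ}, Primrec f → Primrec i → Primrec fun x => P (f x) (i x)) :
    PP fun a => HalfCon b (N a) (n a) (F a) (P a) (e a) (e' a) := by
  unfold HalfCon
  have hN' : ∀ {β : Type} [Primcodable β] {f : β → α}, Primrec f → Primrec fun x => N (f x) := fun hf => hN.comp hf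
  have hn' : ∀ {β : Type} [Primcodable β] {f : β → α}, Primrec f → Primrec fun x => n (f x) := fun hf => hn.comp hf
  repeat' with_reducible first
    | apply PP.and
    | apply PP.all_lt
    | apply PP_sideP
    | apply PP.ne
    | apply PP.imp
    | apply PP.eq
    | apply PP.lt
    | exact pr_idd
    | exact Primrec.fst
    | exact Primrec.snd
    | exact Primrec.const _
    | exact hN
    | exact hn
    | apply pr_wn
    | apply pr_dg
    | apply pr_gE
    | apply hF
    | apply he
    | apply he'
    | apply hP
    | apply hN'
    | apply hn'
    | apply pr_fst
    | apply pr_snd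
end P

theorem PP_ConZ : PP fun x : ℕ × ℕ => ConZ x.1 x.2 := by
  unfold ConZ
  refine PP.ex_lt (pr_pow (pr_cM Primrec.fst) (pr_cL Primrec.snd)) ?_
  have hsf : ∀ {β : Type} [Primcodable β] {f : β → (ℕ × ℕ) × ℕ} {i j : β → ℕ}, Primrec f → Primrec i → Primrec j →
      Primrec fun x => sf (dg (cM (f x).1.1) (f x).2) (i x) (j x) := fun hf hi hj =>
    pr_dg (pr_cM (pr_fst (pr_fst hf))) (pr_snd hf) (pr_npair (Primrec.const 0) (pr_npair hi hj))
  have hse : ∀ (b : Bool) {β : Type} [Primcodable β] {f : β → (ℕ × ℕ) × ℕ} {i j : β → ℕ}, Primrec f → Primrec i → Primrec j →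
      Primrec fun x => se (dg (cM (f x).1.1) (f x).2) b (i x) (j x) := fun b _ _ _ _ _ hf hi hj =>
    pr_dg (pr_cM (pr_fst (pr_fst hf))) (pr_snd hf) (pr_npair (Primrec.const _) (pr_npair hi hj))
  have hsp : ∀ (b : Bool) {β : Type} [Primcodable β] {f : β → (ℕ × ℕ) × ℕ} {i : β → ℕ}, Primrec f → Primrec i →
      Primrec fun x => sp (dg (cM (f x).1.1) (f x).2) b (i x) := fun b _ _ _ _ hf hi =>
    pr_dg (pr_cM (pr_fst (pr_fst hf))) (pr_snd hf) (pr_npair (Primrec.const _) hi)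
  have h1 : Primrec fun x : (ℕ × ℕ) × ℕ => x.1.1 := pr_fst Primrec.fst
  have h2 : Primrec fun x : (ℕ × ℕ) × ℕ => x.1.2 := pr_snd Primrec.fst
  have hA : PP fun x : (ℕ × ℕ) × ℕ => HalfCon true x.1.1 x.1.2 (sf (dg (cM x.1.1) x.2)) (sp (dg (cM x.1.1) x.2) true)
      (se (dg (cM x.1.1) x.2) true) (se (dg (cM x.1.1) x.2) false) :=
    PP_halfCon (α := (ℕ × ℕ) × ℕ) (N := fun x => x.1.1) (n := fun x => x.1.2) (F := fun x => sf (dg (cM x.1.1) x.2))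
      (P := fun x => sp (dg (cM x.1.1) x.2) true) (e := fun x => se (dg (cM x.1.1) x.2) true)
      (e' := fun x => se (dg (cM x.1.1) x.2) false) true h1 h2 hsf (hse true) (hse false) (hsp true)
  have hB : PP fun x : (ℕ × ℕ) × ℕ => HalfCon false x.1.1 x.1.2 (fun j i => sf (dg (cM x.1.1) x.2) i j) (sp (dg (cM x.1.1) x.2) false)
      (se (dg (cM x.1.1) x.2) false) (se (dg (cM x.1.1) x.2) true) :=
    PP_halfCon (α := (ℕ × ℕ) × ℕ) (N := fun x => x.1.1) (n := fun x => x.1.2) (F := fun x j i => sf (dg (cM x.1.1) x.2) i j)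
      (P := fun x => sp (dg (cM x.1.1) x.2) false) (e := fun x => se (dg (cM x.1.1) x.2) false)
      (e' := fun x => se (dg (cM x.1.1) x.2) true) false h1 h2 (fun hf hi hj => hsf hf hj hi) (hse false) (hse true) (hsp false)
  have h3 : Primrec fun x : (ℕ × ℕ) × ℕ => sf (dg (cM x.1.1) x.2) 0 0 :=
    hsf (f := fun x => x) (i := fun _ => 0) (j := fun _ => 0) pr_idd (Primrec.const 0) (Primrec.const 0)
  have h4 : Primrec fun x : (ℕ × ℕ) × ℕ => sf (dg (cM x.1.1) x.2) 0 0 / 2 := pr_div h3 (Primrec.const 2)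
  have hC : PP fun x : (ℕ × ℕ) × ℕ => 0 < x.1.2 → ¬ fb (sf (dg (cM x.1.1) x.2) 0 0 / 2) x.1.1 :=
    PP.imp (PP.lt (Primrec.const 0) h2) (PP.not (PP.fb h4 h1))
  exact PP.and hA (PP.and hB hC)

theorem gsat_computable : ComputablePred fun N => ¬ GSat N := by
  rw [ComputablePred.computable_iff_re_compl_re']
  constructor
  · exact (PP.re_ex (p := fun N n => ¬ ConZ N n) (PP.not PP_ConZ)).of_eq fun N => (not_gsat_iff N).symm
  · exact gsat_re.of_eq fun N => not_not.symm

theorem part1 : DecidableELogic eU (LogED DSem.xd Cdiff) := by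
  refine decidable_of_sat eU (fun _ => ()) 1 ?_ ?_ _ GSat gsat_computable ?_
  · intro i hi
    interval_cases i; rfl
  · intro m; cases m; decide
  · intro φ
    exact ⟨GSat.of_not_mem φ, fun h => h.model φ rfl⟩
end OneVarEq

namespace OneVarEq

/-- `Log^=_xd 𝒞_diff` and `Log^=_xd 𝒞_ftime` are decidable,
but `Log^=_xd (𝒞_diff ⊗ 𝒞_diff ⊗ 𝒞_ftime)` is undecidable. -/
theorem diff_ftime_fusion_undecidable :
    DecidableELogic eU (LogED DSem.xd Cdiff) ∧
    DecidableELogic eB (LogED DSem.xd Cftime) ∧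
    ¬ DecidableELogic eS3
      (LogED DSem.xd (frameFusion Cdiff (frameFusion Cdiff Cftime))) := ⟨part1, part2, part3⟩

end OneVarEq
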